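/- Let 0 < d < n, and let Ω ⊂ ℝⁿ be a weak local John domain with d-Ahlfors regular boundary and unbounded complement. Let A : Ω → ℝ^{n×n} satisfy the weighted ellipticity conditions, L = −div A∇, and L* = −div A^T∇. Let 1 ≤ p ≤ ∞, 1 ≤ β ≤ ∞ and s ∈ ℝ, and let p', β' be the Hölder conjugates. If the L^p_{av,β,s}(Ω)-Poisson problem for L is compatibly solvable, then the L^{p'}_{av,β',1−s}(Ω)-Poisson problem for L* is compatibly solvable. -/

import Mathlib

open MeasureTheory Metric Set Filter
open scoped ENNReal NNReal Topology RealInnerProductSpace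

noncomputable section

namespace Paper

/-- Euclidean space `ℝⁿ`. -/
abbrev Euc (n : ℕ) : Type := EuclideanSpace ℝ (Fin n)

variable {n : ℕ}

/-- `δ(x)`: the distance from `x` to the boundary of `Ω`. -/
def bd (Ω : Set (Euc n)) (x : Euc n) : ℝ := Metric.infDist x (frontier Ω)

/-- `σ`: the `d`-dimensional Hausdorff measure on `ℝⁿ`. -/
def hm (n : ℕ) (d : ℝ) : Measure (Euc n) := μH[d]

/-- `Γ ⊆ ℝⁿ` is `d`-Ahlfors regular with constant `A`:
`(1/A) rᵈ ≤ σ(B(ξ,r) ∩ Γ) ≤ A rᵈ` for all `ξ ∈ Γ` and `0 < r ≤ diam Γ`. -/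
def AhlforsRegular (d A : ℝ) (Γ : Set (Euc n)) : Prop :=
  Γ.Nonempty ∧ 0 < A ∧
    ∀ ξ ∈ Γ, ∀ r : ℝ, 0 < r → ENNReal.ofReal r ≤ EMetric.diam Γ →
      ENNReal.ofReal (r ^ d / A) ≤ hm n d (Metric.ball ξ r ∩ Γ) ∧
        hm n d (Metric.ball ξ r ∩ Γ) ≤ ENNReal.ofReal (A * r ^ d)

/-- A `λ`-carrot path from `x ∈ ∂Ω` to `y ∈ Ω`: a rectifiable curve, parameterized by
arc length (hence `1`-Lipschitz), from `x` to `y`, staying in `Ω ∪ {x}`, with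
`δ(ζ(t)) ≥ λ t`. -/
def IsCarrotPath (Ω : Set (Euc n)) (lam : ℝ) (x y : Euc n) : Prop :=
  ∃ (T : ℝ) (ζ : ℝ → Euc n), 0 ≤ T ∧ ζ 0 = x ∧ ζ T = y ∧
    LipschitzOnWith 1 ζ (Set.Icc 0 T) ∧
    (∀ t ∈ Set.Icc (0 : ℝ) T, ζ t ∈ Ω ∪ {x}) ∧
    (∀ t ∈ Set.Icc (0 : ℝ) T, lam * t ≤ bd Ω (ζ t))

/-- `y ∈ Ω` is a `(θ,λ,N)`-weak local John point. -/
def IsWLJPoint (Ω : Set (Euc n)) (d θ lam N : ℝ) (y : Euc n) : Prop :=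
  ∃ F : Set (Euc n), MeasurableSet F ∧
    F ⊆ Metric.ball y (N * bd Ω y) ∩ frontier Ω ∧
    ENNReal.ofReal θ * hm n d (Metric.ball y (N * bd Ω y) ∩ frontier Ω) ≤ hm n d F ∧
    ∀ x ∈ F, IsCarrotPath Ω lam x y

/-- The weak local John condition with specified parameters. -/
def WeakLocalJohnWith (Ω : Set (Euc n)) (d θ lam N : ℝ) : Prop :=
  0 < θ ∧ θ ≤ 1 ∧ 0 < lam ∧ lam ≤ 1 ∧ 2 ≤ N ∧ ∀ y ∈ Ω, IsWLJPoint Ω d θ lam N y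

/-- `Ω` is a weak local John domain. -/
def WeakLocalJohn (Ω : Set (Euc n)) (d : ℝ) : Prop :=
  ∃ θ lam N : ℝ, WeakLocalJohnWith Ω d θ lam N

/-- The interior corkscrew condition. -/
def InteriorCorkscrew (Ω : Set (Euc n)) : Prop :=
  ∃ ε : ℝ, 0 < ε ∧ ε < 1 ∧ ∀ x ∈ frontier Ω, ∀ r : ℝ, 0 < r →
    ENNReal.ofReal r < EMetric.diam Ω →
    ∃ z : Euc n, z ∈ Metric.ball x r ∧ Metric.ball z (ε * r) ⊆ Ω

/-- The Harnack chain condition. -/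
def HarnackChainCond (Ω : Set (Euc n)) : Prop :=
  ∃ (M m : ℝ) (Nf : ℝ → ℕ), 1 ≤ M ∧ 0 < m ∧ m < 1 ∧
    ∀ x ∈ Ω, ∀ y ∈ Ω,
      ∃ (N : ℕ) (c : Fin (N + 1) → Euc n) (r : Fin (N + 1) → ℝ),
        N ≤ Nf (dist x y / min (bd Ω x) (bd Ω y)) ∧
        x ∈ Metric.ball (c 0) (r 0) ∧ y ∈ Metric.ball (c (Fin.last N)) (r (Fin.last N)) ∧
        (∀ i : Fin N,
          (Metric.ball (c i.castSucc) (r i.castSucc) ∩ Metric.ball (c i.succ) (r i.succ)).Nonempty) ∧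
        ∀ i : Fin (N + 1), 0 < r i ∧ Metric.ball (c i) (r i) ⊆ Ω ∧
          m * (2 * r i) ≤ bd Ω (c i) - r i ∧ bd Ω (c i) - r i ≤ M * (2 * r i)

/-- The weighted ellipticity conditions
`λ δ(x)^{d+1-n} |ξ|² ≤ ξ·A(x)ξ` and `|η·A(x)ξ| ≤ Λ δ(x)^{d+1-n} |ξ||η|` on `Ω`. -/
def WeaklyElliptic (Ω : Set (Euc n)) (d lam Lam : ℝ)
    (A : Euc n → Euc n →L[ℝ] Euc n) : Prop :=
  0 < lam ∧ lam ≤ Lam ∧ (∀ v : Euc n, Measurable fun x => A x v) ∧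
    ∀ x ∈ Ω, ∀ ξ η : Euc n,
      lam * bd Ω x ^ (d + 1 - (n : ℝ)) * ‖ξ‖ ^ 2 ≤ ⟪ξ, A x ξ⟫ ∧
      |⟪η, A x ξ⟫| ≤ Lam * bd Ω x ^ (d + 1 - (n : ℝ)) * ‖ξ‖ * ‖η‖

/-- A test function on the open set `Ψ`: smooth, compactly supported, support inside `Ψ`. -/
def IsTestOn (Ψ : Set (Euc n)) (φ : Euc n → ℝ) : Prop :=
  ContDiff ℝ (⊤ : ℕ∞) φ ∧ HasCompactSupport φ ∧ tsupport φ ⊆ Ψ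

/-- `g` is the weak gradient of `u` on `Ψ`:
`∫_Ψ u ∂ᵥφ = −∫_Ψ ⟪g,v⟫ φ` for all test functions `φ` and directions `v`. -/
def HasWeakGradOn (u : Euc n → ℝ) (g : Euc n → Euc n) (Ψ : Set (Euc n)) : Prop :=
  LocallyIntegrableOn u Ψ volume ∧ LocallyIntegrableOn g Ψ volume ∧
    ∀ φ : Euc n → ℝ, IsTestOn Ψ φ → ∀ v : Euc n,
      (∫ x in Ψ, u x * fderiv ℝ φ x v) = -∫ x in Ψ, ⟪g x, v⟫ * φ x

/-- Weak formulation of `− div A ∇u = − div H` in `Ψ`, where `g` is the weak gradient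
of `u`. -/
def WeakSolOn (Ψ : Set (Euc n)) (A : Euc n → Euc n →L[ℝ] Euc n)
    (u : Euc n → ℝ) (g H : Euc n → Euc n) : Prop :=
  HasWeakGradOn u g Ψ ∧ LocallyIntegrableOn H Ψ volume ∧
    ∀ φ : Euc n → ℝ, IsTestOn Ψ φ →
      (∫ x in Ψ, ⟪gradient φ x, A x (g x)⟫) = ∫ x in Ψ, ⟪gradient φ x, H x⟫

/-- `Tr u(ξ) = 0` in the averaged sense: `r^{-n} ∫_{B(ξ,r)∩Ω} |u| → 0` as `r → 0⁺`. -/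
def TrZeroAt (Ω : Set (Euc n)) (u : Euc n → ℝ) (ξ : Euc n) : Prop :=
  Tendsto (fun r : ℝ => (1 / r ^ n) * ∫ x in Metric.ball ξ r ∩ Ω, |u x|)
    (𝓝[>] 0) (𝓝 0)

/-- The Whitney average `W_{c,β} f (y) = (⨍_{B(y, c δ(y))} |f|^β)^{1/β}`
(essential supremum if `β = ∞`), as an extended nonnegative real. -/
def wAvg (Ω : Set (Euc n)) (c : ℝ) (β : ℝ≥0∞) {F : Type*} [NormedAddCommGroup F]
    (f : Euc n → F) (y : Euc n) : ℝ≥0∞ :=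
  eLpNorm f β
    ((volume (Metric.ball y (c * bd Ω y)))⁻¹ • volume.restrict (Metric.ball y (c * bd Ω y)))

/-- The weighted averaged norm `‖f‖_{L^p_{av,c,β,s}(Ψ;Ω)}`:
`(∫_Ψ (W_{c,β}f)^p δ^{d-n+p-ps})^{1/p}`, `sup_Ψ (W_{c,β}f) δ^{1-s}` if `p = ∞`. -/
def avNormOn (Ω Ψ : Set (Euc n)) (d c : ℝ) (β p : ℝ≥0∞) (s : ℝ)
    {F : Type*} [NormedAddCommGroup F] (f : Euc n → F) : ℝ≥0∞ :=
  if p = ⊤ then ⨆ y ∈ Ψ, wAvg Ω c β f y * ENNReal.ofReal (bd Ω y) ^ (1 - s)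
  else (∫⁻ y in Ψ, wAvg Ω c β f y ^ p.toReal *
      ENNReal.ofReal (bd Ω y) ^ (d - n + p.toReal - p.toReal * s)) ^ (1 / p.toReal)

/-- The weighted averaged norm `‖f‖_{L^p_{av,c,β,s}(Ω)}`. -/
def avNorm (Ω : Set (Euc n)) (d c : ℝ) (β p : ℝ≥0∞) (s : ℝ)
    {F : Type*} [NormedAddCommGroup F] (f : Euc n → F) : ℝ≥0∞ :=
  avNormOn Ω Ω d c β p s f

/-- `f ∈ L^β_loc(Ω)`. -/
def MemLLoc (Ω : Set (Euc n)) (β : ℝ≥0∞) {F : Type*} [NormedAddCommGroup F]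
    (f : Euc n → F) : Prop :=
  AEStronglyMeasurable f (volume.restrict Ω) ∧
    ∀ K : Set (Euc n), K ⊆ Ω → IsCompact K → eLpNorm f β (volume.restrict K) < ⊤

/-- The nontangential cone `γ_a(ξ) = {x ∈ Ω : |x − ξ| < (1+a) δ(x)}`. -/
def ntCone (Ω : Set (Euc n)) (a : ℝ) (ξ : Euc n) : Set (Euc n) :=
  {x | x ∈ Ω ∧ dist x ξ < (1 + a) * bd Ω x}

/-- The nontangential maximal function `N_a f (ξ) = esssup_{γ_a(ξ)} |f|`. -/
def ntMax (Ω : Set (Euc n)) (a : ℝ) {F : Type*} [NormedAddCommGroup F]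
    (f : Euc n → F) (ξ : Euc n) : ℝ≥0∞ :=
  essSup (fun x => (‖f x‖₊ : ℝ≥0∞)) (volume.restrict (ntCone Ω a ξ))

/-- The `L^q` norm of an `ℝ≥0∞`-valued function. -/
def lqNormE (q : ℝ≥0∞) {α : Type*} [MeasurableSpace α] (μ : Measure α)
    (f : α → ℝ≥0∞) : ℝ≥0∞ :=
  if q = ⊤ then essSup f μ else (∫⁻ x, f x ^ q.toReal ∂μ) ^ (1 / q.toReal)

/-- `Tr_{a,c} u (x) = U`: `x` is in the closure of its nontangential cone, and the
Whitney averages of `|u − U|` tend to `0` nontangentially. -/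
def HasNTTrace (Ω : Set (Euc n)) (a c : ℝ) (u : Euc n → ℝ) (x : Euc n) (U : ℝ) : Prop :=
  x ∈ closure (ntCone Ω a x) ∧
    Tendsto (fun y => wAvg Ω c 1 (fun z => u z - U) y) (𝓝[ntCone Ω a x] x) (𝓝 0)


/-- The weak formulation of the Poisson equation `Lu = -div(δ^{d+1-n} H)` in `Ω`,
`g` being the weak gradient of `u`. -/
def PoissonEq {n : ℕ} (Ω : Set (Euc n)) (d : ℝ) (A : Euc n → Euc n →L[ℝ] Euc n)
    (u : Euc n → ℝ) (g H : Euc n → Euc n) : Prop :=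
  WeakSolOn Ω A u g fun x => bd Ω x ^ (d + 1 - (n : ℝ)) • H x

/-- Compatible solvability of the `L^p_{av,β,s}(Ω)`-Poisson problem for
`L = -div A ∇`: there are `C < ∞` and `c ∈ (0,1)` such that every Lax–Milgram
(i.e. `W̃^{1,2}_{av,2,1/2}`) solution with datum `H ∈ L^p_{av,β,s} ∩ L²_{av,2,1/2}`
satisfies `‖∇u‖_{L^p_{av,c,β,s}} ≤ C ‖H‖_{L^p_{av,c,β,s}}`. -/
def CompatSolvable {n : ℕ} (Ω : Set (Euc n)) (d : ℝ) (A : Euc n → Euc n →L[ℝ] Euc n)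
    (β p : ℝ≥0∞) (s : ℝ) : Prop :=
  ∃ C cc : ℝ, 0 < C ∧ 0 < cc ∧ cc < 1 ∧
    ∀ (H : Euc n → Euc n) (u : Euc n → ℝ) (g : Euc n → Euc n),
      avNorm Ω d cc β p s H < ⊤ → avNorm Ω d cc 2 2 (1 / 2) H < ⊤ →
      avNorm Ω d cc 2 2 (1 / 2) g < ⊤ → avNorm Ω d cc 2 2 (1 / 2 + 1) u < ⊤ →
      PoissonEq Ω d A u g H →
      avNorm Ω d cc β p s g ≤ ENNReal.ofReal C * avNorm Ω d cc β p s H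

section Geometry

variable {Ω : Set (Euc n)}

lemma bd_nonneg (Ω : Set (Euc n)) (x : Euc n) : 0 ≤ bd Ω x := Metric.infDist_nonneg

lemma continuous_bd (Ω : Set (Euc n)) : Continuous (bd Ω) := Metric.continuous_infDist_pt _

lemma measurable_bd (Ω : Set (Euc n)) : Measurable (bd Ω) := (continuous_bd Ω).measurable

lemma bd_le_add_dist (x y : Euc n) : bd Ω x ≤ bd Ω y + dist x y :=
  Metric.infDist_le_infDist_add_dist

lemma bd_le_dist {x ξ : Euc n} (hξ : ξ ∈ frontier Ω) : bd Ω x ≤ dist x ξ :=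
  Metric.infDist_le_dist_of_mem hξ

lemma notMem_frontier_of_mem (hΩ : IsOpen Ω) {x : Euc n} (hx : x ∈ Ω) : x ∉ frontier Ω := by
  rw [hΩ.frontier_eq]; exact fun h => h.2 hx

lemma bd_pos (hΩ : IsOpen Ω) (hne : (frontier Ω).Nonempty) {x : Euc n} (hx : x ∈ Ω) :
    0 < bd Ω x :=
  (isClosed_frontier.notMem_iff_infDist_pos hne).1 (notMem_frontier_of_mem hΩ hx)

lemma exists_nearest (hne : (frontier Ω).Nonempty) (x : Euc n) :
    ∃ ξ ∈ frontier Ω, dist x ξ = bd Ω x := by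
  obtain ⟨ξ, h, h'⟩ := isClosed_frontier.exists_infDist_eq_dist hne x
  exact ⟨ξ, h, h'.symm⟩

lemma subset_of_isPreconnected (hΩ : IsOpen Ω) {s : Set (Euc n)} (hs : IsPreconnected s)
    (hd : Disjoint s (frontier Ω)) {x : Euc n} (hxs : x ∈ s) (hx : x ∈ Ω) : s ⊆ Ω := by
  refine hs.subset_left_of_subset_union hΩ isClosed_closure.isOpen_compl
    (disjoint_compl_right.mono_left subset_closure) (fun y hy => ?_) ⟨x, hxs, hx⟩
  by_contra h
  simp only [mem_union, not_or, mem_compl_iff, not_not] at h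
  exact Set.disjoint_left.1 hd hy (by rw [hΩ.frontier_eq]; exact ⟨h.2, h.1⟩)

lemma ball_bd_subset (hΩ : IsOpen Ω) {x : Euc n} (hx : x ∈ Ω) : ball x (bd Ω x) ⊆ Ω := by
  intro y hy
  have hpos : 0 < bd Ω x := dist_nonneg.trans_lt hy
  refine subset_of_isPreconnected hΩ (convex_ball x _).isPreconnected ?_ (mem_ball_self hpos) hx hy
  rw [Set.disjoint_left]
  intro z hz hz'
  have := bd_le_dist (x := x) hz'
  rw [mem_ball, dist_comm] at hz
  linarith

/-- The power `δ ^ a` of the distance to the boundary, with values in `[0, ∞]`. -/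
def dw (Ω : Set (Euc n)) (a : ℝ) (y : Euc n) : ℝ≥0∞ := ENNReal.ofReal (bd Ω y) ^ a

lemma measurable_dw (Ω : Set (Euc n)) (a : ℝ) : Measurable (dw Ω a) :=
  (measurable_bd Ω).ennreal_ofReal.pow_const a

lemma dw_eq_ofReal {a : ℝ} {y : Euc n} (h : 0 < bd Ω y) : dw Ω a y = ENNReal.ofReal (bd Ω y ^ a) :=
  ENNReal.ofReal_rpow_of_pos h

lemma dw_ne_top {a : ℝ} {y : Euc n} (h : 0 < bd Ω y) : dw Ω a y ≠ ⊤ := by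
  rw [dw_eq_ofReal h]; exact ENNReal.ofReal_ne_top

lemma dw_ne_zero {a : ℝ} {y : Euc n} (h : 0 < bd Ω y) : dw Ω a y ≠ 0 := by
  rw [dw_eq_ofReal h]; simpa using Real.rpow_pos_of_pos h a

lemma dw_add {a b : ℝ} {y : Euc n} (h : 0 < bd Ω y) : dw Ω (a + b) y = dw Ω a y * dw Ω b y :=
  ENNReal.rpow_add _ _ (by simpa using h) ENNReal.ofReal_ne_top

lemma dw_rpow {a b : ℝ} {y : Euc n} : dw Ω a y ^ b = dw Ω (a * b) y :=
  (ENNReal.rpow_mul _ _ _).symm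

lemma rpow_le_of_comparable {r t M : ℝ} (a : ℝ) (hr : 0 < r) (ht : 0 < t) (h1 : r ≤ M * t)
    (h2 : t ≤ M * r) : r ^ a ≤ M ^ |a| * t ^ a := by
  have hM : 0 < M := by
    by_contra h
    push Not at h
    nlinarith
  rcases le_total 0 a with ha | ha
  · rw [abs_of_nonneg ha, ← Real.mul_rpow hM.le ht.le]
    exact Real.rpow_le_rpow hr.le h1 ha
  · rw [abs_of_nonpos ha]
    have : r ^ a ≤ (t / M) ^ a := Real.rpow_le_rpow_of_nonpos (by positivity)
      ((div_le_iff₀ hM).2 (by linarith)) ha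
    refine this.trans_eq ?_
    rw [Real.div_rpow ht.le hM.le, Real.rpow_neg hM.le]
    field_simp

lemma dw_le_of_comparable {M : ℝ} (a : ℝ) {x y : Euc n} (hx : 0 < bd Ω x) (hy : 0 < bd Ω y)
    (h1 : bd Ω x ≤ M * bd Ω y) (h2 : bd Ω y ≤ M * bd Ω x) :
    dw Ω a x ≤ ENNReal.ofReal (M ^ |a|) * dw Ω a y := by
  have hM : 0 < M := by
    by_contra h
    push Not at h
    nlinarith
  rw [dw_eq_ofReal hx, dw_eq_ofReal hy, ← ENNReal.ofReal_mul (by positivity)]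
  exact ENNReal.ofReal_le_ofReal (rpow_le_of_comparable a hx hy h1 h2)

lemma volume_ball_bd {c : ℝ} (hc : 0 < c) (y : Euc n) (hy : 0 < bd Ω y) :
    volume (ball y (c * bd Ω y)) =
      ENNReal.ofReal (c ^ n) * dw Ω n y * volume (ball (0 : Euc n) 1) := by
  rw [Measure.addHaar_ball_of_pos _ _ (by positivity), dw_eq_ofReal hy,
    ← ENNReal.ofReal_mul (by positivity), mul_pow, Real.rpow_natCast]
  simp

lemma setLIntegral_swap (Ω : Set (Euc n)) (K : ℝ) {w F : Euc n → ℝ≥0∞} (hw : Measurable w)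
    (hF : AEMeasurable F (volume.restrict Ω)) :
    ∫⁻ y in Ω, w y * ∫⁻ x in ball y (K * bd Ω y) ∩ Ω, F x =
      ∫⁻ x in Ω, F x * ∫⁻ y in {y | dist x y < K * bd Ω y} ∩ Ω, w y := by
  set S : Set (Euc n × Euc n) := {q | dist q.2 q.1 < K * bd Ω q.1} with hS
  have hSo : MeasurableSet S := by
    apply measurableSet_lt
    · exact (measurable_snd.dist measurable_fst)
    · exact ((measurable_bd Ω).comp measurable_fst).const_mul K
  have hm1 : ∀ y, MeasurableSet (ball y (K * bd Ω y)) := fun y => measurableSet_ball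
  have hm2 : ∀ x, MeasurableSet {y | dist x y < K * bd Ω y} := fun x =>
    measurableSet_lt (measurable_const.dist measurable_id) ((measurable_bd Ω).const_mul K)
  have h1 : ∀ y, w y * ∫⁻ x in ball y (K * bd Ω y) ∩ Ω, F x =
      ∫⁻ x in Ω, S.indicator (fun q => w q.1 * F q.2) (y, x) := by
    intro y
    rw [← Measure.restrict_restrict (hm1 y), ← lintegral_indicator (hm1 y),
      ← lintegral_const_mul'' _ (hF.indicator (hm1 y))]
    refine lintegral_congr fun x => ?_
    by_cases h : dist x y < K * bd Ω y
    · simp [Set.indicator, S, h]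
    · simp [Set.indicator, S, h]
  have h2 : ∀ x, F x * ∫⁻ y in {y | dist x y < K * bd Ω y} ∩ Ω, w y =
      ∫⁻ y in Ω, S.indicator (fun q => w q.1 * F q.2) (y, x) := by
    intro x
    rw [← Measure.restrict_restrict (hm2 x), ← lintegral_indicator (hm2 x),
      ← lintegral_const_mul _ (hw.indicator (hm2 x))]
    refine lintegral_congr fun y => ?_
    by_cases h : dist x y < K * bd Ω y
    · simp [Set.indicator, S, h, mul_comm]
    · simp [Set.indicator, S, h]
  simp_rw [h1, h2]
  apply lintegral_lintegral_swap
  apply AEMeasurable.indicator _ hSo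
  exact (hw.comp measurable_fst).aemeasurable.mul hF.comp_snd

lemma bd_le_of_dist_lt {c : ℝ} {x y : Euc n} (h : dist x y < c * bd Ω y) :
    (1 - c) * bd Ω y ≤ bd Ω x ∧ bd Ω x ≤ (1 + c) * bd Ω y := by
  have h1 := bd_le_add_dist (Ω := Ω) x y
  have h2 := bd_le_add_dist (Ω := Ω) y x
  rw [dist_comm] at h2
  constructor <;> linarith

lemma ball_mul_bd_subset (hΩ : IsOpen Ω) {c : ℝ} (hc1 : c ≤ 1) {y : Euc n} (hy : y ∈ Ω) :
    ball y (c * bd Ω y) ⊆ Ω :=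
  (ball_subset_ball (by nlinarith [bd_nonneg Ω y])).trans (ball_bd_subset hΩ hy)

/-- Integrating averages over Whitney balls against a power of `δ` is the same, up to constants,
as integrating the function itself. -/
lemma exists_lintegral_average_comparable (hΩ : IsOpen Ω) (hne : (frontier Ω).Nonempty) {c : ℝ}
    (hc : 0 < c) (hc1 : c < 1) (a : ℝ) :
    ∃ C : ℝ≥0, ∀ F : Euc n → ℝ≥0∞, AEMeasurable F (volume.restrict Ω) →
      (∫⁻ x in Ω, F x * dw Ω a x) ≤ C * ∫⁻ y in Ω,
        (volume (ball y (c * bd Ω y)))⁻¹ * (∫⁻ x in ball y (c * bd Ω y), F x) * dw Ω a y ∧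
      (∫⁻ y in Ω, (volume (ball y (c * bd Ω y)))⁻¹ * (∫⁻ x in ball y (c * bd Ω y), F x) * dw Ω a y)
        ≤ C * ∫⁻ x in Ω, F x * dw Ω a x := by
  have hc1' : 0 < 1 - c := by linarith
  set v := volume (ball (0 : Euc n) 1) with hv
  have hv0 : v ≠ 0 := (measure_ball_pos _ _ one_pos).ne'
  have hvt : v ≠ ⊤ := measure_ball_lt_top.ne
  set M : ℝ := (1 + c) / (1 - c) with hM
  have hMpos : 0 < M := by positivity
  have hM1 : 1 + c ≤ M := by
    rw [hM, le_div_iff₀ hc1']; nlinarith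
  have hM2 : 1 / (1 - c) ≤ M := by
    rw [hM]; gcongr; linarith
  set c0 : ℝ≥0∞ := (ENNReal.ofReal (c ^ n) * v)⁻¹ with hc0
  have hcn : ENNReal.ofReal (c ^ n) ≠ 0 := by simpa using pow_pos hc n
  have hc0t : c0 ≠ ⊤ := by simp [c0, hv0, hc]
  have hc00 : c0 ≠ 0 := ENNReal.inv_ne_zero.2 (ENNReal.mul_ne_top ENNReal.ofReal_ne_top hvt)
  have hV : ∀ y ∈ Ω, (volume (ball y (c * bd Ω y)))⁻¹ = c0 * dw Ω (-n) y := by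
    intro y hy
    have hb := bd_pos hΩ hne hy
    rw [volume_ball_bd hc y hb, hc0, mul_right_comm, ENNReal.mul_inv (.inr (dw_ne_top hb))
      (.inr (dw_ne_zero hb))]
    congr 1
    rw [dw, dw, ENNReal.rpow_neg]
  set k : Euc n → ℝ≥0∞ := fun x => ∫⁻ y in {y | dist x y < c * bd Ω y} ∩ Ω, c0 * dw Ω (a - n) y
    with hk
  have hrw : ∀ F : Euc n → ℝ≥0∞, AEMeasurable F (volume.restrict Ω) →
      (∫⁻ y in Ω, (volume (ball y (c * bd Ω y)))⁻¹ * (∫⁻ x in ball y (c * bd Ω y), F x) * dw Ω a y)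
        = ∫⁻ x in Ω, F x * k x := by
    intro F hF
    rw [← setLIntegral_swap Ω c ((measurable_dw Ω (a - n)).const_mul c0) hF]
    refine setLIntegral_congr_fun hΩ.measurableSet fun y hy => ?_
    rw [inter_eq_left.2 (ball_mul_bd_subset hΩ hc1.le hy), hV y hy, sub_eq_add_neg, add_comm,
      dw_add (bd_pos hΩ hne hy)]
    ring
  have hcomp : ∀ x y, y ∈ Ω → dist x y < c * bd Ω y →
      bd Ω x ≤ M * bd Ω y ∧ bd Ω y ≤ M * bd Ω x := by
    intro x y hy h
    obtain ⟨h1, h2⟩ := bd_le_of_dist_lt h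
    have hb := bd_pos hΩ hne hy
    constructor
    · nlinarith
    · have : bd Ω y ≤ (1 / (1 - c)) * bd Ω x := by
        rw [one_div, ← div_eq_inv_mul, le_div_iff₀ hc1']; linarith
      exact this.trans (by gcongr; exact bd_nonneg _ _)
  set D : ℝ≥0∞ := c0 * ENNReal.ofReal (M ^ |a - n|) with hD
  have hMa : ENNReal.ofReal (M ^ |a - n|) ≠ 0 := by simpa using Real.rpow_pos_of_pos hMpos _
  have hup : ∀ x ∈ Ω, k x ≤ D * ENNReal.ofReal ((c * M) ^ n) * v * dw Ω a x := by
    intro x hx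
    have hbx := bd_pos hΩ hne hx
    calc k x ≤ ∫⁻ y in {y | dist x y < c * bd Ω y} ∩ Ω, D * dw Ω (a - n) x := by
          refine setLIntegral_mono measurable_const fun y hy => ?_
          obtain ⟨h1, h2⟩ := hcomp x y hy.2 hy.1
          rw [hD, mul_assoc]
          gcongr
          exact dw_le_of_comparable _ (bd_pos hΩ hne hy.2) hbx h2 h1
      _ = D * dw Ω (a - n) x * volume ({y | dist x y < c * bd Ω y} ∩ Ω) := by
          rw [setLIntegral_const]
      _ ≤ D * dw Ω (a - n) x * volume (ball x ((c * M) * bd Ω x)) := by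
          gcongr
          intro y hy
          obtain ⟨h1, h2⟩ := hcomp x y hy.2 hy.1
          rw [mem_ball, dist_comm]
          have h3 : dist x y < c * bd Ω y := hy.1
          calc dist x y < c * bd Ω y := h3
            _ ≤ c * M * bd Ω x := by rw [mul_assoc]; gcongr
      _ = D * ENNReal.ofReal ((c * M) ^ n) * v * dw Ω a x := by
          rw [volume_ball_bd (by positivity) x hbx, show dw Ω a x = dw Ω (a - n) x * dw Ω n x by
            rw [← dw_add hbx]; ring_nf]
          ring
  have hlow : ∀ x ∈ Ω, dw Ω a x ≤ c0⁻¹ * ENNReal.ofReal (M ^ |a - n|) *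
      (ENNReal.ofReal ((c / (1 + c)) ^ n) * v)⁻¹ * k x := by
    intro x hx
    have hbx := bd_pos hΩ hne hx
    have hsub : ball x (c / (1 + c) * bd Ω x) ⊆ {y | dist x y < c * bd Ω y} ∩ Ω := by
      intro y hy
      have hy' : dist y x < c / (1 + c) * bd Ω x := hy
      have h1 : (1 - c / (1 + c)) * bd Ω x ≤ bd Ω y := (bd_le_of_dist_lt hy').1
      have h2 : 1 - c / (1 + c) = 1 / (1 + c) := by field_simp; ring
      rw [h2] at h1
      refine ⟨?_, ball_mul_bd_subset hΩ ((div_le_one (by positivity)).2 (by linarith)) hx hy⟩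
      change dist x y < _
      rw [dist_comm]
      calc dist y x < c / (1 + c) * bd Ω x := hy'
        _ = c * (1 / (1 + c) * bd Ω x) := by ring
        _ ≤ c * bd Ω y := by gcongr
    have h1 : dw Ω a x * (ENNReal.ofReal ((c / (1 + c)) ^ n) * v) ≤
        (c0⁻¹ * ENNReal.ofReal (M ^ |a - n|)) * k x := by
      calc dw Ω a x * (ENNReal.ofReal ((c / (1 + c)) ^ n) * v)
          = dw Ω (a - n) x * volume (ball x (c / (1 + c) * bd Ω x)) := by
            rw [volume_ball_bd (by positivity) x hbx, show dw Ω a x = dw Ω (a - n) x * dw Ω n x by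
              rw [← dw_add hbx]; ring_nf]
            ring
        _ = ∫⁻ y in ball x (c / (1 + c) * bd Ω x), dw Ω (a - n) x := by rw [setLIntegral_const]
        _ ≤ ∫⁻ y in ball x (c / (1 + c) * bd Ω x),
              (c0⁻¹ * ENNReal.ofReal (M ^ |a - n|)) * (c0 * dw Ω (a - n) y) := by
            refine setLIntegral_mono (((measurable_dw _ _).const_mul _).const_mul _) fun y hy => ?_
            obtain ⟨h1, h2⟩ := hcomp x y (hsub hy).2 (hsub hy).1
            refine (dw_le_of_comparable (a - n) hbx (bd_pos hΩ hne (hsub hy).2) h1 h2).trans_eq ?_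
            calc _ = (c0⁻¹ * c0) * (ENNReal.ofReal (M ^ |a - n|) * dw Ω (a - n) y) := by
                  rw [ENNReal.inv_mul_cancel hc00 hc0t, one_mul]
              _ = _ := by ring
        _ ≤ ∫⁻ y in {y | dist x y < c * bd Ω y} ∩ Ω,
              (c0⁻¹ * ENNReal.ofReal (M ^ |a - n|)) * (c0 * dw Ω (a - n) y) :=
            lintegral_mono_set hsub
        _ = _ := by rw [lintegral_const_mul _ ((measurable_dw _ _).const_mul _)]
    have hz : ENNReal.ofReal ((c / (1 + c)) ^ n) * v ≠ 0 := mul_ne_zero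
      (by simpa using pow_pos (by positivity : 0 < c / (1 + c)) n) hv0
    rw [mul_right_comm, ← div_eq_mul_inv (_ * k x),
      ENNReal.le_div_iff_mul_le (.inl hz) (.inl (ENNReal.mul_ne_top ENNReal.ofReal_ne_top hvt))]
    exact h1
  obtain ⟨C1, hC1⟩ : ∃ C1 : ℝ≥0, (C1 : ℝ≥0∞) = D * ENNReal.ofReal ((c * M) ^ n) * v := by
    refine ⟨_, ENNReal.coe_toNNReal ?_⟩
    exact ENNReal.mul_ne_top (ENNReal.mul_ne_top (ENNReal.mul_ne_top hc0t ENNReal.ofReal_ne_top)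
      ENNReal.ofReal_ne_top) hvt
  obtain ⟨C2, hC2⟩ : ∃ C2 : ℝ≥0, (C2 : ℝ≥0∞) = c0⁻¹ * ENNReal.ofReal (M ^ |a - n|) *
      (ENNReal.ofReal ((c / (1 + c)) ^ n) * v)⁻¹ := by
    refine ⟨_, ENNReal.coe_toNNReal ?_⟩
    refine ENNReal.mul_ne_top (ENNReal.mul_ne_top (ENNReal.inv_ne_top.2 hc00)
      ENNReal.ofReal_ne_top) (ENNReal.inv_ne_top.2 (mul_ne_zero ?_ hv0))
    simpa using pow_pos (by positivity : 0 < c / (1 + c)) n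
  refine ⟨C1 + C2, fun F hF => ?_⟩
  rw [hrw F hF]
  constructor
  · calc ∫⁻ x in Ω, F x * dw Ω a x ≤ ∫⁻ x in Ω, C2 * (F x * k x) := by
          refine setLIntegral_mono' hΩ.measurableSet fun x hx => ?_
          calc F x * dw Ω a x ≤ F x * (C2 * k x) := by gcongr; rw [hC2]; exact hlow x hx
            _ = _ := by ring
      _ = C2 * ∫⁻ x in Ω, F x * k x := lintegral_const_mul' _ _ ENNReal.coe_ne_top
      _ ≤ _ := by gcongr; exact_mod_cast le_add_self
  · calc ∫⁻ x in Ω, F x * k x ≤ ∫⁻ x in Ω, C1 * (F x * dw Ω a x) := by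
          refine setLIntegral_mono' hΩ.measurableSet fun x hx => ?_
          calc F x * k x ≤ F x * (C1 * dw Ω a x) := by gcongr; rw [hC1]; exact hup x hx
            _ = _ := by ring
      _ = C1 * ∫⁻ x in Ω, F x * dw Ω a x := lintegral_const_mul' _ _ ENNReal.coe_ne_top
      _ ≤ _ := by gcongr; exact_mod_cast le_self_add

end Geometry

section Pairing

variable {Ω : Set (Euc n)} {E F : Type*} [NormedAddCommGroup E] [NormedAddCommGroup F]

lemma measurable_setLIntegral_ball (Ω : Set (Euc n)) (c : ℝ) {φ : Euc n → ℝ≥0∞}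
    (hφ : Measurable φ) : Measurable fun y => ∫⁻ x in ball y (c * bd Ω y), φ x := by
  set S : Set (Euc n × Euc n) := {q | dist q.2 q.1 < c * bd Ω q.1} with hS
  have hSo : MeasurableSet S := measurableSet_lt (measurable_snd.dist measurable_fst)
    (((measurable_bd Ω).comp measurable_fst).const_mul c)
  have h : ∀ y, ∫⁻ x in ball y (c * bd Ω y), φ x = ∫⁻ x, S.indicator (fun q => φ q.2) (y, x) := by
    intro y
    rw [← lintegral_indicator measurableSet_ball]
    refine lintegral_congr fun x => ?_
    by_cases h : dist x y < c * bd Ω y <;> simp [Set.indicator, S, h]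
  simp_rw [h]
  exact ((hφ.comp measurable_snd).indicator hSo).lintegral_prod_right'

/-- Normalized Lebesgue measure on the Whitney ball around `y`. -/
def avMeasure (Ω : Set (Euc n)) (c : ℝ) (y : Euc n) : Measure (Euc n) :=
  (volume (ball y (c * bd Ω y)))⁻¹ • volume.restrict (ball y (c * bd Ω y))

lemma measurable_lintegral_avMeasure (Ω : Set (Euc n)) (c : ℝ) {φ : Euc n → ℝ≥0∞}
    (hφ : Measurable φ) : Measurable fun y => ∫⁻ x, φ x ∂(avMeasure Ω c y) := by
  simp only [avMeasure, lintegral_smul_measure, smul_eq_mul]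
  refine Measurable.mul (Measurable.inv ?_) (measurable_setLIntegral_ball Ω c hφ)
  simpa using measurable_setLIntegral_ball Ω c (measurable_const (a := (1 : ℝ≥0∞)))

lemma avMeasure_absolutelyContinuous (hΩ : IsOpen Ω) {c : ℝ} (hc1 : c ≤ 1) {y : Euc n}
    (hy : y ∈ Ω) : avMeasure Ω c y ≪ volume.restrict Ω :=
  (Measure.smul_absolutelyContinuous).trans
    (Measure.absolutelyContinuous_of_le
      (Measure.restrict_mono (ball_mul_bd_subset hΩ hc1 hy) le_rfl))

lemma aemeasurable_wAvg (hΩ : IsOpen Ω) {c : ℝ} (hc1 : c ≤ 1) (β : ℝ≥0∞) {f : Euc n → E}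
    (hf : AEStronglyMeasurable f (volume.restrict Ω)) :
    AEMeasurable (wAvg Ω c β f) (volume.restrict Ω) := by
  set f' := hf.mk f with hf'
  have hm : StronglyMeasurable f' := hf.stronglyMeasurable_mk
  have hme : Measurable fun x => ‖f' x‖ₑ := hm.enorm
  have key : Measurable (wAvg Ω c β f') := by
    have h1 : ∀ y, wAvg Ω c β f' y = eLpNorm f' β (avMeasure Ω c y) := fun _ => rfl
    rw [show wAvg Ω c β f' = fun y => eLpNorm f' β (avMeasure Ω c y) from funext h1]
    rcases eq_or_ne β 0 with rfl | h0
    · simp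
    rcases eq_or_ne β ⊤ with rfl | ht
    · refine measurable_of_Ioi fun t => ?_
      have : (fun y => eLpNorm f' ⊤ (avMeasure Ω c y)) ⁻¹' Ioi t =
          {y | ∫⁻ x, ({x | t < ‖f' x‖ₑ}).indicator 1 x ∂(avMeasure Ω c y) ≠ 0} := by
        ext y
        rw [mem_preimage, mem_Ioi, mem_ofPred_eq,
          lintegral_indicator_one (measurableSet_lt measurable_const hme), ← not_le, not_iff_not,
          eLpNorm_exponent_top, eLpNormEssSup]
        constructor
        · intro h
          have := ae_le_essSup (f := fun x => ‖f' x‖ₑ) (μ := avMeasure Ω c y)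
          have h2 : ∀ᵐ x ∂(avMeasure Ω c y), ‖f' x‖ₑ ≤ t := this.mono fun x hx => hx.trans h
          simpa [ae_iff] using h2
        · intro h
          refine essSup_le_of_ae_le _ ?_
          rw [EventuallyLE, ae_iff]
          simpa using h
      rw [this]
      exact (measurable_lintegral_avMeasure Ω c (measurable_one.indicator
        (measurableSet_lt measurable_const hme))) (measurableSet_singleton 0).compl
    · simp_rw [eLpNorm_eq_lintegral_rpow_enorm_toReal h0 ht]
      exact (measurable_lintegral_avMeasure Ω c (hme.pow_const _)).pow_const _
  refine ⟨_, key, ?_⟩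
  filter_upwards [ae_restrict_mem hΩ.measurableSet] with y hy
  exact eLpNorm_congr_ae ((avMeasure_absolutelyContinuous hΩ hc1 hy).ae_eq hf.ae_eq_mk)

lemma average_mul_le_wAvg_mul_wAvg (hΩ : IsOpen Ω) {c : ℝ} (hc1 : c ≤ 1) {β β' : ℝ≥0∞}
    (hβ : 1 / β + 1 / β' = 1) {f : Euc n → E} {g : Euc n → F}
    (hf : AEStronglyMeasurable f (volume.restrict Ω))
    (hg : AEStronglyMeasurable g (volume.restrict Ω)) {y : Euc n} (hy : y ∈ Ω) :
    (volume (ball y (c * bd Ω y)))⁻¹ * (∫⁻ x in ball y (c * bd Ω y), ‖f x‖ₑ * ‖g x‖ₑ) ≤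
      wAvg Ω c β f y * wAvg Ω c β' g y := by
  have : ENNReal.HolderConjugate β β' := by
    rw [ENNReal.holderConjugate_iff]; simpa using hβ
  have hac := avMeasure_absolutelyContinuous hΩ hc1 hy
  have := eLpNorm_le_eLpNorm_mul_eLpNorm_of_nnnorm (p := β) (q := β') (r := 1)
    (hf.norm.mono_ac hac) (hg.norm.mono_ac hac) (fun a b : ℝ => a * b) 1
    (Eventually.of_forall fun x => by simp)
  rw [ENNReal.coe_one, one_mul, eLpNorm_norm, eLpNorm_norm, eLpNorm_one_eq_lintegral_enorm] at this
  refine le_trans (le_of_eq ?_) this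
  simp [avMeasure, lintegral_smul_measure, enorm_mul]

/-- The exponent of `δ` in the `L^p` form of the averaged norm. -/
def avExp (n : ℕ) (d : ℝ) (p : ℝ≥0∞) (s : ℝ) : ℝ := (d - n) / p.toReal + 1 - s

lemma toReal_inv_add_toReal_inv {p p' : ℝ≥0∞} (hp : 1 / p + 1 / p' = 1) :
    p.toReal⁻¹ + p'.toReal⁻¹ = 1 := by
  have h0 : 1 / p ≠ ⊤ := fun h => by simp [h] at hp
  have h0' : 1 / p' ≠ ⊤ := fun h => by simp [h] at hp
  have h := congrArg ENNReal.toReal hp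
  rw [ENNReal.toReal_add h0 h0'] at h
  simpa using h

lemma avExp_add_avExp (n : ℕ) (d : ℝ) {p p' : ℝ≥0∞} (hp : 1 / p + 1 / p' = 1) (s : ℝ) :
    avExp n d p s + avExp n d p' (1 - s) = d + 1 - n := by
  simp only [avExp, div_eq_mul_inv]
  linear_combination (d - n) * toReal_inv_add_toReal_inv hp

lemma avNorm_of_ne_top (hΩ : IsOpen Ω) (d c : ℝ) (β : ℝ≥0∞) {p : ℝ≥0∞} (s : ℝ)
    (hp0 : p ≠ 0) (hp : p ≠ ⊤) (f : Euc n → E) :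
    avNorm Ω d c β p s f =
      (∫⁻ y in Ω, (wAvg Ω c β f y * dw Ω (avExp n d p s) y) ^ p.toReal) ^ (1 / p.toReal) := by
  have hpos : 0 < p.toReal := ENNReal.toReal_pos hp0 hp
  rw [avNorm, avNormOn, if_neg hp]
  congr 1
  refine setLIntegral_congr_fun hΩ.measurableSet fun y _ => ?_
  rw [ENNReal.mul_rpow_of_nonneg _ _ hpos.le, dw_rpow, dw, avExp]
  congr 2
  field_simp

lemma avNorm_top (d c : ℝ) (β : ℝ≥0∞) (s : ℝ) (f : Euc n → E) :
    avNorm Ω d c β ⊤ s f = ⨆ y ∈ Ω, wAvg Ω c β f y * dw Ω (avExp n d ⊤ s) y := by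
  simp [avNorm, avNormOn, dw, avExp]

lemma lintegral_wAvg_mul_le (hΩ : IsOpen Ω) (hne : (frontier Ω).Nonempty) (d : ℝ) {c : ℝ}
    (hc1 : c ≤ 1) (β β' : ℝ≥0∞) {p p' : ℝ≥0∞} (hp : 1 / p + 1 / p' = 1) (s : ℝ)
    {f : Euc n → E} {g : Euc n → F} (hf : AEStronglyMeasurable f (volume.restrict Ω))
    (hg : AEStronglyMeasurable g (volume.restrict Ω)) :
    ∫⁻ y in Ω, wAvg Ω c β f y * wAvg Ω c β' g y * dw Ω (d + 1 - n) y ≤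
      avNorm Ω d c β p s f * avNorm Ω d c β' p' (1 - s) g := by
  have hpq : ENNReal.HolderConjugate p p' := by
    rw [ENNReal.holderConjugate_iff]; simpa using hp
  have hp1 : 1 ≤ p := ENNReal.HolderConjugate.one_le p p'
  have hp'1 : 1 ≤ p' := ENNReal.HolderConjugate.one_le p' p
  set U := fun y => wAvg Ω c β f y * dw Ω (avExp n d p s) y with hU
  set U' := fun y => wAvg Ω c β' g y * dw Ω (avExp n d p' (1 - s)) y with hU'
  have hUm : AEMeasurable U (volume.restrict Ω) :=
    (aemeasurable_wAvg hΩ hc1 β hf).mul (measurable_dw _ _).aemeasurable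
  have hUm' : AEMeasurable U' (volume.restrict Ω) :=
    (aemeasurable_wAvg hΩ hc1 β' hg).mul (measurable_dw _ _).aemeasurable
  have hexp := avExp_add_avExp n d hp s
  have h1 : ∫⁻ y in Ω, wAvg Ω c β f y * wAvg Ω c β' g y * dw Ω (d + 1 - n) y =
      ∫⁻ y in Ω, (U * U') y := by
    refine setLIntegral_congr_fun hΩ.measurableSet fun y hy => ?_
    simp only [Pi.mul_apply, U, U']
    rw [← hexp, dw_add (bd_pos hΩ hne hy)]
    ring
  have hsup : ∀ (V W : Euc n → ℝ≥0∞), AEMeasurable W (volume.restrict Ω) →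
      ∫⁻ y in Ω, V y * W y ≤ (⨆ y ∈ Ω, V y) * ∫⁻ y in Ω, W y := by
    intro V W hW
    rw [← lintegral_const_mul'' _ hW]
    exact setLIntegral_mono' hΩ.measurableSet fun y hy =>
      mul_le_mul_left (le_iSup₂ (f := fun y _ => V y) y hy) _
  rw [h1]
  rcases eq_or_ne p ⊤ with rfl | hpt
  · obtain rfl : p' = 1 := by simpa using hp
    rw [avNorm_top, avNorm_of_ne_top hΩ d c β' (1 - s) one_ne_zero ENNReal.one_ne_top]
    simpa using hsup U U' hUm'
  rcases eq_or_ne p' ⊤ with rfl | hpt'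
  · obtain rfl : p = 1 := by simpa using hp
    rw [avNorm_top, avNorm_of_ne_top hΩ d c β s one_ne_zero ENNReal.one_ne_top,
      mul_comm (_ ^ _), mul_comm U]
    simpa using hsup U' U hUm
  rw [avNorm_of_ne_top hΩ d c β s (one_pos.trans_le hp1).ne' hpt,
    avNorm_of_ne_top hΩ d c β' (1 - s) (one_pos.trans_le hp'1).ne' hpt']
  refine ENNReal.lintegral_mul_le_Lp_mul_Lq _ ?_ hUm hUm'
  have h0 := (one_pos.trans_le hp1).ne'
  have h0' := (one_pos.trans_le hp'1).ne'
  have hr := toReal_inv_add_toReal_inv hp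
  exact Real.holderConjugate_iff.2 ⟨lt_of_le_of_ne (by
    simpa using ENNReal.toReal_mono hpt hp1) fun h => by
      rw [← h] at hr
      have : (0 : ℝ) < p'.toReal⁻¹ := inv_pos.2 (ENNReal.toReal_pos h0' hpt')
      simp only [inv_one, add_eq_left] at hr
      exact this.ne' hr, hr⟩

lemma exists_lintegral_mul_le_avNorm_mul_avNorm (hΩ : IsOpen Ω) (hne : (frontier Ω).Nonempty)
    (d : ℝ) {c : ℝ} (hc : 0 < c) (hc1 : c < 1) {β β' : ℝ≥0∞} (hβ : 1 / β + 1 / β' = 1)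
    {p p' : ℝ≥0∞} (hp : 1 / p + 1 / p' = 1) (s : ℝ) :
    ∃ C : ℝ≥0, ∀ (f : Euc n → E) (g : Euc n → F),
      AEStronglyMeasurable f (volume.restrict Ω) → AEStronglyMeasurable g (volume.restrict Ω) →
      ∫⁻ x in Ω, ‖f x‖ₑ * ‖g x‖ₑ * dw Ω (d + 1 - n) x ≤
        C * (avNorm Ω d c β p s f * avNorm Ω d c β' p' (1 - s) g) := by
  obtain ⟨C, hC⟩ := exists_lintegral_average_comparable hΩ hne hc hc1 (d + 1 - n)
  refine ⟨C, fun f g hf hg => ((hC _ (hf.enorm.mul hg.enorm)).1).trans ?_⟩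
  gcongr
  refine le_trans (setLIntegral_mono' hΩ.measurableSet fun y hy => ?_)
    (lintegral_wAvg_mul_le hΩ hne d hc1.le β β' hp s hf hg)
  refine mul_le_mul_left ?_ _
  exact average_mul_le_wAvg_mul_wAvg hΩ hc1.le hβ hf hg hy

end Pairing

section Duality

/-- On a finite measure space the `L^q` norm of a bounded function is attained, up to a factor
`2`, by pairing with a bounded function in the unit ball of the dual space. -/
lemma exists_dual_le {α : Type*} [MeasurableSpace α] (μ : Measure α) [IsFiniteMeasure μ]
    {p q : ℝ≥0∞} (hpq : 1 / p + 1 / q = 1) {f : α → ℝ≥0∞} (hf : Measurable f) {M : ℝ≥0∞}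
    (hM : M ≠ ⊤) (hfM : ∀ x, f x ≤ M) :
    ∃ (h : α → ℝ≥0∞) (M' : ℝ≥0∞), Measurable h ∧ M' ≠ ⊤ ∧ (∀ x, h x ≤ M') ∧
      eLpNorm h p μ ≤ 1 ∧ eLpNorm f q μ ≤ 2 * ∫⁻ x, f x * h x ∂μ := by
  have hc : ENNReal.HolderConjugate p q := by
    rw [ENNReal.holderConjugate_iff]; simpa using hpq
  have hp1 : 1 ≤ p := ENNReal.HolderConjugate.one_le p q
  have hq1 : 1 ≤ q := ENNReal.HolderConjugate.one_le q p
  have hp0 : p ≠ 0 := (one_pos.trans_le hp1).ne'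
  have hq0 : q ≠ 0 := (one_pos.trans_le hq1).ne'
  set S := eLpNorm f q μ with hS
  rcases eq_or_ne S 0 with h0 | h0
  · exact ⟨0, 0, measurable_zero, ENNReal.zero_ne_top, fun x => le_rfl, by simp, by simp [h0]⟩
  have hμ0 : μ ≠ 0 := by
    rintro rfl; simp [S] at h0
  rcases eq_or_ne q ⊤ with rfl | hqt
  · obtain rfl : p = 1 := by simpa using hpq
    have hSt : S ≠ ⊤ := by
      refine (lt_of_le_of_lt ?_ hM.lt_top).ne
      rw [hS, eLpNorm_exponent_top, eLpNormEssSup]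
      exact essSup_le_of_ae_le _ (Eventually.of_forall hfM)
    set A := {x | S / 2 < f x} with hA
    have hAm : MeasurableSet A := measurableSet_lt measurable_const hf
    have hA0 : μ A ≠ 0 := by
      intro h
      have : S ≤ S / 2 := by
        conv_lhs => rw [hS, eLpNorm_exponent_top, eLpNormEssSup]
        refine essSup_le_of_ae_le _ ?_
        rw [EventuallyLE, ae_iff]
        simpa [A] using h
      exact absurd this (not_le.2 (ENNReal.half_lt_self h0 hSt))
    have hAt : μ A ≠ ⊤ := measure_ne_top _ _
    refine ⟨A.indicator fun _ => (μ A)⁻¹, (μ A)⁻¹, measurable_const.indicator hAm,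
      ENNReal.inv_ne_top.2 hA0, fun x => indicator_le_self' (fun _ _ => zero_le) _, ?_, ?_⟩
    · rw [eLpNorm_one_eq_lintegral_enorm]
      simp only [enorm_eq_self]
      rw [lintegral_indicator hAm, setLIntegral_const, ENNReal.inv_mul_cancel hA0 hAt]
    · have : S / 2 ≤ ∫⁻ x, f x * A.indicator (fun _ => (μ A)⁻¹) x ∂μ := by
        calc S / 2 = ∫⁻ x in A, S / 2 * (μ A)⁻¹ ∂μ := by
              rw [setLIntegral_const, mul_assoc, ENNReal.inv_mul_cancel hA0 hAt, mul_one]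
          _ ≤ ∫⁻ x in A, f x * (μ A)⁻¹ ∂μ :=
              setLIntegral_mono' hAm fun x hx => mul_le_mul_left (le_of_lt hx) _
          _ = _ := by
              rw [← lintegral_indicator hAm]
              refine lintegral_congr fun x => ?_
              by_cases hx : x ∈ A <;> simp [hx]
      calc S = 2 * (S / 2) := (ENNReal.mul_div_cancel (by simp) (by simp)).symm
        _ ≤ _ := by gcongr
  have hqr : 0 < q.toReal := ENNReal.toReal_pos hq0 hqt
  have hSI : S ^ q.toReal = ∫⁻ x, f x ^ q.toReal ∂μ := by
    rw [hS, eLpNorm_eq_lintegral_rpow_enorm_toReal hq0 hqt, ← ENNReal.rpow_mul,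
      one_div_mul_cancel hqr.ne', ENNReal.rpow_one]
    rfl
  have hSt : S ≠ ⊤ := by
    have : S ^ q.toReal ≠ ⊤ := by
      rw [hSI]
      refine (lt_of_le_of_lt (lintegral_mono fun x =>
        ENNReal.rpow_le_rpow (hfM x) hqr.le) ?_).ne
      rw [lintegral_const]
      exact ENNReal.mul_lt_top (ENNReal.rpow_lt_top_of_nonneg hqr.le hM) (measure_lt_top _ _)
    intro h
    rw [h, ENNReal.top_rpow_of_pos hqr] at this
    exact this rfl
  have hq1r : 1 ≤ q.toReal := by simpa using ENNReal.toReal_mono hqt hq1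
  have hq1r' : 0 ≤ q.toReal - 1 := by linarith
  have h2 : ∫⁻ x, (f x / S) ^ q.toReal ∂μ = 1 := by
    simp_rw [ENNReal.div_rpow_of_nonneg _ _ hqr.le, div_eq_mul_inv]
    rw [lintegral_mul_const _ (hf.pow_const _), ← hSI,
      ENNReal.mul_inv_cancel (by simp [h0, hSt]) (by simp [hSt, h0])]
  refine ⟨fun x => (f x / S) ^ (q.toReal - 1), (M / S) ^ (q.toReal - 1),
    (hf.div_const _).pow_const _, ENNReal.rpow_ne_top_of_nonneg hq1r'
      (ENNReal.div_ne_top hM h0), fun x => ?_, ?_, ?_⟩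
  · exact ENNReal.rpow_le_rpow (ENNReal.div_le_div_right (hfM x) _) hq1r'
  · rcases eq_or_ne p ⊤ with rfl | hpt
    · obtain rfl : q = 1 := by simpa using hpq
      simp only [ENNReal.toReal_one, sub_self, ENNReal.rpow_zero]
      rw [eLpNorm_exponent_top]
      exact essSup_le_of_ae_le _ (Eventually.of_forall fun x => by simp)
    have hpr : 0 < p.toReal := ENNReal.toReal_pos hp0 hpt
    have hr := toReal_inv_add_toReal_inv hpq
    have he : (q.toReal - 1) * p.toReal = q.toReal := by
      field_simp at hr
      linarith
    rw [eLpNorm_eq_lintegral_rpow_enorm_toReal hp0 hpt]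
    simp only [enorm_eq_self, ← ENNReal.rpow_mul, he]
    rw [h2, ENNReal.one_rpow]
  · have h1 : ∀ x, f x * (f x / S) ^ (q.toReal - 1) = S * (f x / S) ^ q.toReal := by
      intro x
      have : f x = S * (f x / S) := (ENNReal.mul_div_cancel h0 hSt).symm
      rw [show f x * (f x / S) ^ (q.toReal - 1) = S * (f x / S) * (f x / S) ^ (q.toReal - 1) from
        congrArg (· * _) this, mul_assoc]
      congr 1
      conv_lhs => enter [1]; rw [← ENNReal.rpow_one (f x / S)]
      rw [← ENNReal.rpow_add_of_nonneg _ _ zero_le_one hq1r', add_sub_cancel]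
    simp_rw [h1]
    rw [lintegral_const_mul _ ((hf.div_const _).pow_const _), h2, mul_one]
    exact le_mul_of_one_le_left' (by norm_num)

end Duality

section Discretization

variable {Ω : Set (Euc n)} {E : Type*} [NormedAddCommGroup E]

/-- The Whitney-type piece of `Ω` of scale `2 ^ k` and position `m`, where `j = (k, m)`. -/
def piece (Ω : Set (Euc n)) (j : ℤ × (Fin n → ℤ)) : Set (Euc n) :=
  {x | x ∈ Ω ∧ (2 : ℝ) ^ j.1 ≤ bd Ω x ∧ bd Ω x < (2 : ℝ) ^ (j.1 + 1) ∧
    ∀ i, ⌊x i / (2 : ℝ) ^ j.1⌋ = j.2 i}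

lemma piece_subset (j : ℤ × (Fin n → ℤ)) : piece Ω j ⊆ Ω := fun _ hx => hx.1

lemma measurableSet_piece (hΩ : IsOpen Ω) (j : ℤ × (Fin n → ℤ)) : MeasurableSet (piece Ω j) := by
  refine hΩ.measurableSet.inter ((measurableSet_le measurable_const (measurable_bd Ω)).inter
    ((measurableSet_lt (measurable_bd Ω) measurable_const).inter ?_))
  have : {x : Euc n | ∀ i, ⌊x i / (2 : ℝ) ^ j.1⌋ = j.2 i} =
      ⋂ i, (fun x : Euc n => ⌊x i / (2 : ℝ) ^ j.1⌋) ⁻¹' {j.2 i} := by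
    ext x; simp
  change MeasurableSet {x : Euc n | ∀ i, ⌊x i / (2 : ℝ) ^ j.1⌋ = j.2 i}
  rw [this]
  exact MeasurableSet.iInter fun i =>
    (Int.measurable_floor.comp (by fun_prop)) (measurableSet_singleton _)

lemma exists_mem_piece (hΩ : IsOpen Ω) (hne : (frontier Ω).Nonempty) {x : Euc n} (hx : x ∈ Ω) :
    ∃ j, x ∈ piece Ω j :=
  ⟨(Int.log 2 (bd Ω x), fun i => ⌊x i / (2 : ℝ) ^ Int.log 2 (bd Ω x)⌋), hx,
    by simpa using Int.zpow_log_le_self (b := 2) one_lt_two (bd_pos hΩ hne hx),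
    by simpa using Int.lt_zpow_succ_log_self (b := 2) one_lt_two (bd Ω x), fun _ => rfl⟩

lemma lt_of_zpow_le_of_lt {k l : ℤ} {a b : ℝ} {K : ℕ} (h1 : (2 : ℝ) ^ k ≤ a) (h2 : a ≤ 2 ^ K * b)
    (h3 : b < (2 : ℝ) ^ (l + 1)) : k < l + 1 + K := by
  have : (2 : ℝ) ^ k < (2 : ℝ) ^ (l + 1 + K) := by
    rw [zpow_add₀ two_ne_zero, zpow_natCast]
    calc (2 : ℝ) ^ k ≤ 2 ^ K * b := h1.trans h2
      _ < 2 ^ K * 2 ^ (l + 1) := by gcongr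
      _ = _ := mul_comm _ _
  exact (zpow_lt_zpow_iff_right₀ one_lt_two).1 this

lemma eq_of_mem_piece {i j : ℤ × (Fin n → ℤ)} {x : Euc n} (hi : x ∈ piece Ω i)
    (hj : x ∈ piece Ω j) : i = j := by
  have h1 := lt_of_zpow_le_of_lt (K := 0) hi.2.1 (by simp) hj.2.2.1
  have h2 := lt_of_zpow_le_of_lt (K := 0) hj.2.1 (by simp) hi.2.2.1
  have h : i.1 = j.1 := by push_cast at h1 h2; omega
  refine Prod.ext h (funext fun l => ?_)
  rw [← hi.2.2.2 l, ← hj.2.2.2 l, h]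

lemma dist_le_of_mem_piece {j : ℤ × (Fin n → ℤ)} {x y : Euc n} (hx : x ∈ piece Ω j)
    (hy : y ∈ piece Ω j) : dist x y ≤ n * (2 : ℝ) ^ j.1 := by
  have ht : (0 : ℝ) < 2 ^ j.1 := by positivity
  rw [EuclideanSpace.dist_eq]
  refine Real.sqrt_le_iff.2 ⟨by positivity, ?_⟩
  have : ∀ i, dist (x i) (y i) ^ 2 ≤ ((2 : ℝ) ^ j.1) ^ 2 := by
    intro i
    have h := Int.abs_sub_lt_one_of_floor_eq_floor ((hx.2.2.2 i).trans (hy.2.2.2 i).symm)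
    rw [← sub_div, abs_div, abs_of_pos ht, div_lt_one ht] at h
    rw [Real.dist_eq]
    gcongr
  calc ∑ i, dist (x i) (y i) ^ 2 ≤ ∑ _i : Fin n, ((2 : ℝ) ^ j.1) ^ 2 :=
        Finset.sum_le_sum fun i _ => this i
    _ = n * ((2 : ℝ) ^ j.1) ^ 2 := by simp
    _ ≤ n ^ 2 * ((2 : ℝ) ^ j.1) ^ 2 := by
        gcongr
        exact_mod_cast Nat.le_self_pow two_ne_zero n
    _ = _ := by ring

lemma isCompact_closure_piece (j : ℤ × (Fin n → ℤ)) : IsCompact (closure (piece Ω j)) := by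
  refine Bornology.IsBounded.isCompact_closure (Metric.isBounded_iff.2
    ⟨n * (2 : ℝ) ^ j.1, fun x hx y hy => dist_le_of_mem_piece hx hy⟩)

lemma exists_two_pow_ge (c : ℝ) : ∃ K : ℕ, 2 / (1 - c) ≤ (2 : ℝ) ^ K ∧ 1 ≤ K := by
  obtain ⟨K, hK⟩ := pow_unbounded_of_one_lt (2 / (1 - c)) (one_lt_two (α := ℝ))
  exact ⟨K + 1, hK.le.trans (pow_le_pow_right₀ one_le_two (Nat.le_succ K)), Nat.le_add_left _ _⟩

lemma bd_le_of_mem_piece_of_dist_lt {c : ℝ} (hc1 : c < 1) {K : ℕ} (hK : 2 / (1 - c) ≤ (2 : ℝ) ^ K)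
    {j : ℤ × (Fin n → ℤ)} {x y : Euc n} (hx : x ∈ piece Ω j) (hxy : dist x y < c * bd Ω y) :
    bd Ω y ≤ 2 ^ K * (2 : ℝ) ^ j.1 := by
  have h1 := bd_le_add_dist (Ω := Ω) y x
  rw [dist_comm] at h1
  have h2 := hx.2.2.1
  rw [zpow_add_one₀ two_ne_zero] at h2
  have hc1' : 0 < 1 - c := by linarith
  have h3 : (2 : ℝ) ^ j.1 * (2 / (1 - c)) ≤ 2 ^ j.1 * 2 ^ K := by gcongr
  have h4 : bd Ω y ≤ 2 ^ j.1 * (2 / (1 - c)) := by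
    rw [mul_div_assoc', le_div_iff₀ hc1']
    linarith
  linarith

lemma exists_card_le_of_nonempty_inter (hΩ : IsOpen Ω) (hne : (frontier Ω).Nonempty) {c : ℝ}
    (hc1 : c < 1) :
    ∃ M : ℕ, ∀ y ∈ Ω, ∀ J : Finset (ℤ × (Fin n → ℤ)),
      (∀ j ∈ J, (piece Ω j ∩ ball y (c * bd Ω y)).Nonempty) → J.card ≤ M := by
  obtain ⟨K, hK, hK1⟩ := exists_two_pow_ge c
  set T : Finset (ℤ × (Fin n → ℤ)) := Finset.Icc (-(K + 2 : ℤ)) (K + 2) ×ˢ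
    Fintype.piFinset fun _ => Finset.Icc (-(2 ^ K + 1 : ℤ)) (2 ^ K + 1) with hT
  refine ⟨T.card, fun y hy J hJ => ?_⟩
  set κ := Int.log 2 (bd Ω y) with hκ
  have hy0 := bd_pos hΩ hne hy
  have hκ1 : (2 : ℝ) ^ κ ≤ bd Ω y := by
    simpa using Int.zpow_log_le_self (b := 2) one_lt_two hy0
  have hκ2 : bd Ω y < (2 : ℝ) ^ (κ + 1) := by
    simpa using Int.lt_zpow_succ_log_self (b := 2) one_lt_two (bd Ω y)
  set Φ : ℤ × (Fin n → ℤ) → ℤ × (Fin n → ℤ) := fun q =>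
    (κ + q.1, fun i => ⌊y i / (2 : ℝ) ^ (κ + q.1)⌋ + q.2 i) with hΦ
  suffices J ⊆ T.image Φ from (Finset.card_le_card this).trans Finset.card_image_le
  intro j hj
  obtain ⟨x, hxj, hxy⟩ := hJ j hj
  rw [mem_ball] at hxy
  have ht : (0 : ℝ) < 2 ^ j.1 := by positivity
  have hyt := bd_le_of_mem_piece_of_dist_lt hc1 hK hxj hxy
  have h1 : j.1 < κ + 1 + (1 : ℕ) := by
    refine lt_of_zpow_le_of_lt hxj.2.1 ?_ hκ2
    have := bd_le_add_dist (Ω := Ω) x y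
    nlinarith
  have h2 : κ < j.1 + 1 + (K : ℕ) := by
    refine lt_of_zpow_le_of_lt hκ1 hyt ?_
    exact zpow_lt_zpow_right₀ one_lt_two (by omega)
  refine Finset.mem_image.2 ⟨(j.1 - κ, fun i => j.2 i - ⌊y i / (2 : ℝ) ^ j.1⌋), ?_, ?_⟩
  · simp only [T, Finset.mem_product, Finset.mem_Icc, Fintype.mem_piFinset]
    refine ⟨by push_cast at h1; omega, fun i => ?_⟩
    have h3 : |x i / (2 : ℝ) ^ j.1 - y i / (2 : ℝ) ^ j.1| < 2 ^ K := by
      rw [← sub_div, abs_div, abs_of_pos ht, div_lt_iff₀ ht]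
      calc |x i - y i| ≤ dist x y := by
            rw [← Real.dist_eq]; exact PiLp.dist_apply_le x y i
        _ < c * bd Ω y := hxy
        _ ≤ bd Ω y := by nlinarith
        _ ≤ _ := hyt
    rw [← hxj.2.2.2 i]
    rw [abs_lt] at h3
    have a1 := Int.floor_le (x i / (2 : ℝ) ^ j.1)
    have a2 := Int.lt_floor_add_one (x i / (2 : ℝ) ^ j.1)
    have b1 := Int.floor_le (y i / (2 : ℝ) ^ j.1)
    have b2 := Int.lt_floor_add_one (y i / (2 : ℝ) ^ j.1)
    constructor
    · have : (-(2 ^ K + 1 : ℤ) : ℝ) ≤ (⌊x i / (2 : ℝ) ^ j.1⌋ - ⌊y i / (2 : ℝ) ^ j.1⌋ : ℤ) := by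
        push_cast; linarith
      exact_mod_cast this
    · have : ((⌊x i / (2 : ℝ) ^ j.1⌋ - ⌊y i / (2 : ℝ) ^ j.1⌋ : ℤ) : ℝ) ≤ (2 ^ K + 1 : ℤ) := by
        push_cast; linarith
      exact_mod_cast this
  · simp [Φ]

end Discretization

section DiscreteNorm

variable {Ω : Set (Euc n)} {E : Type*} [NormedAddCommGroup E]

/-- The length scale of the pieces with index `j`. -/
def scale (j : ℤ × (Fin n → ℤ)) : ℝ≥0∞ := ENNReal.ofReal ((2 : ℝ) ^ j.1)

lemma scale_rpow (j : ℤ × (Fin n → ℤ)) (a : ℝ) :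
    scale j ^ a = ENNReal.ofReal (((2 : ℝ) ^ j.1) ^ a) :=
  ENNReal.ofReal_rpow_of_pos (by positivity)

lemma scale_ne_zero (j : ℤ × (Fin n → ℤ)) : scale j ≠ 0 := by
  simpa [scale] using (by positivity : (0 : ℝ) < 2 ^ j.1)

lemma scale_ne_top (j : ℤ × (Fin n → ℤ)) : scale j ≠ ⊤ := ENNReal.ofReal_ne_top

lemma scale_rpow_ne_zero (j : ℤ × (Fin n → ℤ)) (a : ℝ) : scale j ^ a ≠ 0 := by
  rw [scale_rpow]; simpa using (by positivity : (0 : ℝ) < ((2 : ℝ) ^ j.1) ^ a)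

lemma scale_rpow_ne_top (j : ℤ × (Fin n → ℤ)) (a : ℝ) : scale j ^ a ≠ ⊤ := by
  rw [scale_rpow]; exact ENNReal.ofReal_ne_top

lemma scale_add (j : ℤ × (Fin n → ℤ)) (a b : ℝ) : scale j ^ (a + b) = scale j ^ a * scale j ^ b :=
  ENNReal.rpow_add _ _ (scale_ne_zero j) (scale_ne_top j)

/-- Lebesgue measure on a piece, rescaled to have mass comparable to at most `1`. -/
def pieceMeasure (Ω : Set (Euc n)) (j : ℤ × (Fin n → ℤ)) : Measure (Euc n) :=
  scale j ^ (-(n : ℝ)) • volume.restrict (piece Ω j)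

instance (Ω : Set (Euc n)) (j : ℤ × (Fin n → ℤ)) : IsFiniteMeasure (pieceMeasure Ω j) := by
  refine ⟨?_⟩
  rw [pieceMeasure, Measure.smul_apply, Measure.restrict_apply_univ, smul_eq_mul]
  exact ENNReal.mul_lt_top (scale_rpow_ne_top _ _).lt_top
    ((measure_mono subset_closure).trans_lt (isCompact_closure_piece j).measure_lt_top)

lemma dw_le_scale {M : ℝ} (a : ℝ) {j : ℤ × (Fin n → ℤ)} {y : Euc n} (hy : 0 < bd Ω y)
    (h1 : bd Ω y ≤ M * 2 ^ j.1) (h2 : 2 ^ j.1 ≤ M * bd Ω y) :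
    dw Ω a y ≤ ENNReal.ofReal (M ^ |a|) * scale j ^ a := by
  have hM : 0 < M := by
    have : (0 : ℝ) < 2 ^ j.1 := by positivity
    by_contra h
    nlinarith
  rw [dw_eq_ofReal hy, scale_rpow, ← ENNReal.ofReal_mul (by positivity)]
  exact ENNReal.ofReal_le_ofReal (rpow_le_of_comparable a hy (by positivity) h1 h2)

lemma scale_le_dw {M : ℝ} (a : ℝ) {j : ℤ × (Fin n → ℤ)} {y : Euc n} (hy : 0 < bd Ω y)
    (h1 : bd Ω y ≤ M * 2 ^ j.1) (h2 : 2 ^ j.1 ≤ M * bd Ω y) :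
    scale j ^ a ≤ ENNReal.ofReal (M ^ |a|) * dw Ω a y := by
  have hM : 0 < M := by
    have : (0 : ℝ) < 2 ^ j.1 := by positivity
    by_contra h
    nlinarith
  rw [dw_eq_ofReal hy, scale_rpow, ← ENNReal.ofReal_mul (by positivity)]
  exact ENNReal.ofReal_le_ofReal (rpow_le_of_comparable a (by positivity) hy h2 h1)

lemma exists_wAvg_mul_dw_le (hΩ : IsOpen Ω) (hne : (frontier Ω).Nonempty) {c : ℝ}
    (hc : 0 < c) (hc1 : c < 1) {β : ℝ≥0∞} (hβ : 1 ≤ β) (e : ℝ) :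
    ∃ C : ℝ≥0, ∀ (F : Euc n → E) (J : Finset (ℤ × (Fin n → ℤ))),
      AEStronglyMeasurable F (volume.restrict Ω) →
      (∀ x ∈ Ω, F x ≠ 0 → ∃ j ∈ J, x ∈ piece Ω j) → ∀ y ∈ Ω, ∀ B : ℝ≥0∞,
      (∀ j ∈ J, (piece Ω j ∩ ball y (c * bd Ω y)).Nonempty →
        scale j ^ e * eLpNorm F β (pieceMeasure Ω j) ≤ B) →
      wAvg Ω c β F y * dw Ω e y ≤ C * B := by
  classical
  obtain ⟨K, hK, hK1⟩ := exists_two_pow_ge c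
  obtain ⟨M, hM⟩ := exists_card_le_of_nonempty_inter hΩ hne hc1
  set v := volume (ball (0 : Euc n) 1) with hv
  have hv0 : v ≠ 0 := (measure_ball_pos _ _ one_pos).ne'
  have hvt : v ≠ ⊤ := measure_ball_lt_top.ne
  set C1 : ℝ≥0∞ := (ENNReal.ofReal (c ^ n))⁻¹ * v⁻¹ * ENNReal.ofReal (((2 : ℝ) ^ K) ^ |-(n : ℝ)|)
    with hC1
  have hcn : ENNReal.ofReal (c ^ n) ≠ 0 := by simpa using pow_pos hc n
  have hC1t : C1 ≠ ⊤ := ENNReal.mul_ne_top (ENNReal.mul_ne_top (ENNReal.inv_ne_top.2 hcn)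
    (ENNReal.inv_ne_top.2 hv0)) ENNReal.ofReal_ne_top
  set C0 : ℝ≥0∞ := max 1 C1 with hC0
  have hC0t : C0 ≠ ⊤ := by simp [C0, hC1t]
  set C2 : ℝ≥0∞ := M * (C0 * ENNReal.ofReal (((2 : ℝ) ^ K) ^ |e|)) with hC2
  have hC2t : C2 ≠ ⊤ := ENNReal.mul_ne_top (ENNReal.natCast_ne_top _)
    (ENNReal.mul_ne_top hC0t ENNReal.ofReal_ne_top)
  refine ⟨C2.toNNReal, fun F J hF hFJ y hy B hB => ?_⟩
  rw [ENNReal.coe_toNNReal hC2t]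
  have hy0 := bd_pos hΩ hne hy
  set J' := J.filter fun j => (piece Ω j ∩ ball y (c * bd Ω y)).Nonempty with hJ'
  have hcard : J'.card ≤ M := hM y hy J' fun j hj => (Finset.mem_filter.1 hj).2
  have hac := avMeasure_absolutelyContinuous hΩ hc1.le hy (Ω := Ω)
  have hsum : F =ᵐ[avMeasure Ω c y] ∑ j ∈ J', (piece Ω j).indicator F := by
    have : ∀ᵐ x ∂(avMeasure Ω c y), x ∈ ball y (c * bd Ω y) :=
      Measure.smul_absolutelyContinuous.ae_le (ae_restrict_mem measurableSet_ball)
    filter_upwards [this] with x hx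
    rw [Finset.sum_apply]
    have hxΩ : x ∈ Ω := ball_mul_bd_subset hΩ hc1.le hy hx
    by_cases h0 : F x = 0
    · rw [h0, Finset.sum_eq_zero]
      intro j _
      by_cases h : x ∈ piece Ω j <;> simp [h, h0]
    obtain ⟨j, hj, hxj⟩ := hFJ x hxΩ h0
    rw [Finset.sum_eq_single_of_mem j (Finset.mem_filter.2 ⟨hj, x, hxj, hx⟩), indicator_of_mem hxj]
    intro i _ hij
    exact indicator_of_notMem (fun h => hij (eq_of_mem_piece h hxj)) _
  have hcomp : ∀ j ∈ J', bd Ω y ≤ 2 ^ K * 2 ^ j.1 ∧ 2 ^ j.1 ≤ 2 ^ K * bd Ω y := by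
    intro j hj
    obtain ⟨x, hxj, hxy⟩ := (Finset.mem_filter.1 hj).2
    rw [mem_ball] at hxy
    refine ⟨bd_le_of_mem_piece_of_dist_lt hc1 hK hxj hxy, ?_⟩
    have h1 := bd_le_add_dist (Ω := Ω) x y
    have h2 := hxj.2.1
    have h3 : (2 : ℝ) ^ 1 ≤ 2 ^ K := pow_le_pow_right₀ one_le_two hK1
    nlinarith
  have hterm : ∀ j ∈ J', eLpNorm ((piece Ω j).indicator F) β (avMeasure Ω c y) * dw Ω e y ≤
      C0 * ENNReal.ofReal (((2 : ℝ) ^ K) ^ |e|) * B := by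
    intro j hj
    obtain ⟨h1, h2⟩ := hcomp j hj
    have hmeas : (avMeasure Ω c y).restrict (piece Ω j) ≤ C0 • pieceMeasure Ω j := by
      rw [avMeasure, Measure.restrict_smul, pieceMeasure, smul_smul]
      refine (Measure.le_iff.2 fun s hs => ?_)
      simp only [Measure.smul_apply, smul_eq_mul]
      refine mul_le_mul' ?_ ?_
      · rw [volume_ball_bd hc y hy0]
        rw [ENNReal.mul_inv (Or.inr hvt) (Or.inr hv0),
          ENNReal.mul_inv (Or.inl hcn) (Or.inl ENNReal.ofReal_ne_top)]
        have : (dw Ω n y)⁻¹ = dw Ω (-n) y := (ENNReal.rpow_neg _ _).symm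
        rw [this]
        calc _ ≤ (ENNReal.ofReal (c ^ n))⁻¹ *
              (ENNReal.ofReal (((2 : ℝ) ^ K) ^ |-(n : ℝ)|) * scale j ^ (-(n : ℝ))) * v⁻¹ := by
              gcongr
              exact dw_le_scale _ hy0 h1 h2
          _ = C1 * scale j ^ (-(n : ℝ)) := by rw [hC1]; ring
          _ ≤ _ := by gcongr; exact le_max_right _ _
      · exact Measure.restrict_mono subset_rfl Measure.restrict_le_self s
    have hCp : C0 ^ (1 / β).toReal ≤ C0 := by
      conv_rhs => rw [← ENNReal.rpow_one C0]
      refine ENNReal.rpow_le_rpow_of_exponent_le (le_max_left _ _) ?_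
      have : (1 / β) ≤ 1 := by simpa using hβ
      simpa using ENNReal.toReal_mono ENNReal.one_ne_top this
    have hC00 : C0 ≠ 0 := (one_pos.trans_le (le_max_left _ _)).ne'
    rw [eLpNorm_indicator_eq_eLpNorm_restrict (measurableSet_piece hΩ j)]
    calc _ ≤ eLpNorm F β (C0 • pieceMeasure Ω j) *
          (ENNReal.ofReal (((2 : ℝ) ^ K) ^ |e|) * scale j ^ e) := by
          gcongr
          exact dw_le_scale _ hy0 h1 h2
      _ ≤ C0 * eLpNorm F β (pieceMeasure Ω j) *
          (ENNReal.ofReal (((2 : ℝ) ^ K) ^ |e|) * scale j ^ e) := by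
          gcongr
          rw [eLpNorm_smul_measure_of_ne_zero hC00, smul_eq_mul]
          gcongr
      _ = C0 * ENNReal.ofReal (((2 : ℝ) ^ K) ^ |e|) *
          (scale j ^ e * eLpNorm F β (pieceMeasure Ω j)) := by ring
      _ ≤ _ := by
          gcongr
          exact hB j (Finset.mem_filter.1 hj).1 (Finset.mem_filter.1 hj).2
  calc wAvg Ω c β F y * dw Ω e y
      = eLpNorm (∑ j ∈ J', (piece Ω j).indicator F) β (avMeasure Ω c y) * dw Ω e y := by
        rw [← eLpNorm_congr_ae hsum]; rfl
    _ ≤ (∑ j ∈ J', eLpNorm ((piece Ω j).indicator F) β (avMeasure Ω c y)) * dw Ω e y := by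
        gcongr
        exact eLpNorm_sum_le (fun j _ => (hF.mono_ac hac).indicator (measurableSet_piece hΩ j)) hβ
    _ = ∑ j ∈ J', eLpNorm ((piece Ω j).indicator F) β (avMeasure Ω c y) * dw Ω e y :=
        Finset.sum_mul _ _ _
    _ ≤ ∑ _j ∈ J', C0 * ENNReal.ofReal (((2 : ℝ) ^ K) ^ |e|) * B := Finset.sum_le_sum hterm
    _ = J'.card * (C0 * ENNReal.ofReal (((2 : ℝ) ^ K) ^ |e|) * B) := by
        rw [Finset.sum_const, nsmul_eq_mul]
    _ ≤ M * (C0 * ENNReal.ofReal (((2 : ℝ) ^ K) ^ |e|) * B) := by gcongr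
    _ = C2 * B := by rw [hC2]; ring

end DiscreteNorm

section DiscreteBound

variable {Ω : Set (Euc n)} {E : Type*} [NormedAddCommGroup E]

lemma exists_piece_neighborhood (Ω : Set (Euc n)) {c : ℝ} (hc1 : c < 1) :
    ∃ C : ℝ≥0, ∀ j : ℤ × (Fin n → ℤ), ∃ X : Set (Euc n), MeasurableSet X ∧
      volume X ≤ C * scale j ^ (n : ℝ) ∧
      ∀ y ∈ Ω, (piece Ω j ∩ ball y (c * bd Ω y)).Nonempty → y ∈ X := by
  obtain ⟨K, hK, hK1⟩ := exists_two_pow_ge c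
  set v := volume (ball (0 : Euc n) 1) with hv
  have hvt : v ≠ ⊤ := measure_ball_lt_top.ne
  refine ⟨(ENNReal.ofReal ((2 ^ K + n) ^ n) * v).toNNReal, fun j => ?_⟩
  rw [ENNReal.coe_toNNReal (ENNReal.mul_ne_top ENNReal.ofReal_ne_top hvt)]
  rcases (piece Ω j).eq_empty_or_nonempty with h | ⟨x₀, hx₀⟩
  · exact ⟨∅, MeasurableSet.empty, by simp, fun y _ hy => by simp [h] at hy⟩
  refine ⟨ball x₀ ((2 ^ K + n) * 2 ^ j.1), measurableSet_ball, ?_, fun y hy hyj => ?_⟩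
  · rw [Measure.addHaar_ball_of_pos _ _ (by positivity), scale_rpow, mul_right_comm,
      ← ENNReal.ofReal_mul (by positivity), Real.rpow_natCast, mul_pow]
    simp [v]
  · obtain ⟨x, hxj, hxy⟩ := hyj
    rw [mem_ball] at hxy ⊢
    have h1 := dist_le_of_mem_piece hxj hx₀
    have h2 := bd_le_of_mem_piece_of_dist_lt hc1 hK hxj hxy
    have h3 := dist_triangle y x x₀
    rw [dist_comm y x] at h3
    have h4 : c * bd Ω y ≤ bd Ω y := by nlinarith [bd_nonneg Ω y]
    linarith

/-- The counting measure on a finite family of pieces, each weighted by (a proxy of) its volume. -/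
def indexMeasure (J : Finset (ℤ × (Fin n → ℤ))) : Measure (ℤ × (Fin n → ℤ)) :=
  ∑ j ∈ J, scale j ^ (n : ℝ) • Measure.dirac j

lemma lintegral_indexMeasure (J : Finset (ℤ × (Fin n → ℤ))) (f : ℤ × (Fin n → ℤ) → ℝ≥0∞) :
    ∫⁻ j, f j ∂(indexMeasure J) = ∑ j ∈ J, scale j ^ (n : ℝ) * f j := by
  simp [indexMeasure, lintegral_finsetSum_measure, lintegral_smul_measure]

instance (J : Finset (ℤ × (Fin n → ℤ))) : IsFiniteMeasure (indexMeasure J) := by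
  refine ⟨?_⟩
  rw [← lintegral_one, lintegral_indexMeasure]
  simp only [mul_one]
  exact ENNReal.sum_lt_top.2 fun j _ => (scale_rpow_ne_top _ _).lt_top

lemma le_eLpNorm_top_indexMeasure {J : Finset (ℤ × (Fin n → ℤ))} (f : ℤ × (Fin n → ℤ) → ℝ≥0∞)
    {j : ℤ × (Fin n → ℤ)} (hj : j ∈ J) : f j ≤ eLpNorm f ⊤ (indexMeasure J) := by
  rw [eLpNorm_exponent_top, eLpNormEssSup]
  simp only [enorm_eq_self]
  have h := ENNReal.ae_le_essSup (μ := indexMeasure J) f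
  rw [ae_iff] at h
  by_contra hlt
  have h1 : ∫⁻ i, ({i | ¬f i ≤ essSup f (indexMeasure J)}).indicator 1 i ∂(indexMeasure J) = 0 := by
    rw [lintegral_indicator_one (MeasurableSet.of_discrete), h]
  rw [lintegral_indexMeasure, Finset.sum_eq_zero_iff] at h1
  have := h1 j hj
  rw [indicator_of_mem (by exact hlt), Pi.one_apply, mul_one] at this
  exact scale_rpow_ne_zero _ _ this

lemma exists_avNorm_le_eLpNorm_indexMeasure (hΩ : IsOpen Ω) (hne : (frontier Ω).Nonempty) (d : ℝ)
    {c : ℝ} (hc : 0 < c) (hc1 : c < 1) {β p : ℝ≥0∞} (hβ : 1 ≤ β) (hp : 1 ≤ p) (s : ℝ) :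
    ∃ C : ℝ≥0, ∀ (F : Euc n → E) (J : Finset (ℤ × (Fin n → ℤ))),
      AEStronglyMeasurable F (volume.restrict Ω) →
      (∀ x ∈ Ω, F x ≠ 0 → ∃ j ∈ J, x ∈ piece Ω j) →
      avNorm Ω d c β p s F ≤ C * eLpNorm (fun j => scale j ^ avExp n d p s *
        eLpNorm F β (pieceMeasure Ω j)) p (indexMeasure J) := by
  obtain ⟨C, hC⟩ := exists_wAvg_mul_dw_le (E := E) hΩ hne hc hc1 hβ (avExp n d p s)
  rcases eq_or_ne p ⊤ with rfl | hpt
  · refine ⟨C, fun F J hF hFJ => ?_⟩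
    rw [avNorm_top]
    refine iSup₂_le fun y hy => hC F J hF hFJ y hy _ fun j hj _ => ?_
    exact le_eLpNorm_top_indexMeasure (fun j => scale j ^ avExp n d ⊤ s *
      eLpNorm F β (pieceMeasure Ω j)) hj
  have hp0 : p ≠ 0 := (one_pos.trans_le hp).ne'
  have hpr : 0 < p.toReal := ENNReal.toReal_pos hp0 hpt
  obtain ⟨C', hC'⟩ := exists_piece_neighborhood Ω hc1
  choose X hXm hXv hX using hC'
  refine ⟨C * C' ^ (1 / p.toReal), fun F J hF hFJ => ?_⟩
  rw [avNorm_of_ne_top hΩ d c β s hp0 hpt]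
  set b : ℤ × (Fin n → ℤ) → ℝ≥0∞ := fun j => scale j ^ avExp n d p s *
    eLpNorm F β (pieceMeasure Ω j) with hb
  have hpt' : ∀ y ∈ Ω, (wAvg Ω c β F y * dw Ω (avExp n d p s) y) ^ p.toReal ≤
      (C : ℝ≥0∞) ^ p.toReal * ∑ j ∈ J, (X j).indicator (fun _ => b j ^ p.toReal) y := by
    intro y hy
    set S := ∑ j ∈ J, (X j).indicator (fun _ => b j ^ p.toReal) y with hS
    have := hC F J hF hFJ y hy (S ^ (1 / p.toReal)) fun j hj hjy => by
      have h1 : b j ^ p.toReal ≤ S := by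
        calc b j ^ p.toReal = (X j).indicator (fun _ => b j ^ p.toReal) y := by
              rw [indicator_of_mem (hX j y hy hjy)]
          _ ≤ S := Finset.single_le_sum
            (f := fun j => (X j).indicator (fun _ => b j ^ p.toReal) y) (fun _ _ => zero_le) hj
      calc b j = (b j ^ p.toReal) ^ (1 / p.toReal) := by
            rw [← ENNReal.rpow_mul, mul_one_div_cancel hpr.ne', ENNReal.rpow_one]
        _ ≤ _ := ENNReal.rpow_le_rpow h1 (by positivity)
    calc _ ≤ (C * S ^ (1 / p.toReal)) ^ p.toReal := ENNReal.rpow_le_rpow this hpr.le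
      _ = _ := by
        rw [ENNReal.mul_rpow_of_nonneg _ _ hpr.le, ← ENNReal.rpow_mul,
          one_div_mul_cancel hpr.ne', ENNReal.rpow_one]
  have hint : ∫⁻ y in Ω, (wAvg Ω c β F y * dw Ω (avExp n d p s) y) ^ p.toReal ≤
      (C : ℝ≥0∞) ^ p.toReal * (C' * ∫⁻ j, b j ^ p.toReal ∂(indexMeasure J)) := by
    calc _ ≤ ∫⁻ y in Ω, (C : ℝ≥0∞) ^ p.toReal *
          ∑ j ∈ J, (X j).indicator (fun _ => b j ^ p.toReal) y :=
          setLIntegral_mono' hΩ.measurableSet hpt'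
      _ ≤ ∫⁻ y, (C : ℝ≥0∞) ^ p.toReal *
          ∑ j ∈ J, (X j).indicator (fun _ => b j ^ p.toReal) y := setLIntegral_le_lintegral _ _
      _ = (C : ℝ≥0∞) ^ p.toReal * ∑ j ∈ J, b j ^ p.toReal * volume (X j) := by
          have hm : ∀ j ∈ J, Measurable ((X j).indicator (fun _ => b j ^ p.toReal)) :=
            fun j _ => measurable_const.indicator (hXm j)
          rw [lintegral_const_mul _ (Finset.measurable_sum _ hm),
            lintegral_finsetSum _ hm]
          congr 1
          refine Finset.sum_congr rfl fun j _ => ?_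
          rw [lintegral_indicator (hXm j), setLIntegral_const]
      _ ≤ (C : ℝ≥0∞) ^ p.toReal * ∑ j ∈ J, b j ^ p.toReal * (C' * scale j ^ (n : ℝ)) := by
          gcongr with j hj
          exact hXv j
      _ = _ := by
          rw [lintegral_indexMeasure, Finset.mul_sum, Finset.mul_sum, Finset.mul_sum]
          exact Finset.sum_congr rfl fun j _ => by ring
  refine (ENNReal.rpow_le_rpow hint (by positivity)).trans_eq ?_
  rw [eLpNorm_eq_lintegral_rpow_enorm_toReal hp0 hpt]
  simp only [enorm_eq_self]
  rw [ENNReal.mul_rpow_of_nonneg _ _ (by positivity),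
    ENNReal.mul_rpow_of_nonneg _ _ (by positivity), ← ENNReal.rpow_mul,
    mul_one_div_cancel hpr.ne', ENNReal.rpow_one, ENNReal.coe_mul,
    ENNReal.coe_rpow_of_nonneg _ (by positivity), mul_assoc]

end DiscreteBound

section NormDuality

variable {Ω : Set (Euc n)}

/-- Bounded measurable fields supported in finitely many pieces of `Ω`. -/
def IsTame (Ω : Set (Euc n)) (H : Euc n → Euc n) : Prop :=
  Measurable H ∧ (∃ M : ℝ, ∀ x, ‖H x‖ ≤ M) ∧
    ∃ J : Finset (ℤ × (Fin n → ℤ)), ∀ x, H x ≠ 0 → ∃ j ∈ J, x ∈ piece Ω j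

lemma IsTame.avNorm_lt_top (hΩ : IsOpen Ω) (hne : (frontier Ω).Nonempty) (d : ℝ)
    {c : ℝ} (hc : 0 < c) (hc1 : c < 1) {β p : ℝ≥0∞} (hβ : 1 ≤ β) (hp : 1 ≤ p) (s : ℝ)
    {H : Euc n → Euc n} (hH : IsTame Ω H) : avNorm Ω d c β p s H < ⊤ := by
  obtain ⟨hm, ⟨M, hM⟩, J, hJ⟩ := hH
  obtain ⟨C, hC⟩ := exists_avNorm_le_eLpNorm_indexMeasure (E := Euc n) hΩ hne d hc hc1 hβ hp s
  refine (hC H J hm.aestronglyMeasurable fun x _ hx => hJ x hx).trans_lt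
    (ENNReal.mul_lt_top ENNReal.coe_lt_top ?_)
  have hb : ∀ j, scale j ^ avExp n d p s * eLpNorm H β (pieceMeasure Ω j) ≠ ⊤ := fun j =>
    ENNReal.mul_ne_top (scale_rpow_ne_top _ _) (MemLp.of_bound (p := β) (μ := pieceMeasure Ω j)
      hm.aestronglyMeasurable M (Eventually.of_forall hM)).eLpNorm_ne_top
  have hz : ∀ j ∉ J, scale j ^ avExp n d p s * eLpNorm H β (pieceMeasure Ω j) = 0 := by
    intro j hj
    have : H =ᵐ[pieceMeasure Ω j] 0 := by
      refine Measure.smul_absolutelyContinuous.ae_le ?_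
      filter_upwards [ae_restrict_mem (measurableSet_piece hΩ j)] with x hx
      by_contra h
      obtain ⟨i, hi, hxi⟩ := hJ x h
      exact hj (eq_of_mem_piece hxi hx ▸ hi)
    rw [eLpNorm_congr_ae this, eLpNorm_zero, mul_zero]
  set b : ℤ × (Fin n → ℤ) → ℝ≥0∞ :=
    fun j => scale j ^ avExp n d p s * eLpNorm H β (pieceMeasure Ω j) with hb'
  have hbS : ∀ j, b j ≤ ∑ i ∈ J, b i := by
    intro j
    by_cases hj : j ∈ J
    · exact Finset.single_le_sum (f := b) (fun _ _ => zero_le) hj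
    · rw [show b j = 0 from hz j hj]; exact zero_le
  have hS : ∑ i ∈ J, b i ≠ ⊤ := ENNReal.sum_ne_top.2 fun j _ => hb j
  have : ∀ j, ‖b j‖ₑ ≤ ‖(∑ i ∈ J, b i).toReal‖ₑ := by
    intro j
    rw [Real.enorm_of_nonneg ENNReal.toReal_nonneg, ENNReal.ofReal_toReal hS]
    exact hbS j
  refine (eLpNorm_mono_enorm this).trans_lt ?_
  exact (memLp_const _).eLpNorm_lt_top

lemma exists_avNorm_indicator_le_of_dual (hΩ : IsOpen Ω) (hne : (frontier Ω).Nonempty) (d : ℝ)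
    {c : ℝ} (hc : 0 < c) (hc1 : c < 1) {β β' : ℝ≥0∞} (hβ : 1 / β + 1 / β' = 1)
    {p p' : ℝ≥0∞} (hp : 1 / p + 1 / p' = 1) (s : ℝ) :
    ∃ C : ℝ≥0, ∀ (G : Euc n → Euc n) (B : ℝ≥0∞) (T : Set (Euc n)) (M : ℝ)
      (J : Finset (ℤ × (Fin n → ℤ))), Measurable G → MeasurableSet T →
      (∀ x ∈ T, ‖G x‖ ≤ M) → (∀ x ∈ T, ∃ j ∈ J, x ∈ piece Ω j) →
      (∀ H, IsTame Ω H →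
        ENNReal.ofReal (∫ x in Ω, ⟪G x, bd Ω x ^ (d + 1 - (n : ℝ)) • H x⟫) ≤
          B * avNorm Ω d c β p s H) →
      avNorm Ω d c β' p' (1 - s) (T.indicator G) ≤ C * B := by
  classical
  have hβc : ENNReal.HolderConjugate β β' := by
    rw [ENNReal.holderConjugate_iff]; simpa using hβ
  have hpc : ENNReal.HolderConjugate p p' := by
    rw [ENNReal.holderConjugate_iff]; simpa using hp
  obtain ⟨C₁, hC₁⟩ := exists_avNorm_le_eLpNorm_indexMeasure (E := Euc n) hΩ hne d hc hc1
    (ENNReal.HolderConjugate.one_le β β') (ENNReal.HolderConjugate.one_le p p') s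
  obtain ⟨C₂, hC₂⟩ := exists_avNorm_le_eLpNorm_indexMeasure (E := Euc n) hΩ hne d hc hc1
    (ENNReal.HolderConjugate.one_le β' β) (ENNReal.HolderConjugate.one_le p' p) (1 - s)
  set e := avExp n d p s with he
  set e' := avExp n d p' (1 - s) with he'
  set a : ℝ := d + 1 - n with ha
  have hee : e + e' = a := avExp_add_avExp n d hp s
  set C₃ : ℝ≥0∞ := ENNReal.ofReal (2 ^ |a|) with hC₃
  refine ⟨C₂ * (4 * ((2 : ℝ) ^ |a|).toNNReal * C₁), fun G B T M J hG hT hM hTJ hdual => ?_⟩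
  set G₁ := T.indicator G with hG₁
  have hG₁m : Measurable G₁ := hG.indicator hT
  have hG₁M : ∀ x, ‖G₁ x‖ ≤ max M 0 := by
    intro x
    by_cases hx : x ∈ T
    · rw [hG₁, indicator_of_mem hx]; exact (hM x hx).trans (le_max_left _ _)
    · rw [hG₁, indicator_of_notMem hx, norm_zero]; exact le_max_right _ _
  have hG₁J : ∀ x, G₁ x ≠ 0 → ∃ j ∈ J, x ∈ piece Ω j := fun x hx =>
    hTJ x (mem_of_indicator_ne_zero hx)
  set Me : ℝ≥0∞ := ENNReal.ofReal (max M 0) with hMe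
  have hG₁Me : ∀ x, ‖G₁ x‖ₑ ≤ Me := fun x => by
    rw [← ofReal_norm]; exact ENNReal.ofReal_le_ofReal (hG₁M x)
  -- dual functions on the pieces
  have hex := fun j => exists_dual_le (pieceMeasure Ω j) hβ hG₁m.enorm
    ENNReal.ofReal_ne_top hG₁Me
  choose h Mh hhm hMh hhM hh1 hh2 using hex
  simp_rw [eLpNorm_enorm] at hh2
  -- dual sequence
  set b : ℤ × (Fin n → ℤ) → ℝ≥0∞ := fun j => scale j ^ e' * eLpNorm G₁ β' (pieceMeasure Ω j)
    with hb
  have hbt : ∀ j, b j ≠ ⊤ := fun j =>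
    ENNReal.mul_ne_top (scale_rpow_ne_top _ _) (MemLp.of_bound (p := β') (μ := pieceMeasure Ω j)
      hG₁m.aestronglyMeasurable _ (Eventually.of_forall hG₁M)).eLpNorm_ne_top
  have hbz : ∀ j ∉ J, b j = 0 := by
    intro j hj
    have : G₁ =ᵐ[pieceMeasure Ω j] 0 := by
      refine Measure.smul_absolutelyContinuous.ae_le ?_
      filter_upwards [ae_restrict_mem (measurableSet_piece hΩ j)] with x hx
      by_contra h
      obtain ⟨i, hi, hxi⟩ := hG₁J x h
      exact hj (eq_of_mem_piece hxi hx ▸ hi)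
    rw [hb]
    simp only
    rw [eLpNorm_congr_ae this, eLpNorm_zero, mul_zero]
  have hbS : ∀ j, b j ≤ ∑ i ∈ J, b i := by
    intro j
    by_cases hj : j ∈ J
    · exact Finset.single_le_sum (f := b) (fun _ _ => zero_le) hj
    · rw [hbz j hj]; exact zero_le
  obtain ⟨v, Mv, -, hMv, hvM, hv1, hv2⟩ := exists_dual_le (indexMeasure J) hp
    (Measurable.of_discrete (f := b)) (ENNReal.sum_ne_top.2 fun j _ => hbt j) hbS
  -- the test field
  set κ : ℤ × (Fin n → ℤ) → ℝ≥0∞ := fun j => v j * scale j ^ (-e) with hκ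
  have hκt : ∀ j, κ j ≠ ⊤ := fun j =>
    ENNReal.mul_ne_top (((hvM j).trans_lt hMv.lt_top).ne) (scale_rpow_ne_top _ _)
  have hht : ∀ j x, h j x ≠ ⊤ := fun j x => ((hhM j x).trans_lt (hMh j).lt_top).ne
  set w : Euc n → ℝ≥0∞ := fun x => ∑ j ∈ J, (piece Ω j).indicator (fun x => κ j * h j x) x with hw
  have hwm : Measurable w := Finset.measurable_sum _ fun j _ =>
    ((hhm j).const_mul _).indicator (measurableSet_piece hΩ j)
  have hwS : ∀ x, w x ≤ ∑ j ∈ J, κ j * Mh j := fun x => Finset.sum_le_sum fun j _ =>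
    (indicator_le_self' (fun _ _ => zero_le) _).trans (mul_le_mul_right (hhM j x) _)
  have hSt : ∑ j ∈ J, κ j * Mh j ≠ ⊤ :=
    ENNReal.sum_ne_top.2 fun j _ => ENNReal.mul_ne_top (hκt j) (hMh j)
  have hwt : ∀ x, w x ≠ ⊤ := fun x => ((hwS x).trans_lt hSt.lt_top).ne
  have hwj : ∀ j ∈ J, ∀ x ∈ piece Ω j, w x = κ j * h j x := by
    intro j hj x hx
    simp only [hw]
    rw [Finset.sum_eq_single_of_mem j hj, indicator_of_mem hx]
    exact fun i _ hij => indicator_of_notMem (fun h' => hij (eq_of_mem_piece h' hx)) _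
  set H : Euc n → Euc n := fun x => ((w x).toReal * ‖G₁ x‖⁻¹) • G₁ x with hH
  have hHn : ∀ x, ‖H x‖ₑ ≤ w x := by
    intro x
    rw [← ofReal_norm, ← ENNReal.ofReal_toReal (hwt x)]
    refine ENNReal.ofReal_le_ofReal ?_
    simp only [hH]
    rw [norm_smul, norm_mul, norm_inv, norm_norm, mul_assoc, Real.norm_of_nonneg
      ENNReal.toReal_nonneg]
    exact mul_le_of_le_one_right ENNReal.toReal_nonneg inv_mul_le_one
  have hHz : ∀ x, G₁ x = 0 → H x = 0 := fun x hx => by simp [hH, hx]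
  have hHtame : IsTame Ω H := by
    refine ⟨(hwm.ennreal_toReal.mul hG₁m.norm.inv).smul hG₁m,
      ⟨(∑ j ∈ J, κ j * Mh j).toReal, fun x => ?_⟩, J, fun x hx =>
      hG₁J x fun h' => hx (hHz x h')⟩
    rw [← toReal_enorm]
    exact ENNReal.toReal_mono hSt ((hHn x).trans (hwS x))
  -- the norm of the test field
  have hHav : avNorm Ω d c β p s H ≤ C₁ := by
    refine (hC₁ H J hHtame.1.aestronglyMeasurable fun x _ hx =>
      hG₁J x fun h' => hx (hHz x h')).trans (mul_le_of_le_one_right' (le_trans ?_ hv1))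
    refine eLpNorm_mono_enorm_ae ?_
    have hae : ∀ᵐ j ∂(indexMeasure J), j ∈ J := by
      rw [ae_iff, ← lintegral_indicator_one (MeasurableSet.of_discrete), lintegral_indexMeasure]
      exact Finset.sum_eq_zero fun j hj => by simp [hj]
    filter_upwards [hae] with j hj
    simp only [enorm_eq_self]
    have h1 : eLpNorm H β (pieceMeasure Ω j) ≤
        (κ j).toNNReal • eLpNorm (h j) β (pieceMeasure Ω j) := by
      refine eLpNorm_le_nnreal_smul_eLpNorm_of_ae_le_mul' ?_ _
      refine Measure.smul_absolutelyContinuous.ae_le ?_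
      filter_upwards [ae_restrict_mem (measurableSet_piece hΩ j)] with x hx
      rw [ENNReal.coe_toNNReal (hκt j), enorm_eq_self, ← hwj j hj x hx]
      exact hHn x
    calc scale j ^ e * eLpNorm H β (pieceMeasure Ω j) ≤ scale j ^ e * (κ j * 1) := by
          gcongr
          refine h1.trans ?_
          rw [ENNReal.smul_def, smul_eq_mul, ENNReal.coe_toNNReal (hκt j)]
          gcongr
          exact hh1 j
      _ = v j * (scale j ^ e * scale j ^ (-e)) := by rw [hκ]; ring
      _ = v j := by rw [← scale_add, add_neg_cancel, ENNReal.rpow_zero, mul_one]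
  -- the pairing
  set P : ℝ≥0∞ := ∫⁻ x in Ω, w x * ‖G₁ x‖ₑ * dw Ω a x with hP
  have hPsum : P = ∑ j ∈ J, ∫⁻ x in piece Ω j, κ j * h j x * ‖G₁ x‖ₑ * dw Ω a x := by
    have hpt : ∀ x, w x * ‖G₁ x‖ₑ * dw Ω a x = ∑ j ∈ J, (piece Ω j).indicator
        (fun x => κ j * h j x * ‖G₁ x‖ₑ * dw Ω a x) x := by
      intro x
      simp only [hw, Finset.sum_mul]
      refine Finset.sum_congr rfl fun j _ => ?_
      by_cases hx : x ∈ piece Ω j <;> simp [hx]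
    rw [hP]
    simp_rw [hpt]
    have hmj : ∀ j ∈ J, Measurable ((piece Ω j).indicator
        (fun x => κ j * h j x * ‖G₁ x‖ₑ * dw Ω a x)) := fun j _ =>
      ((((hhm j).const_mul _).mul hG₁m.enorm).mul
        (measurable_dw Ω a)).indicator (measurableSet_piece hΩ j)
    rw [lintegral_finsetSum _ hmj]
    refine Finset.sum_congr rfl fun j _ => ?_
    rw [lintegral_indicator (measurableSet_piece hΩ j),
      Measure.restrict_restrict_of_subset (piece_subset j)]
  have hcomp : ∀ j, ∀ x ∈ piece Ω j, 0 < bd Ω x ∧ bd Ω x ≤ 2 * 2 ^ j.1 ∧ 2 ^ j.1 ≤ 2 * bd Ω x := by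
    intro j x hx
    have h0 := bd_pos hΩ hne hx.1
    have h1 := hx.2.2.1
    rw [zpow_add_one₀ two_ne_zero] at h1
    exact ⟨h0, by linarith, by linarith [hx.2.1]⟩
  have hPt : P ≠ ⊤ := by
    rw [hPsum]
    refine ENNReal.sum_ne_top.2 fun j hj => (lt_of_le_of_lt (setLIntegral_mono'
      (g := fun _ => κ j * Mh j * Me * (C₃ * scale j ^ a)) (measurableSet_piece hΩ j)
      fun x hx => ?_) ?_).ne
    · obtain ⟨h0, h1, h2⟩ := hcomp j x hx
      exact mul_le_mul' (mul_le_mul' (mul_le_mul_right (hhM j x) _) (hG₁Me x))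
        (dw_le_scale a h0 h1 h2)
    · rw [setLIntegral_const]
      refine ENNReal.mul_lt_top ?_ ((measure_mono subset_closure).trans_lt
        (isCompact_closure_piece j).measure_lt_top)
      exact ENNReal.mul_lt_top (ENNReal.mul_lt_top (ENNReal.mul_lt_top (hκt j).lt_top
        (hMh j).lt_top) ENNReal.ofReal_lt_top) (ENNReal.mul_lt_top ENNReal.ofReal_lt_top
        (scale_rpow_ne_top _ _).lt_top)
  have hPint : P = ENNReal.ofReal (∫ x in Ω, ⟪G x, bd Ω x ^ a • H x⟫) := by
    have hpt : ∀ x, ⟪G x, bd Ω x ^ a • H x⟫ = (w x).toReal * ‖G₁ x‖ * bd Ω x ^ a := by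
      intro x
      have : ⟪G x, G₁ x⟫ = ‖G₁ x‖ ^ 2 := by
        by_cases hx : x ∈ T
        · simp [hG₁, hx]
        · simp [hG₁, hx]
      simp only [hH]
      rw [inner_smul_right, inner_smul_right, this]
      by_cases h0 : ‖G₁ x‖ = 0
      · simp [h0]
      · field_simp
    simp_rw [hpt]
    have hmeas : Measurable (fun x => (w x).toReal * ‖G₁ x‖ * bd Ω x ^ a) :=
      (hwm.ennreal_toReal.mul hG₁m.norm).mul ((measurable_bd Ω).pow_const _)
    rw [integral_eq_lintegral_of_nonneg_ae (Eventually.of_forall fun x => by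
        have := bd_nonneg Ω x
        simp only [Pi.zero_apply]
        positivity) hmeas.aestronglyMeasurable]
    have : ∫⁻ x in Ω, ENNReal.ofReal ((w x).toReal * ‖G₁ x‖ * bd Ω x ^ a) = P := by
      refine setLIntegral_congr_fun hΩ.measurableSet fun x hx => ?_
      rw [ENNReal.ofReal_mul (by positivity), ENNReal.ofReal_mul ENNReal.toReal_nonneg,
        ENNReal.ofReal_toReal (hwt x), ofReal_norm, dw_eq_ofReal (bd_pos hΩ hne hx)]
    rw [this, ENNReal.ofReal_toReal hPt]
  have hPB : P ≤ B * C₁ := by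
    rw [hPint]
    exact (hdual H hHtame).trans (by gcongr)
  have hlow : eLpNorm b p' (indexMeasure J) ≤ 4 * C₃ * P := by
    calc eLpNorm b p' (indexMeasure J) ≤ 2 * ∑ j ∈ J, scale j ^ (n : ℝ) * (b j * v j) := by
          rw [← lintegral_indexMeasure]; exact hv2
      _ ≤ 2 * ∑ j ∈ J, 2 * C₃ * ∫⁻ x in piece Ω j, κ j * h j x * ‖G₁ x‖ₑ * dw Ω a x := by
          refine mul_le_mul_right (Finset.sum_le_sum fun j hj => ?_) _
          have h3 : ∫⁻ x in piece Ω j, ‖G₁ x‖ₑ * h j x * scale j ^ a ≤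
              C₃ * ∫⁻ x in piece Ω j, h j x * ‖G₁ x‖ₑ * dw Ω a x := by
            rw [← lintegral_const_mul' _ _ ENNReal.ofReal_ne_top]
            refine setLIntegral_mono' (measurableSet_piece hΩ j) fun x hx => ?_
            obtain ⟨h0, h1, h2⟩ := hcomp j x hx
            calc _ ≤ ‖G₁ x‖ₑ * h j x * (C₃ * dw Ω a x) := by
                  gcongr; exact scale_le_dw a h0 h1 h2
              _ = _ := by ring
          have h4 : ∫⁻ x in piece Ω j, κ j * h j x * ‖G₁ x‖ₑ * dw Ω a x =
              κ j * ∫⁻ x in piece Ω j, h j x * ‖G₁ x‖ₑ * dw Ω a x := by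
            rw [← lintegral_const_mul' _ _ (hκt j)]
            exact lintegral_congr fun x => by ring
          have h5 := hh2 j
          rw [pieceMeasure, lintegral_smul_measure, smul_eq_mul, ← pieceMeasure] at h5
          rw [lintegral_mul_const' _ _ (scale_rpow_ne_top _ _)] at h3
          rw [h4]
          have h6 : scale j ^ (n : ℝ) * scale j ^ (-(n : ℝ)) = 1 := by
            rw [← scale_add, add_neg_cancel, ENNReal.rpow_zero]
          have h7 : scale j ^ e' = scale j ^ (-e) * scale j ^ a := by
            rw [← scale_add]; congr 1; linarith
          calc scale j ^ (n : ℝ) * (b j * v j)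
              = scale j ^ (n : ℝ) * (scale j ^ e' * eLpNorm G₁ β' (pieceMeasure Ω j) * v j) := rfl
            _ ≤ scale j ^ (n : ℝ) * (scale j ^ e' * (2 * (scale j ^ (-(n : ℝ)) *
                ∫⁻ x in piece Ω j, ‖G₁ x‖ₑ * h j x)) * v j) := by gcongr
            _ = (scale j ^ (n : ℝ) * scale j ^ (-(n : ℝ))) * (2 * (v j * scale j ^ (-e)) *
                ((∫⁻ x in piece Ω j, ‖G₁ x‖ₑ * h j x) * scale j ^ a)) := by
                rw [h7]; ring
            _ ≤ 2 * (v j * scale j ^ (-e)) *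
                (C₃ * ∫⁻ x in piece Ω j, h j x * ‖G₁ x‖ₑ * dw Ω a x) := by
                rw [h6, one_mul]; gcongr
            _ = _ := by rw [hκ]; ring
      _ = 4 * C₃ * P := by rw [← Finset.mul_sum, ← hPsum]; ring
  calc avNorm Ω d c β' p' (1 - s) G₁ ≤ C₂ * eLpNorm b p' (indexMeasure J) :=
        hC₂ G₁ J hG₁m.aestronglyMeasurable fun x _ hx => hG₁J x hx
    _ ≤ C₂ * (4 * C₃ * (B * C₁)) := by gcongr; exact hlow.trans (by gcongr)
    _ = _ := by
      push_cast
      rw [hC₃, ENNReal.ofReal]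
      ring

end NormDuality

section NormLimit

variable {Ω : Set (Euc n)} {E : Type*} [NormedAddCommGroup E]

lemma avNorm_congr_ae (hΩ : IsOpen Ω) (d : ℝ) {c : ℝ} (hc1 : c ≤ 1) (β p : ℝ≥0∞) (s : ℝ)
    {f g : Euc n → E} (h : f =ᵐ[volume.restrict Ω] g) :
    avNorm Ω d c β p s f = avNorm Ω d c β p s g := by
  have hw : ∀ y ∈ Ω, wAvg Ω c β f y = wAvg Ω c β g y := fun y hy =>
    eLpNorm_congr_ae ((avMeasure_absolutelyContinuous hΩ hc1 hy).ae_le h)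
  unfold avNorm avNormOn
  split_ifs
  · exact iSup_congr fun y => iSup_congr fun hy => by rw [hw y hy]
  · congr 1
    exact setLIntegral_congr_fun hΩ.measurableSet fun y hy => by simp only [hw y hy]

lemma avNorm_le_of_tendsto (hΩ : IsOpen Ω) (hne : (frontier Ω).Nonempty) (d : ℝ) {c : ℝ}
    (hc1 : c ≤ 1) (β : ℝ≥0∞) {p : ℝ≥0∞} (hp : 1 ≤ p) (s : ℝ)
    {f : Euc n → E} {F : ℕ → Euc n → E} (hF : ∀ N, AEStronglyMeasurable (F N) (volume.restrict Ω))
    (hle : ∀ N x, ‖F N x‖ ≤ ‖f x‖) (hlim : ∀ x ∈ Ω, Tendsto (fun N => F N x) atTop (𝓝 (f x)))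
    {R : ℝ≥0∞} (hR : ∀ N, avNorm Ω d c β p s (F N) ≤ R) : avNorm Ω d c β p s f ≤ R := by
  have hw : ∀ y ∈ Ω, Tendsto (fun N => wAvg Ω c β (F N) y) atTop (𝓝 (wAvg Ω c β f y)) := by
    intro y hy
    have hac := avMeasure_absolutelyContinuous hΩ hc1 hy
    refine tendsto_of_le_liminf_of_limsup_le ?_ ?_
    · exact Lp.eLpNorm_lim_le_liminf_eLpNorm (fun N => (hF N).mono_ac hac) f
        (hac.ae_le ((ae_restrict_mem hΩ.measurableSet).mono hlim))
    · exact (limsup_le_limsup (Eventually.of_forall fun N =>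
        (eLpNorm_mono (hle N) : wAvg Ω c β (F N) y ≤ wAvg Ω c β f y))).trans
          (limsup_const _).le
  have hdw : ∀ y ∈ Ω, Tendsto (fun N => wAvg Ω c β (F N) y * dw Ω (avExp n d p s) y) atTop
      (𝓝 (wAvg Ω c β f y * dw Ω (avExp n d p s) y)) := fun y hy =>
    ENNReal.Tendsto.mul_const (hw y hy) (Or.inr (dw_ne_top (bd_pos hΩ hne hy)))
  rcases eq_or_ne p ⊤ with rfl | hpt
  · rw [avNorm_top]
    refine iSup₂_le fun y hy => le_of_tendsto' (hdw y hy) fun N => le_trans ?_ (hR N)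
    rw [avNorm_top]
    exact le_iSup₂ (f := fun y (_ : y ∈ Ω) => wAvg Ω c β (F N) y * dw Ω (avExp n d ⊤ s) y) y hy
  · have hp0 : p ≠ 0 := (zero_lt_one.trans_le hp).ne'
    have hpos : 0 < p.toReal := ENNReal.toReal_pos hp0 hpt
    rw [avNorm_of_ne_top hΩ d c β s hp0 hpt, one_div, ENNReal.rpow_inv_le_iff hpos]
    have h1 : ∀ N, ∫⁻ y in Ω, (wAvg Ω c β (F N) y * dw Ω (avExp n d p s) y) ^ p.toReal ≤
        R ^ p.toReal := fun N => by
      have := hR N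
      rwa [avNorm_of_ne_top hΩ d c β s hp0 hpt, one_div, ENNReal.rpow_inv_le_iff hpos] at this
    have h2 : ∀ N, AEMeasurable (fun y => (wAvg Ω c β (F N) y * dw Ω (avExp n d p s) y) ^ p.toReal)
        (volume.restrict Ω) := fun N =>
      ((aemeasurable_wAvg hΩ hc1 β (hF N)).mul (measurable_dw Ω _).aemeasurable).pow_const _
    calc _ = ∫⁻ y in Ω, liminf (fun N =>
          (wAvg Ω c β (F N) y * dw Ω (avExp n d p s) y) ^ p.toReal) atTop := by
          refine setLIntegral_congr_fun hΩ.measurableSet fun y hy => Eq.symm ?_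
          exact ((ENNReal.continuous_rpow_const.tendsto _).comp (hdw y hy)).liminf_eq
      _ ≤ _ := lintegral_liminf_le' h2
      _ ≤ _ := (liminf_le_liminf (Eventually.of_forall h1)).trans (by simp)

lemma exists_avNorm_le_of_dual (hΩ : IsOpen Ω) (hne : (frontier Ω).Nonempty) (d : ℝ)
    {c : ℝ} (hc : 0 < c) (hc1 : c < 1) {β β' : ℝ≥0∞} (hβ : 1 / β + 1 / β' = 1)
    {p p' : ℝ≥0∞} (hp : 1 / p + 1 / p' = 1) (s : ℝ) :
    ∃ C : ℝ≥0, ∀ (G : Euc n → Euc n) (B : ℝ≥0∞), AEStronglyMeasurable G (volume.restrict Ω) →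
      (∀ H, IsTame Ω H →
        ENNReal.ofReal (∫ x in Ω, ⟪G x, bd Ω x ^ (d + 1 - (n : ℝ)) • H x⟫) ≤
          B * avNorm Ω d c β p s H) →
      avNorm Ω d c β' p' (1 - s) G ≤ C * B := by
  obtain ⟨C, hC⟩ := exists_avNorm_indicator_le_of_dual hΩ hne d hc hc1 hβ hp s
  refine ⟨C, fun G B hG hdual => ?_⟩
  have hpc : ENNReal.HolderConjugate p p' := by
    rw [ENNReal.holderConjugate_iff]; simpa using hp
  set G₀ := hG.mk G
  have hG₀ : Measurable G₀ := hG.stronglyMeasurable_mk.measurable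
  have hGG : G =ᵐ[volume.restrict Ω] G₀ := hG.ae_eq_mk
  rw [avNorm_congr_ae hΩ d hc1.le β' p' (1 - s) hGG]
  obtain ⟨ι, hι⟩ := exists_injective_nat (ℤ × (Fin n → ℤ))
  set J : ℕ → Finset (ℤ × (Fin n → ℤ)) := fun N => (Finset.range N).preimage ι hι.injOn
  set T : ℕ → Set (Euc n) := fun N => {x | ‖G₀ x‖ ≤ N} ∩ ⋃ j ∈ J N, piece Ω j
  have hT : ∀ N, MeasurableSet (T N) := fun N =>
    (measurableSet_le hG₀.norm measurable_const).inter
      ((J N).measurableSet_biUnion fun j _ => measurableSet_piece hΩ j)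
  refine avNorm_le_of_tendsto hΩ hne d hc1.le β' (ENNReal.HolderConjugate.one_le p' p) (1 - s)
    (F := fun N => (T N).indicator G₀)
    (fun N => (hG₀.indicator (hT N)).aestronglyMeasurable)
    (fun N x => norm_indicator_le_norm_self _ _) (fun x hx => ?_) (fun N => ?_)
  · obtain ⟨j, hj⟩ := exists_mem_piece hΩ hne hx
    refine tendsto_const_nhds.congr' ?_
    obtain ⟨N₀, hN₀⟩ := exists_nat_ge ‖G₀ x‖
    filter_upwards [eventually_ge_atTop (max N₀ (ι j + 1))] with N hN
    have hxT : x ∈ T N := by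
      refine ⟨hN₀.trans (by exact_mod_cast (le_max_left _ _).trans hN), mem_iUnion₂.2 ⟨j, ?_, hj⟩⟩
      simp only [J, Finset.mem_preimage, Finset.mem_range]
      have := (le_max_right _ _).trans hN
      omega
    rw [indicator_of_mem hxT]
  · refine hC G₀ B (T N) N (J N) hG₀ (hT N) (fun x hx => hx.1)
      (fun x hx => by simpa using hx.2) fun H hH => ?_
    rw [integral_congr_ae (g := fun x => ⟪G x, bd Ω x ^ (d + 1 - (n : ℝ)) • H x⟫)]
    · exact hdual H hH
    · filter_upwards [hGG] with x hx
      rw [hx]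

end NormLimit

section Path

variable {E : Type*} [NormedAddCommGroup E] [NormedSpace ℝ E]

lemma abs_le_integral_norm_fderiv_path {v : E → ℝ} (hv : ContDiff ℝ 1 v) {γ : ℝ → E} {L : ℝ≥0}
    (hγ : LipschitzWith L γ) (h0 : v (γ 0) = 0) {T : ℝ} (hT : 0 ≤ T) :
    |v (γ T)| ≤ ∫ t in 0..T, L * ‖fderiv ℝ v (γ t)‖ := by
  have hcont : Continuous fun t => (L : ℝ) * ‖fderiv ℝ v (γ t)‖ :=
    continuous_const.mul ((hv.continuous_fderiv one_ne_zero).comp hγ.continuous).norm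
  refine image_le_of_liminf_slope_right_le_deriv_boundary (f := fun t => |v (γ t)|)
    (B := fun x => ∫ t in (0 : ℝ)..x, L * ‖fderiv ℝ v (γ t)‖)
    (hv.continuous.comp hγ.continuous).abs.continuousOn (by simp [h0])
    (fun x _ => (hcont.integral_hasStrictDerivAt 0 x).hasDerivAt.continuousAt.continuousWithinAt)
    (fun x _ => (hcont.integral_hasStrictDerivAt 0 x).hasDerivAt.hasDerivWithinAt)
    (fun x _ r hr => ?_) (right_mem_Icc.2 hT)
  obtain ⟨k, hk, hkr⟩ : ∃ k : ℝ≥0, ‖fderiv ℝ v (γ x)‖₊ < k ∧ (L : ℝ) * k < r := by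
    have ht : Tendsto (fun k : ℝ≥0 => (L : ℝ) * k) (𝓝[>] ‖fderiv ℝ v (γ x)‖₊)
        (𝓝 (L * ‖fderiv ℝ v (γ x)‖₊)) :=
      ((continuous_const.mul NNReal.continuous_coe).tendsto _).mono_left nhdsWithin_le_nhds
    obtain ⟨k, hk1, hk2⟩ := ((ht.eventually_lt_const hr).and self_mem_nhdsWithin).exists
    exact ⟨k, hk2, hk1⟩
  obtain ⟨s, hs, hlip⟩ := (hv.contDiffAt.hasStrictFDerivAt
    one_ne_zero).exists_lipschitzOnWith_of_nnnorm_lt k hk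
  have hev : ∀ᶠ z in 𝓝[>] x, γ z ∈ s := nhdsWithin_le_nhds (hγ.continuous.continuousAt hs)
  refine Eventually.frequently ?_
  filter_upwards [hev, self_mem_nhdsWithin] with z hz hxz
  have hzx : 0 < z - x := sub_pos.2 hxz
  rw [slope_def_field, div_lt_iff₀ hzx]
  calc |v (γ z)| - |v (γ x)| ≤ |v (γ z) - v (γ x)| := abs_sub_abs_le_abs_sub _ _
    _ ≤ k * dist (γ z) (γ x) := by
      simpa [Real.dist_eq] using hlip.dist_le_mul _ hz _ (mem_of_mem_nhds hs)
    _ ≤ k * (L * dist z x) := by gcongr; exact hγ.dist_le_mul _ _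
    _ = L * k * (z - x) := by rw [Real.dist_eq, abs_of_pos hzx]; ring
    _ < r * (z - x) := by gcongr

lemma enorm_le_lintegral_enorm_fderiv_path {v : E → ℝ} (hv : ContDiff ℝ 1 v) {γ : ℝ → E} {L : ℝ≥0}
    (hγ : LipschitzWith L γ) (h0 : v (γ 0) = 0) {T : ℝ} (hT : 0 ≤ T) :
    ‖v (γ T)‖ₑ ≤ ∫⁻ t in Ioc 0 T, L * ‖fderiv ℝ v (γ t)‖ₑ := by
  have hcont : Continuous fun t => (L : ℝ) * ‖fderiv ℝ v (γ t)‖ :=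
    continuous_const.mul ((hv.continuous_fderiv one_ne_zero).comp hγ.continuous).norm
  have h := abs_le_integral_norm_fderiv_path hv hγ h0 hT
  rw [intervalIntegral.integral_of_le hT] at h
  calc ‖v (γ T)‖ₑ = ENNReal.ofReal |v (γ T)| := by rw [← Real.norm_eq_abs, ofReal_norm]
    _ ≤ _ := ENNReal.ofReal_le_ofReal h
    _ = ∫⁻ t in Ioc 0 T, ENNReal.ofReal (L * ‖fderiv ℝ v (γ t)‖) :=
      ofReal_integral_eq_lintegral_ofReal (hcont.integrableOn_Ioc)
        (Eventually.of_forall fun t => by simp only [Pi.zero_apply]; positivity)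
    _ = _ := by
      refine lintegral_congr fun t => ?_
      rw [ENNReal.ofReal_mul L.coe_nonneg, ofReal_norm, ENNReal.ofReal_coe_nnreal]

end Path

lemma lintegral_comp_add_smul {F : Euc n → ℝ≥0∞} (hF : Measurable F) (a : Euc n) {r : ℝ}
    (hr : 0 < r) : ∫⁻ h in ball 0 1, F (a + r • h) =
      ENNReal.ofReal (r ^ n)⁻¹ * ∫⁻ z in ball a r, F z := by
  have h1 : ∫⁻ h in ball 0 1, F (a + r • h) = ∫⁻ h, (ball a r).indicator F (a + r • h) := by
    rw [← lintegral_indicator measurableSet_ball]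
    refine lintegral_congr fun h => ?_
    have : a + r • h ∈ ball a r ↔ h ∈ ball (0 : Euc n) 1 := by
      rw [mem_ball, mem_ball, dist_eq_norm, add_sub_cancel_left, norm_smul, Real.norm_of_nonneg
        hr.le, dist_zero_right]
      exact mul_lt_iff_lt_one_right hr
    by_cases hh : h ∈ ball (0 : Euc n) 1
    · rw [indicator_of_mem hh, indicator_of_mem (this.2 hh)]
    · rw [indicator_of_notMem hh, indicator_of_notMem (fun h' => hh (this.1 h'))]
  have hm : Measurable ((ball a r).indicator F) := hF.indicator measurableSet_ball
  have h2 := lintegral_map (μ := volume) (f := fun x => (ball a r).indicator F (a + x))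
    (hm.comp (measurable_const_add a)) (measurable_const_smul r (α := Euc n))
  rw [Measure.map_addHaar_smul _ hr.ne', lintegral_smul_measure] at h2
  rw [h1, ← h2, lintegral_add_left_eq_self (μ := volume) (fun x => (ball a r).indicator F x) a,
    lintegral_indicator measurableSet_ball, finrank_euclideanSpace_fin, smul_eq_mul,
    abs_of_pos (by positivity)]

section Carrot

variable {Ω : Set (Euc n)}

/-- The points of `Ω` in a cone with vertex `x` and at distance at most `K δ(y)` from `y`. -/
def carrotRegion (Ω : Set (Euc n)) (K : ℝ) (x y : Euc n) : Set (Euc n) :=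
  {z | z ∈ Ω ∧ dist z x ≤ K * bd Ω z ∧ dist z y ≤ K * bd Ω y}

lemma measurableSet_carrotRegion (hΩ : IsOpen Ω) (K : ℝ) (x y : Euc n) :
    MeasurableSet (carrotRegion Ω K x y) :=
  hΩ.measurableSet.inter ((measurableSet_le (measurable_id.dist measurable_const)
    ((measurable_bd Ω).const_mul K)).inter
    (measurableSet_le (measurable_id.dist measurable_const) measurable_const))

lemma IsCarrotPath.average_le (hΩ : IsOpen Ω) {lam : ℝ} (hl0 : 0 < lam) (hl1 : lam ≤ 1)
    {x y : Euc n} (hx : x ∈ frontier Ω) (hy : y ∈ Ω) (hζ : IsCarrotPath Ω lam x y)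
    {v : Euc n → ℝ} (hv : ContDiff ℝ 1 v) (hvx : v x = 0) :
    ENNReal.ofReal ((lam / 2 * bd Ω y) ^ n)⁻¹ * ∫⁻ z in ball y (lam / 2 * bd Ω y), ‖v z‖ₑ ≤
      ENNReal.ofReal (4 / lam * ((lam ^ 2 / 4) ^ n)⁻¹) *
        ∫⁻ z in carrotRegion Ω (4 / lam) x y, ‖fderiv ℝ v z‖ₑ * dw Ω (1 - n) z := by
  obtain ⟨T, ζ, hT0, hζ0, hζT, hlip, hmem, hcar⟩ := hζ
  have hne : (frontier Ω).Nonempty := ⟨x, hx⟩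
  have hδ : 0 < bd Ω y := bd_pos hΩ hne hy
  have h0T : (0 : ℝ) ∈ Icc 0 T := left_mem_Icc.2 hT0
  have hTT : T ∈ Icc 0 T := right_mem_Icc.2 hT0
  have hδT : bd Ω y ≤ T := by
    have h1 := hlip.dist_le_mul _ hTT _ h0T
    rw [hζT, hζ0, Real.dist_eq, sub_zero, abs_of_nonneg hT0, NNReal.coe_one, one_mul] at h1
    exact (bd_le_dist hx).trans h1
  have hT : 0 < T := hδ.trans_le hδT
  have hlT : lam * T ≤ bd Ω y := hζT ▸ hcar T hTT
  set κ : ℝ := lam * bd Ω y / (2 * T) with hκ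
  have hκ0 : 0 < κ := by positivity
  have hκ1 : κ ≤ lam / 2 := by
    rw [hκ, div_le_div_iff₀ (by positivity) two_pos]
    nlinarith
  have hκ2 : lam ^ 2 / 2 ≤ κ := by
    rw [hκ, div_le_div_iff₀ two_pos (by positivity)]
    nlinarith
  have hκT : κ * T = lam / 2 * bd Ω y := by rw [hκ]; field_simp
  set ξ : ℝ → Euc n := fun t => ζ (projIcc 0 T hT0 t) with hξ
  have hξe : ∀ t ∈ Icc 0 T, ξ t = ζ t := fun t ht => by rw [hξ]; simp only [projIcc_of_mem hT0 ht]
  have hξl : LipschitzWith 1 ξ := by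
    have := hlip.to_restrict.comp (LipschitzWith.projIcc hT0)
    simpa [Function.comp_def] using this
  set F : Euc n → ℝ≥0∞ := fun z => ‖fderiv ℝ v z‖ₑ with hF
  have hFm : Measurable F := (hv.continuous_fderiv one_ne_zero).enorm.measurable
  have hpath : ∀ h ∈ ball (0 : Euc n) 1, ‖v (y + (κ * T) • h)‖ₑ ≤
      ∫⁻ t in Ioc 0 T, 2 * F (ξ t + (κ * t) • h) := by
    intro h hh
    have hh1 : ‖h‖ ≤ 1 := by simpa using (mem_ball_zero_iff.1 hh).le
    have hγ : LipschitzWith 2 fun t => ξ t + (κ * t) • h := by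
      refine LipschitzWith.of_dist_le_mul fun t s => ?_
      calc dist (ξ t + (κ * t) • h) (ξ s + (κ * s) • h)
          ≤ dist (ξ t) (ξ s) + dist ((κ * t) • h) ((κ * s) • h) := dist_add_add_le _ _ _ _
        _ ≤ 1 * dist t s + κ * dist t s * ‖h‖ := by
          refine add_le_add (by simpa using hξl.dist_le_mul t s) (le_of_eq ?_)
          rw [dist_eq_norm, ← sub_smul, norm_smul, ← mul_sub, norm_mul,
            Real.norm_of_nonneg hκ0.le, Real.dist_eq, Real.norm_eq_abs]
        _ ≤ 1 * dist t s + 1 * dist t s * 1 := by gcongr; linarith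
        _ = _ := by push_cast; ring
    have := enorm_le_lintegral_enorm_fderiv_path hv hγ
      (by simp [hξe 0 h0T, hζ0, hvx]) hT0
    simpa [hξe T hTT, hζT] using this
  have hstep : ∀ t ∈ Ioc 0 T, ∫⁻ h in ball 0 1, 2 * F (ξ t + (κ * t) • h) ≤
      ∫⁻ z in carrotRegion Ω (4 / lam) x y, (Icc (bd Ω z / 2) (2 / lam * bd Ω z)).indicator
        (fun _ => 2 * (ENNReal.ofReal ((lam ^ 2 / 4 * bd Ω z) ^ n)⁻¹ * F z)) t := by
    intro t ht
    have htI : t ∈ Icc 0 T := ⟨ht.1.le, ht.2⟩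
    have hkt : 0 < κ * t := mul_pos hκ0 ht.1
    have hxt := hcar t htI
    have hgeo : ∀ z ∈ ball (ξ t) (κ * t), z ∈ carrotRegion Ω (4 / lam) x y ∧
        bd Ω z / 2 ≤ t ∧ t ≤ 2 / lam * bd Ω z := by
      intro z hz
      rw [hξe t htI, mem_ball] at hz
      have hκt : κ * t ≤ lam / 2 * t := by have := ht.1.le; gcongr
      have hκt' : κ * t ≤ t := by nlinarith [ht.1]
      have hzx : dist z x ≤ 2 * t := by
        have h1 := hlip.dist_le_mul _ htI _ h0T
        rw [hζ0, Real.dist_eq, sub_zero, abs_of_pos ht.1, NNReal.coe_one, one_mul] at h1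
        linarith [dist_triangle z (ζ t) x]
      have hzy : dist z y ≤ T := by
        have h1 := hlip.dist_le_mul _ htI _ hTT
        rw [hζT, Real.dist_eq, abs_sub_comm, abs_of_nonneg (sub_nonneg.2 ht.2), NNReal.coe_one,
          one_mul] at h1
        linarith [dist_triangle z (ζ t) y]
      have hzd : lam * t / 2 ≤ bd Ω z := by
        have := bd_le_add_dist (Ω := Ω) (ζ t) z
        rw [dist_comm] at this
        linarith
      have hzt : t ≤ 2 / lam * bd Ω z := by
        rw [div_mul_eq_mul_div, le_div_iff₀ hl0]; linarith
      have hdx : bd Ω z ≤ 2 * t := (bd_le_dist hx).trans hzx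
      have hΩt : ζ t ∈ Ω := by
        refine (hmem t htI).resolve_right fun h' => ?_
        rw [mem_singleton_iff.1 h'] at hxt
        have h0 : bd Ω x ≤ 0 := by simpa using bd_le_dist (x := x) hx
        exact absurd (mul_pos hl0 ht.1) (by linarith)
      refine ⟨⟨?_, ?_, ?_⟩, by linarith, hzt⟩
      · refine ball_bd_subset hΩ hΩt (mem_ball.2 (hz.trans_le ?_))
        have : 0 < lam * t := mul_pos hl0 ht.1
        linarith
      · calc _ ≤ 2 * t := hzx
          _ ≤ 2 * (2 / lam * bd Ω z) := by gcongr
          _ = _ := by ring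
      · refine hzy.trans ?_
        rw [div_mul_eq_mul_div, le_div_iff₀ hl0]
        linarith
    have hm2 : Measurable fun h => F (ξ t + (κ * t) • h) := hFm.comp (by fun_prop)
    rw [lintegral_const_mul _ hm2, lintegral_comp_add_smul hFm _ hkt,
      ← lintegral_const_mul' _ _ ENNReal.ofReal_ne_top, ← lintegral_const_mul' _ _ (by simp),
      ← lintegral_indicator measurableSet_ball,
      ← lintegral_indicator (measurableSet_carrotRegion hΩ _ x y)]
    refine lintegral_mono fun z => ?_
    by_cases hz : z ∈ ball (ξ t) (κ * t)
    · obtain ⟨h1, h2⟩ := hgeo z hz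
      have hz0 : 0 < bd Ω z := bd_pos hΩ hne h1.1
      rw [indicator_of_mem hz, indicator_of_mem h1, indicator_of_mem (mem_Icc.2 h2)]
      have h3 : lam ^ 2 / 4 * bd Ω z ≤ κ * t := by nlinarith [h2.1, sq_nonneg lam]
      have h4 : ((κ * t) ^ n)⁻¹ ≤ ((lam ^ 2 / 4 * bd Ω z) ^ n)⁻¹ :=
        inv_anti₀ (by positivity) (pow_le_pow_left₀ (by positivity) h3 n)
      gcongr
    · rw [indicator_of_notMem hz]; exact zero_le
  have hm1 : Measurable
      (Function.uncurry fun (h : Euc n) (t : ℝ) => 2 * F (ξ t + (κ * t) • h)) := by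
    have hc : Continuous fun p : Euc n × ℝ => ξ p.2 + (κ * p.2) • p.1 :=
      (hξl.continuous.comp continuous_snd).add (by fun_prop)
    exact (hFm.comp hc.measurable).const_mul 2
  have hm2 : Measurable (Function.uncurry fun (t : ℝ) (z : Euc n) =>
      (Icc (bd Ω z / 2) (2 / lam * bd Ω z)).indicator
        (fun _ => 2 * (ENNReal.ofReal ((lam ^ 2 / 4 * bd Ω z) ^ n)⁻¹ * F z)) t) := by
    have hset : MeasurableSet {p : ℝ × Euc n | bd Ω p.2 / 2 ≤ p.1 ∧ p.1 ≤ 2 / lam * bd Ω p.2} := by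
      have hb : Measurable fun p : ℝ × Euc n => bd Ω p.2 := (measurable_bd Ω).comp measurable_snd
      exact (measurableSet_le (hb.div_const 2) measurable_fst).inter
        (measurableSet_le measurable_fst (hb.const_mul _))
    have hfun : Measurable fun p : ℝ × Euc n =>
        2 * (ENNReal.ofReal ((lam ^ 2 / 4 * bd Ω p.2) ^ n)⁻¹ * F p.2) := by
      have hb : Measurable fun z : Euc n =>
          2 * (ENNReal.ofReal ((lam ^ 2 / 4 * bd Ω z) ^ n)⁻¹ * F z) :=
        (((((measurable_bd Ω).const_mul _).pow_const n).inv.ennreal_ofReal).mul hFm).const_mul 2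
      exact hb.comp measurable_snd
    exact hfun.indicator hset
  have hvm : Measurable fun z => ‖v z‖ₑ := hv.continuous.enorm.measurable
  calc ENNReal.ofReal ((lam / 2 * bd Ω y) ^ n)⁻¹ * ∫⁻ z in ball y (lam / 2 * bd Ω y), ‖v z‖ₑ
      = ∫⁻ h in ball 0 1, ‖v (y + (κ * T) • h)‖ₑ := by
        rw [lintegral_comp_add_smul hvm y (mul_pos hκ0 hT), hκT]
    _ ≤ ∫⁻ h in ball 0 1, ∫⁻ t in Ioc 0 T, 2 * F (ξ t + (κ * t) • h) :=
        setLIntegral_mono' measurableSet_ball hpath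
    _ = ∫⁻ t in Ioc 0 T, ∫⁻ h in ball 0 1, 2 * F (ξ t + (κ * t) • h) :=
        lintegral_lintegral_swap hm1.aemeasurable
    _ ≤ ∫⁻ t in Ioc 0 T, ∫⁻ z in carrotRegion Ω (4 / lam) x y,
        (Icc (bd Ω z / 2) (2 / lam * bd Ω z)).indicator
          (fun _ => 2 * (ENNReal.ofReal ((lam ^ 2 / 4 * bd Ω z) ^ n)⁻¹ * F z)) t :=
        setLIntegral_mono' measurableSet_Ioc hstep
    _ = ∫⁻ z in carrotRegion Ω (4 / lam) x y, ∫⁻ t in Ioc 0 T,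
        (Icc (bd Ω z / 2) (2 / lam * bd Ω z)).indicator
          (fun _ => 2 * (ENNReal.ofReal ((lam ^ 2 / 4 * bd Ω z) ^ n)⁻¹ * F z)) t :=
        lintegral_lintegral_swap hm2.aemeasurable
    _ ≤ ∫⁻ z in carrotRegion Ω (4 / lam) x y, ENNReal.ofReal (4 / lam * ((lam ^ 2 / 4) ^ n)⁻¹) *
        (F z * dw Ω (1 - n) z) := by
        refine setLIntegral_mono' (measurableSet_carrotRegion hΩ _ x y) fun z hz => ?_
        have hz0 : 0 < bd Ω z := bd_pos hΩ hne hz.1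
        have hrw : bd Ω z ^ (1 - (n : ℝ)) = bd Ω z * (bd Ω z ^ n)⁻¹ := by
          rw [Real.rpow_sub hz0, Real.rpow_one, Real.rpow_natCast, div_eq_mul_inv]
        calc _ ≤ ∫⁻ t : ℝ, (Icc (bd Ω z / 2) (2 / lam * bd Ω z)).indicator
              (fun _ => 2 * (ENNReal.ofReal ((lam ^ 2 / 4 * bd Ω z) ^ n)⁻¹ * F z)) t :=
              setLIntegral_le_lintegral _ _
          _ = 2 * (ENNReal.ofReal ((lam ^ 2 / 4 * bd Ω z) ^ n)⁻¹ * F z) *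
              ENNReal.ofReal (2 / lam * bd Ω z - bd Ω z / 2) := by
              rw [lintegral_indicator_const measurableSet_Icc, Real.volume_Icc]
          _ ≤ 2 * (ENNReal.ofReal ((lam ^ 2 / 4 * bd Ω z) ^ n)⁻¹ * F z) *
              ENNReal.ofReal (2 / lam * bd Ω z) := by
              gcongr; linarith
          _ = (ENNReal.ofReal 2 * (ENNReal.ofReal ((lam ^ 2 / 4 * bd Ω z) ^ n)⁻¹ *
              ENNReal.ofReal (2 / lam * bd Ω z))) * F z := by
              rw [ENNReal.ofReal_ofNat]; ring
          _ = (ENNReal.ofReal (4 / lam * ((lam ^ 2 / 4) ^ n)⁻¹) * dw Ω (1 - n) z) * F z := by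
              rw [dw_eq_ofReal hz0, ← ENNReal.ofReal_mul (by positivity),
                ← ENNReal.ofReal_mul (by positivity), ← ENNReal.ofReal_mul (by positivity), hrw,
                mul_pow, mul_inv]
              congr 2
              ring
          _ = _ := by ring
    _ = _ := lintegral_const_mul' _ _ ENNReal.ofReal_ne_top

end Carrot

section Ahlfors

lemma isPreconnected_compl_closedBall_of_one_lt_rank {E : Type*} [NormedAddCommGroup E]
    [NormedSpace ℝ E] (h : 1 < Module.rank ℝ E) (x : E) {r : ℝ} (hr : 0 ≤ r) :
    IsPreconnected (closedBall x r)ᶜ := by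
  have him : (closedBall x r)ᶜ =
      (fun p : ℝ × E => x + p.1 • p.2) '' (Ioi r ×ˢ sphere (0 : E) 1) := by
    ext z
    simp only [mem_compl_iff, mem_closedBall, not_le, mem_image, mem_prod, mem_Ioi,
      mem_sphere_zero_iff_norm, Prod.exists]
    constructor
    · intro hz
      have hp : 0 < ‖z - x‖ := by rw [← dist_eq_norm]; exact hr.trans_lt hz
      refine ⟨‖z - x‖, ‖z - x‖⁻¹ • (z - x), ⟨by rwa [← dist_eq_norm], ?_⟩, ?_⟩
      · rw [norm_smul, norm_inv, norm_norm, inv_mul_cancel₀ hp.ne']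
      · rw [smul_smul, mul_inv_cancel₀ hp.ne', one_smul, add_sub_cancel]
    · rintro ⟨a, b, ⟨ha, hb⟩, rfl⟩
      rw [dist_eq_norm, add_sub_cancel_left, norm_smul, hb, mul_one, Real.norm_eq_abs]
      exact ha.trans_le (le_abs_self a)
  rw [him]
  exact (isPreconnected_Ioi.prod (isPreconnected_sphere h 0 1)).image _ (by fun_prop)

variable {Ω : Set (Euc n)} {d A₀ : ℝ}

lemma ofReal_bd_le_diam (hn : 2 ≤ n) (hΩ : IsOpen Ω) (hne : (frontier Ω).Nonempty)
    (hunb : ¬ Bornology.IsBounded Ωᶜ) {y : Euc n} (hy : y ∈ Ω) :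
    ENNReal.ofReal (bd Ω y) ≤ ediam (frontier Ω) := by
  by_contra! h
  obtain ⟨ξ, hξ⟩ := hne
  have ht : ediam (frontier Ω) ≠ ⊤ := (h.trans ENNReal.ofReal_lt_top).ne
  set r := (ediam (frontier Ω)).toReal with hr
  have hry : r < bd Ω y := by
    rw [← ENNReal.ofReal_toReal ht] at h
    exact (ENNReal.ofReal_lt_ofReal_iff_of_nonneg ENNReal.toReal_nonneg).1 h
  have hsub : frontier Ω ⊆ closedBall ξ r := by
    intro z hz
    rw [mem_closedBall, dist_edist]
    exact ENNReal.toReal_mono ht (Metric.edist_le_ediam_of_mem hz hξ)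
  have hrank : 1 < Module.rank ℝ (Euc n) := by
    rw [← Module.finrank_eq_rank, finrank_euclideanSpace_fin]
    exact_mod_cast hn
  have hs := subset_of_isPreconnected hΩ
    (isPreconnected_compl_closedBall_of_one_lt_rank hrank ξ ENNReal.toReal_nonneg)
    (disjoint_compl_left.mono_right hsub) (x := y)
    (by simpa using hry.trans_le (bd_le_dist hξ)) hy
  exact hunb (isBounded_closedBall.subset (compl_subset_comm.1 hs))

lemma AhlforsRegular.exists_measure_ball_le {Γ : Set (Euc n)} (hΓ : AhlforsRegular d A₀ Γ)
    (hd : 0 ≤ d) (hcl : IsClosed Γ) (hpos : 0 < ediam Γ) :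
    ∃ C : ℝ, 0 ≤ C ∧
      ∀ ξ ∈ Γ, ∀ r : ℝ, 0 < r → hm n d (ball ξ r ∩ Γ) ≤ ENNReal.ofReal (C * r ^ d) := by
  obtain ⟨-, hA, hreg⟩ := hΓ
  rcases eq_or_ne (ediam Γ) ⊤ with ht | ht
  · exact ⟨A₀, hA.le, fun ξ hξ r hr => (hreg ξ hξ r hr (le_top.trans_eq ht.symm)).2⟩
  set D := (ediam Γ).toReal with hD
  have hD0 : 0 < D := ENNReal.toReal_pos hpos.ne' ht
  have hDD : ENNReal.ofReal D = ediam Γ := ENNReal.ofReal_toReal ht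
  have hcomp : IsCompact Γ := isCompact_of_isClosed_isBounded hcl
    (isBounded_iff_ediam_ne_top.2 ht)
  have hfin : hm n d Γ ≠ ⊤ := by
    obtain ⟨t, htΓ, hcov⟩ := hcomp.elim_nhds_subcover (fun ξ => ball ξ D)
      (fun ξ _ => ball_mem_nhds ξ hD0)
    have hsub : Γ ⊆ ⋃ ξ ∈ t, ball ξ D ∩ Γ := fun z hz => by
      obtain ⟨ξ, hξ, hzξ⟩ := mem_iUnion₂.1 (hcov hz)
      exact mem_iUnion₂.2 ⟨ξ, hξ, hzξ, hz⟩
    refine ((measure_mono hsub).trans (measure_biUnion_finset_le _ _)).trans_lt ?_ |>.ne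
    refine ENNReal.sum_lt_top.2 fun ξ hξ => ?_
    exact (hreg ξ (htΓ ξ hξ) D hD0 hDD.le).2.trans_lt ENNReal.ofReal_lt_top
  refine ⟨max A₀ ((hm n d Γ).toReal / D ^ d), hA.le.trans (le_max_left _ _), fun ξ hξ r hr => ?_⟩
  rcases le_or_gt (ENNReal.ofReal r) (ediam Γ) with h | h
  · refine (hreg ξ hξ r hr h).2.trans (ENNReal.ofReal_le_ofReal ?_)
    gcongr
    exact le_max_left _ _
  · have hDr : D ≤ r := by
      rw [← hDD] at h
      exact ((ENNReal.ofReal_lt_ofReal_iff hr).1 h).le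
    refine (measure_mono inter_subset_right).trans
      ((ENNReal.ofReal_toReal hfin).symm.trans_le (ENNReal.ofReal_le_ofReal ?_))
    calc (hm n d Γ).toReal = (hm n d Γ).toReal / D ^ d * D ^ d := by
          rw [div_mul_cancel₀]; exact (Real.rpow_pos_of_pos hD0 d).ne'
      _ ≤ _ := by
        gcongr
        exact le_max_right _ _

end Ahlfors

lemma isCarrotPath_segment {Ω : Set (Euc n)} (hΩ : IsOpen Ω) {x y : Euc n} (hy : y ∈ Ω)
    (hxy : dist y x = bd Ω y) : IsCarrotPath Ω 1 x y := by
  have hδ0 := bd_nonneg Ω y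
  set D := bd Ω y with hD
  have hn : ‖y - x‖ = D := by rw [← dist_eq_norm, hxy]
  rcases hδ0.eq_or_lt with h0 | hpos
  · rw [← h0, norm_eq_zero, sub_eq_zero] at hn
    refine ⟨0, fun _ => x, le_rfl, rfl, hn.symm,
      LipschitzOnWith.of_dist_le_mul fun t _ s _ => by simp, fun t _ => Or.inr rfl, fun t ht => ?_⟩
    have : t = 0 := le_antisymm ht.2 ht.1
    simpa [this] using bd_nonneg Ω x
  set ζ : ℝ → Euc n := fun t => x + (t / D) • (y - x) with hζ
  have hdist : ∀ t s, dist (ζ t) (ζ s) = dist t s := by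
    intro t s
    rw [hζ, dist_add_left, dist_eq_norm, ← sub_smul, norm_smul, hn, ← sub_div, norm_div,
      Real.norm_of_nonneg hδ0, div_mul_cancel₀ _ hpos.ne', Real.dist_eq, Real.norm_eq_abs]
  have hζD : ζ D = y := by simp [hζ, hpos.ne']
  have hty : ∀ t ∈ Icc 0 D, dist (ζ t) y = D - t := fun t ht => by
    rw [← hζD, hdist, Real.dist_eq, abs_sub_comm, abs_of_nonneg (sub_nonneg.2 ht.2)]
  refine ⟨D, ζ, hδ0, by simp [hζ], hζD, ?_, fun t ht => ?_, fun t ht => ?_⟩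
  · exact LipschitzOnWith.of_dist_le_mul fun t _ s _ => by simp [hdist]
  · rcases ht.1.eq_or_lt with rfl | ht0
    · exact Or.inr (by simp [hζ])
    · exact Or.inl (ball_bd_subset hΩ hy (mem_ball.2 (by rw [hty t ht, ← hD]; linarith)))
  · have h1 := bd_le_add_dist (Ω := Ω) y (ζ t)
    rw [dist_comm, hty t ht, ← hD] at h1
    linarith

section AveragedEstimate

variable {Ω : Set (Euc n)} {d A₀ : ℝ}

lemma lintegral_setLIntegral_carrotRegion_le (hΩ : IsOpen Ω) {ν : Measure (Euc n)} [SFinite ν]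
    (K : ℝ) (y : Euc n) {f m : Euc n → ℝ≥0∞} (hf : Measurable f)
    (hν : ∀ z ∈ Ω, ν {x | dist z x ≤ K * bd Ω z} ≤ m z) :
    ∫⁻ x, (∫⁻ z in carrotRegion Ω K x y, f z) ∂ν ≤
      ∫⁻ z in {z | z ∈ Ω ∧ dist z y ≤ K * bd Ω y}, f z * m z := by
  set S := {z | z ∈ Ω ∧ dist z y ≤ K * bd Ω y} with hS
  have hSm : MeasurableSet S := hΩ.measurableSet.inter
    (measurableSet_le (measurable_id.dist measurable_const) measurable_const)
  set P : Set (Euc n × Euc n) := {q | dist q.2 q.1 ≤ K * bd Ω q.2} with hP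
  have hPm : MeasurableSet P := measurableSet_le (by fun_prop)
    (((measurable_bd Ω).comp measurable_snd).const_mul K)
  have h1 : ∀ x, ∫⁻ z in carrotRegion Ω K x y, f z =
      ∫⁻ z in S, P.indicator (fun q => f q.2) (x, z) := fun x => by
    have : (fun z => P.indicator (fun q => f q.2) (x, z)) =
        ({z | dist z x ≤ K * bd Ω z} : Set (Euc n)).indicator f := by
      ext z; simp only [indicator, hP, mem_ofPred_eq]
    have hm : MeasurableSet {z | dist z x ≤ K * bd Ω z} :=
      measurableSet_le (by fun_prop) ((measurable_bd Ω).const_mul K)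
    rw [this, setLIntegral_indicator hm]
    congr 2
    ext z
    simp only [carrotRegion, hS, mem_inter_iff, mem_ofPred_eq]
    tauto
  simp_rw [h1]
  rw [lintegral_lintegral_swap (f := fun x z => P.indicator (fun q => f q.2) (x, z))
    (by exact ((hf.comp measurable_snd).indicator hPm).aemeasurable)]
  refine setLIntegral_mono_ae' hSm (ae_of_all _ fun z hz => ?_)
  have : (fun x => P.indicator (fun q => f q.2) (x, z)) =
      ({x | dist z x ≤ K * bd Ω z} : Set (Euc n)).indicator fun _ => f z := by
    ext x; simp only [indicator, hP, mem_ofPred_eq]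
  rw [this, lintegral_indicator_const (measurableSet_le (by fun_prop) measurable_const)]
  gcongr
  exact hν z hz.1

lemma exists_averaged_bound_of_lt_one (hΩ : IsOpen Ω) (hne : (frontier Ω).Nonempty) :
    ∃ C : ℝ≥0, ∀ v : Euc n → ℝ, ContDiff ℝ 1 v → (∀ x ∈ frontier Ω, v x = 0) → ∀ y ∈ Ω,
      dw Ω 0 y * (ENNReal.ofReal ((1 / 2 * bd Ω y) ^ n)⁻¹ *
        ∫⁻ z in ball y (1 / 2 * bd Ω y), ‖v z‖ₑ) ≤
      C * ∫⁻ z in {z | z ∈ Ω ∧ dist z y ≤ 4 * bd Ω y}, ‖fderiv ℝ v z‖ₑ * dw Ω (1 - n + 0) z := by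
  refine ⟨(4 / 1 * (((1 : ℝ) ^ 2 / 4) ^ n)⁻¹).toNNReal, fun v hv h0 y hy => ?_⟩
  obtain ⟨x, hx, hxy⟩ := exists_nearest hne y
  have h := (isCarrotPath_segment hΩ hy hxy).average_le hΩ one_pos le_rfl hx hy hv (h0 x hx)
  rw [show dw Ω 0 y = 1 by simp [dw], one_mul, add_zero]
  refine h.trans ?_
  have hsub : carrotRegion Ω 4 x y ⊆ {z | z ∈ Ω ∧ dist z y ≤ 4 * bd Ω y} :=
    fun z hz => ⟨hz.1, hz.2.2⟩
  rw [div_one, ENNReal.ofReal]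
  exact mul_le_mul_right (lintegral_mono_set hsub) _

lemma exists_averaged_bound_of_one_le (hΩ : IsOpen Ω) (hd : 1 ≤ d) (hdn : d < n)
    (hΓ : AhlforsRegular d A₀ (frontier Ω)) (hJ : WeakLocalJohn Ω d)
    (hunb : ¬ Bornology.IsBounded Ωᶜ) :
    ∃ (c K : ℝ) (C : ℝ≥0), 0 < c ∧ c < 1 ∧ 0 ≤ K ∧
      ∀ v : Euc n → ℝ, ContDiff ℝ 1 v → (∀ x ∈ frontier Ω, v x = 0) → ∀ y ∈ Ω,
      dw Ω d y * (ENNReal.ofReal ((c * bd Ω y) ^ n)⁻¹ *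
        ∫⁻ z in ball y (c * bd Ω y), ‖v z‖ₑ) ≤
      C * ∫⁻ z in {z | z ∈ Ω ∧ dist z y ≤ K * bd Ω y}, ‖fderiv ℝ v z‖ₑ * dw Ω (1 - n + d) z := by
  obtain ⟨θ, lam, N, hθ, -, hl0, hl1, hN, hwlj⟩ := hJ
  have hne := hΓ.1
  have hn : 2 ≤ n := by
    have : (1 : ℝ) < n := hd.trans_lt hdn
    exact_mod_cast this
  have hA := hΓ.2.1
  set K := 4 / lam with hK
  have hK0 : 0 < K := by positivity
  rcases Ω.eq_empty_or_nonempty with rfl | ⟨y₀, hy₀⟩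
  · exact ⟨lam / 2, K, 0, by positivity, by linarith, hK0.le, fun v _ _ y hy => absurd hy (by simp)⟩
  have hdiam : 0 < ediam (frontier Ω) :=
    (ENNReal.ofReal_pos.2 (bd_pos hΩ hne hy₀)).trans_le (ofReal_bd_le_diam hn hΩ hne hunb hy₀)
  obtain ⟨C₁, hC₁, hup⟩ := hΓ.exists_measure_ball_le (by linarith) isClosed_frontier hdiam
  have hlow : ∀ y ∈ Ω, ENNReal.ofReal A₀⁻¹ * dw Ω d y ≤
      hm n d (ball y (N * bd Ω y) ∩ frontier Ω) := fun y hy => by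
    obtain ⟨ξ, hξ, hξy⟩ := exists_nearest hne y
    have hδ := bd_pos hΩ hne hy
    rw [dw_eq_ofReal hδ, ← ENNReal.ofReal_mul (by positivity), inv_mul_eq_div]
    refine (hΓ.2.2 ξ hξ _ hδ (ofReal_bd_le_diam hn hΩ hne hunb hy)).1.trans
      (measure_mono (inter_subset_inter_left _ (ball_subset_ball' ?_)))
    rw [dist_comm, hξy]
    nlinarith
  have hcov : ∀ z ∈ Ω, hm n d ({x | dist z x ≤ K * bd Ω z} ∩ frontier Ω) ≤
      ENNReal.ofReal (C₁ * (K + 2) ^ d) * dw Ω d z := fun z hz => by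
    obtain ⟨ξ, hξ, hξz⟩ := exists_nearest hne z
    have hδ := bd_pos hΩ hne hz
    rw [dw_eq_ofReal hδ, ← ENNReal.ofReal_mul (by positivity), mul_assoc,
      ← Real.mul_rpow (by positivity) hδ.le]
    refine (measure_mono (inter_subset_inter_left _ fun x hx => ?_)).trans
      (hup ξ hξ ((K + 2) * bd Ω z) (by positivity))
    have h1 := dist_triangle_left x ξ z
    simp only [mem_ofPred_eq] at hx
    rw [mem_ball]
    nlinarith
  set c₀ : ℝ≥0∞ := ENNReal.ofReal θ * ENNReal.ofReal A₀⁻¹ with hc₀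
  have hc00 : c₀ ≠ 0 := by
    simp only [hc₀, ne_eq, mul_eq_zero, ENNReal.ofReal_eq_zero, not_or, not_le]
    exact ⟨hθ, inv_pos.2 hA⟩
  have hc0t : c₀ ≠ ⊤ := ENNReal.mul_ne_top ENNReal.ofReal_ne_top ENNReal.ofReal_ne_top
  set C₂ : ℝ≥0∞ := ENNReal.ofReal (4 / lam * ((lam ^ 2 / 4) ^ n)⁻¹) with hC₂
  set C₃ : ℝ≥0∞ := ENNReal.ofReal (C₁ * (K + 2) ^ d) with hC₃
  have hCt : c₀⁻¹ * (C₂ * C₃) ≠ ⊤ := ENNReal.mul_ne_top (ENNReal.inv_ne_top.2 hc00)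
    (ENNReal.mul_ne_top ENNReal.ofReal_ne_top ENNReal.ofReal_ne_top)
  refine ⟨lam / 2, K, (c₀⁻¹ * (C₂ * C₃)).toNNReal, by positivity, by linarith, hK0.le,
    fun v hv h0 y hy => ?_⟩
  rw [ENNReal.coe_toNNReal hCt]
  obtain ⟨F, hFm, hFs, hFσ, hFp⟩ := hwlj y hy
  set L : ℝ≥0∞ := ENNReal.ofReal ((lam / 2 * bd Ω y) ^ n)⁻¹ *
    ∫⁻ z in ball y (lam / 2 * bd Ω y), ‖v z‖ₑ with hL
  have hδ := bd_pos hΩ hne hy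
  have hFfin : hm n d F < ⊤ := by
    obtain ⟨ξ, hξ, hξy⟩ := exists_nearest hne y
    refine (measure_mono (hFs.trans (inter_subset_inter_left _ (ball_subset_ball' ?_)))).trans_lt
      ((hup ξ hξ (N * bd Ω y + bd Ω y) (by positivity)).trans_lt ENNReal.ofReal_lt_top)
    rw [hξy]
  set ν := (hm n d).restrict F with hν
  have : IsFiniteMeasure ν := ⟨by rwa [hν, Measure.restrict_apply_univ]⟩
  set f : Euc n → ℝ≥0∞ := fun z => ‖fderiv ℝ v z‖ₑ * dw Ω (1 - n) z with hf
  have hfm : Measurable f :=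
    (hv.continuous_fderiv one_ne_zero).enorm.measurable.mul (measurable_dw Ω _)
  have h1 : L * hm n d F ≤ C₂ * ∫⁻ x, (∫⁻ z in carrotRegion Ω K x y, f z) ∂ν := by
    rw [← lintegral_const_mul' _ _ ENNReal.ofReal_ne_top, ← setLIntegral_const F L, hν]
    exact setLIntegral_mono_ae' hFm (ae_of_all _ fun x hx =>
      IsCarrotPath.average_le hΩ hl0 hl1 (hFs hx).2 hy (hFp x hx) hv (h0 x (hFs hx).2))
  have h2 := lintegral_setLIntegral_carrotRegion_le hΩ (ν := ν) K y hfm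
    (m := fun z => C₃ * dw Ω d z) fun z hz => by
      rw [hν, Measure.restrict_apply (measurableSet_le (by fun_prop) measurable_const)]
      exact (measure_mono (inter_subset_inter_right _ fun x hx => (hFs hx).2)).trans (hcov z hz)
  have hSm : MeasurableSet {z | z ∈ Ω ∧ dist z y ≤ K * bd Ω y} := hΩ.measurableSet.inter
    (measurableSet_le (measurable_id.dist measurable_const) measurable_const)
  have h3 : ∫⁻ z in {z | z ∈ Ω ∧ dist z y ≤ K * bd Ω y}, f z * (C₃ * dw Ω d z) =
      C₃ * ∫⁻ z in {z | z ∈ Ω ∧ dist z y ≤ K * bd Ω y},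
        ‖fderiv ℝ v z‖ₑ * dw Ω (1 - n + d) z := by
    rw [← lintegral_const_mul' _ _ ENNReal.ofReal_ne_top]
    refine setLIntegral_congr_fun hSm fun z hz => ?_
    simp only [hf]
    rw [dw_add (bd_pos hΩ hne hz.1)]
    ring
  have h4 : c₀ * (dw Ω d y * L) ≤ L * hm n d F := by
    rw [hc₀]
    calc _ = L * (ENNReal.ofReal θ * (ENNReal.ofReal A₀⁻¹ * dw Ω d y)) := by ring
      _ ≤ _ := by
        gcongr
        exact (mul_le_mul_right (hlow y hy) _).trans hFσ
  rw [mul_assoc, mul_assoc, ← h3]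
  rw [← ENNReal.mul_le_iff_le_inv hc00 hc0t]
  exact h4.trans (h1.trans (mul_le_mul_right h2 _))

end AveragedEstimate

section Hardy

variable {Ω : Set (Euc n)} {d A₀ : ℝ}

lemma exists_setLIntegral_dw_le (hΩ : IsOpen Ω) (hne : (frontier Ω).Nonempty) {K γ : ℝ}
    (hK : 0 ≤ K) (hγ : 0 < γ) :
    ∃ C : ℝ≥0, ∀ z ∈ Ω, ∫⁻ y in {y | dist z y < K * bd Ω y} ∩ Ω, dw Ω (-n - γ) y ≤
      C * dw Ω (-γ) z := by
  set G : Euc n → ℝ≥0∞ := fun x => ENNReal.ofReal ((1 + ‖x‖) ^ (-(n + γ))) with hG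
  have hGm : Measurable G := by fun_prop
  have hGt : ∫⁻ x, G x < ⊤ := finite_integral_one_add_norm (by simpa using hγ)
  set C₁ : ℝ≥0∞ := ENNReal.ofReal ((1 + 2 * K) ^ (n + γ)) with hC₁
  refine ⟨(C₁ * ∫⁻ x, G x).toNNReal, fun z hz => ?_⟩
  rw [ENNReal.coe_toNNReal (ENNReal.mul_ne_top ENNReal.ofReal_ne_top hGt.ne)]
  have hδ := bd_pos hΩ hne hz
  set r := bd Ω z with hr
  have hSm : MeasurableSet ({y | dist z y < K * bd Ω y} ∩ Ω) := (measurableSet_lt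
    (by fun_prop) ((measurable_bd Ω).const_mul K)).inter hΩ.measurableSet
  have hpt : ∀ y ∈ {y | dist z y < K * bd Ω y} ∩ Ω, dw Ω (-n - γ) y ≤
      C₁ * (ENNReal.ofReal (r ^ (-(n + γ))) * G (r⁻¹ • (y - z))) := by
    rintro y ⟨hy, hyΩ⟩
    simp only [mem_ofPred_eq] at hy
    have hδy := bd_pos hΩ hne hyΩ
    have h1 := bd_le_add_dist (Ω := Ω) z y
    rw [dw_eq_ofReal hδy, hG, ← ENNReal.ofReal_mul (by positivity),
      ← ENNReal.ofReal_mul (by positivity)]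
    refine ENNReal.ofReal_le_ofReal ?_
    have h2 : r * (1 + ‖r⁻¹ • (y - z)‖) = r + dist z y := by
      rw [norm_smul, norm_inv, Real.norm_of_nonneg hδ.le, dist_comm, dist_eq_norm]
      field_simp
    rw [← Real.mul_rpow hδ.le (by positivity), h2,
      show (-(n : ℝ) - γ) = -(n + γ) by ring, Real.rpow_neg hδy.le, Real.rpow_neg (by positivity),
      ← div_eq_mul_inv, le_div_iff₀ (by positivity), inv_mul_le_iff₀ (by positivity),
      ← Real.mul_rpow hδy.le (by positivity)]
    refine Real.rpow_le_rpow (by positivity) ?_ (by positivity)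
    nlinarith
  refine (setLIntegral_mono_ae' hSm (ae_of_all _ hpt)).trans ?_
  refine (setLIntegral_le_lintegral _ _).trans ?_
  rw [lintegral_const_mul _ (by fun_prop), lintegral_const_mul _ (by fun_prop), mul_assoc]
  refine mul_le_mul_right ?_ C₁
  have h3 : ∫⁻ y, G (r⁻¹ • (y - z)) = ENNReal.ofReal (r ^ n) * ∫⁻ x, G x := by
    rw [lintegral_sub_right_eq_self (fun y => G (r⁻¹ • y)) z,
      ← lintegral_map (μ := volume) hGm (measurable_const_smul r⁻¹),
      Measure.map_addHaar_smul _ (inv_ne_zero hδ.ne'), lintegral_smul_measure, smul_eq_mul,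
      finrank_euclideanSpace_fin, abs_of_pos (by positivity)]
    simp
  rw [h3, ← mul_assoc, ← ENNReal.ofReal_mul (by positivity), mul_comm, dw_eq_ofReal hδ,
    ← Real.rpow_natCast, ← Real.rpow_add hδ]
  rw [neg_add_rev, neg_add_cancel_right]

lemma exists_averaged_bound (hΩ : IsOpen Ω) (hdn : d < n)
    (hΓ : AhlforsRegular d A₀ (frontier Ω)) (hJ : WeakLocalJohn Ω d)
    (hunb : ¬ Bornology.IsBounded Ωᶜ) :
    ∃ (e c K : ℝ) (C : ℝ≥0), d - 1 < e ∧ 0 < c ∧ c < 1 ∧ 0 ≤ K ∧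
      ∀ v : Euc n → ℝ, ContDiff ℝ 1 v → (∀ x ∈ frontier Ω, v x = 0) → ∀ y ∈ Ω,
      dw Ω e y * (ENNReal.ofReal ((c * bd Ω y) ^ n)⁻¹ *
        ∫⁻ z in ball y (c * bd Ω y), ‖v z‖ₑ) ≤
      C * ∫⁻ z in {z | z ∈ Ω ∧ dist z y ≤ K * bd Ω y}, ‖fderiv ℝ v z‖ₑ * dw Ω (1 - n + e) z := by
  rcases lt_or_ge d 1 with h | h
  · obtain ⟨C, hC⟩ := exists_averaged_bound_of_lt_one hΩ hΓ.1
    exact ⟨0, 1 / 2, 4, C, by linarith, by norm_num, by norm_num, by norm_num, hC⟩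
  · obtain ⟨c, K, C, h1, h2, h3, hC⟩ := exists_averaged_bound_of_one_le hΩ h hdn hΓ hJ hunb
    exact ⟨d, c, K, C, by linarith, h1, h2, h3, hC⟩

lemma exists_lintegral_dw_le_lintegral_fderiv (hΩ : IsOpen Ω) (hdn : d < n)
    (hΓ : AhlforsRegular d A₀ (frontier Ω)) (hJ : WeakLocalJohn Ω d)
    (hunb : ¬ Bornology.IsBounded Ωᶜ) :
    ∃ C : ℝ≥0, ∀ v : Euc n → ℝ, ContDiff ℝ 1 v → (∀ x ∈ frontier Ω, v x = 0) →
      ∫⁻ x in Ω, ‖v x‖ₑ * dw Ω (d - n - 1) x ≤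
        C * ∫⁻ x in Ω, ‖fderiv ℝ v x‖ₑ * dw Ω (d - n) x := by
  obtain ⟨e, c, K, C₁, he, hc, hc1, hK, hav⟩ := exists_averaged_bound hΩ hdn hΓ hJ hunb
  have hne := hΓ.1
  obtain ⟨C₂, hC₂⟩ := exists_lintegral_average_comparable hΩ hne hc hc1 (d - n - 1)
  obtain ⟨C₃, hC₃⟩ := exists_setLIntegral_dw_le hΩ hne (K := K + 1) (γ := 1 + e - d)
    (by linarith) (by linarith)
  set V := volume (ball (0 : Euc n) 1) with hV
  have hV0 : V⁻¹ ≠ ⊤ := ENNReal.inv_ne_top.2 (measure_ball_pos _ _ one_pos).ne'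
  refine ⟨C₂ * (V⁻¹.toNNReal * C₁ * C₃), fun v hv h0 => ?_⟩
  set f : Euc n → ℝ≥0∞ := fun z => ‖fderiv ℝ v z‖ₑ * dw Ω (1 - n + e) z with hf
  have hfm : Measurable f :=
    (hv.continuous_fderiv one_ne_zero).enorm.measurable.mul (measurable_dw Ω _)
  refine (hC₂ _ hv.continuous.enorm.measurable.aemeasurable).1.trans ?_
  push_cast
  rw [mul_assoc, ENNReal.coe_toNNReal hV0]
  gcongr
  calc _ ≤ ∫⁻ y in Ω, V⁻¹ * C₁ * (dw Ω (-n - (1 + e - d)) y *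
        ∫⁻ z in ball y ((K + 1) * bd Ω y) ∩ Ω, f z) := by
        refine setLIntegral_mono_ae' hΩ.measurableSet (ae_of_all _ fun y hy => ?_)
        have hδ := bd_pos hΩ hne hy
        have h1 := (hav v hv h0 y hy).trans (mul_le_mul_right (lintegral_mono_set
          (t := ball y ((K + 1) * bd Ω y) ∩ Ω) fun z hz => ⟨mem_ball.2 ?_, hz.1⟩) _)
        · have hvol : (volume (ball y (c * bd Ω y)))⁻¹ =
              ENNReal.ofReal ((c * bd Ω y) ^ n)⁻¹ * V⁻¹ := by
            rw [Measure.addHaar_ball_of_pos _ _ (by positivity), finrank_euclideanSpace_fin,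
              ENNReal.mul_inv (Or.inr measure_ball_lt_top.ne) (Or.inl ENNReal.ofReal_ne_top),
              ENNReal.ofReal_inv_of_pos (by positivity)]
          rw [hvol, show d - n - 1 = e + (-n - (1 + e - d)) by ring, dw_add hδ]
          calc _ = V⁻¹ * dw Ω (-n - (1 + e - d)) y * (dw Ω e y *
                (ENNReal.ofReal ((c * bd Ω y) ^ n)⁻¹ *
                  ∫⁻ z in ball y (c * bd Ω y), ‖v z‖ₑ)) := by ring
            _ ≤ _ := mul_le_mul_right h1 _
            _ = _ := by ring
        · have := hz.2
          linarith
    _ = V⁻¹ * C₁ * ∫⁻ z in Ω, f z *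
          ∫⁻ y in {y | dist z y < (K + 1) * bd Ω y} ∩ Ω, dw Ω (-n - (1 + e - d)) y := by
        rw [lintegral_const_mul' _ _ (ENNReal.mul_ne_top hV0 ENNReal.coe_ne_top),
          setLIntegral_swap Ω (K + 1) (measurable_dw Ω _) hfm.aemeasurable]
    _ ≤ V⁻¹ * C₁ * ∫⁻ z in Ω, C₃ * (‖fderiv ℝ v z‖ₑ * dw Ω (d - n) z) := by
        refine mul_le_mul_right ?_ _
        refine setLIntegral_mono_ae' hΩ.measurableSet (ae_of_all _ fun z hz => ?_)
        rw [show d - n = (1 - n + e) + -(1 + e - d) by ring, dw_add (bd_pos hΩ hne hz)]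
        refine (mul_le_mul_right (hC₃ z hz) _).trans_eq ?_
        simp only [hf]
        ring
    _ = _ := by
        rw [lintegral_const_mul' _ _ ENNReal.coe_ne_top]
        ring

end Hardy

section HardyLtwo

variable {Ω : Set (Euc n)} {d A₀ : ℝ}

lemma enorm_gradient (φ : Euc n → ℝ) (x : Euc n) : ‖gradient φ x‖ₑ = ‖fderiv ℝ φ x‖ₑ := by
  rw [gradient, ← ofReal_norm, ← ofReal_norm, LinearIsometryEquiv.norm_map]

lemma enorm_bd_rpow_smul {F : Type*} [NormedAddCommGroup F] [NormedSpace ℝ F] {a : ℝ} {x : Euc n}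
    (h : 0 < bd Ω x) (v : F) : ‖bd Ω x ^ a • v‖ₑ = dw Ω a x * ‖v‖ₑ := by
  rw [enorm_smul, Real.enorm_eq_ofReal (by positivity), dw_eq_ofReal h]

lemma continuous_bd_rpow_smul {F : Type*} [NormedAddCommGroup F] [NormedSpace ℝ F]
    (hΩ : IsOpen Ω) (hne : (frontier Ω).Nonempty) (a : ℝ) {f : Euc n → F} (hf : Continuous f)
    (hs : tsupport f ⊆ Ω) : Continuous fun x => bd Ω x ^ a • f x := by
  refine continuous_of_tsupport fun x hx => ?_
  have hxΩ := hs (tsupport_smul_subset_right _ _ hx)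
  exact ((continuous_bd Ω).continuousAt.rpow_const (Or.inl (bd_pos hΩ hne hxΩ).ne')).smul
    hf.continuousAt

lemma memLp_bd_rpow_smul {F : Type*} [NormedAddCommGroup F] [NormedSpace ℝ F]
    (hΩ : IsOpen Ω) (hne : (frontier Ω).Nonempty) (a : ℝ) {f : Euc n → F} (hf : Continuous f)
    (hc : HasCompactSupport f) (hs : tsupport f ⊆ Ω) (q : ℝ≥0∞) (ν : Measure (Euc n))
    [IsFiniteMeasureOnCompacts ν] : MemLp (fun x => bd Ω x ^ a • f x) q ν :=
  (continuous_bd_rpow_smul hΩ hne a hf hs).memLp_of_hasCompactSupport hc.smul_left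

lemma IsTestOn.contDiff_one {φ : Euc n → ℝ} (h : IsTestOn Ω φ) : ContDiff ℝ 1 φ :=
  h.1.of_le (by exact_mod_cast le_top)

lemma IsTestOn.continuous_gradient {φ : Euc n → ℝ} (h : IsTestOn Ω φ) :
    Continuous (gradient φ) :=
  (InnerProductSpace.toDual ℝ (Euc n)).symm.continuous.comp
    (h.contDiff_one.continuous_fderiv one_ne_zero)

lemma tsupport_gradient_subset (φ : Euc n → ℝ) : tsupport (gradient φ) ⊆ tsupport φ := by
  refine (closure_mono fun x hx => ?_).trans (tsupport_fderiv_subset ℝ)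
  rw [Function.mem_support] at hx ⊢
  contrapose! hx
  rw [gradient, hx, map_zero]

lemma IsTestOn.hasCompactSupport_gradient {φ : Euc n → ℝ} (h : IsTestOn Ω φ) :
    HasCompactSupport (gradient φ) :=
  h.2.1.of_isClosed_subset (isClosed_tsupport _) (tsupport_gradient_subset φ)

lemma exists_hardy (hΩ : IsOpen Ω) (hdn : d < n)
    (hΓ : AhlforsRegular d A₀ (frontier Ω)) (hJ : WeakLocalJohn Ω d)
    (hunb : ¬ Bornology.IsBounded Ωᶜ) :
    ∃ C : ℝ≥0, ∀ φ : Euc n → ℝ, IsTestOn Ω φ →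
      eLpNorm (fun x => bd Ω x ^ ((d - n - 1) / 2) • φ x) 2 (volume.restrict Ω) ≤
        C * eLpNorm (fun x => bd Ω x ^ ((d + 1 - n) / 2) • gradient φ x) 2
          (volume.restrict Ω) := by
  obtain ⟨C, hC⟩ := exists_lintegral_dw_le_lintegral_fderiv hΩ hdn hΓ hJ hunb
  have hne := hΓ.1
  refine ⟨2 * C, fun φ hφ => ?_⟩
  set f : Euc n → ℝ := fun x => bd Ω x ^ ((d - n - 1) / 2) • φ x with hf
  set g : Euc n → Euc n := fun x => bd Ω x ^ ((d + 1 - n) / 2) • gradient φ x with hg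
  have hfm : MemLp f 2 (volume.restrict Ω) :=
    memLp_bd_rpow_smul hΩ hne _ hφ.1.continuous hφ.2.1 hφ.2.2 _ _
  have hgm : MemLp g 2 (volume.restrict Ω) :=
    memLp_bd_rpow_smul hΩ hne _ hφ.continuous_gradient hφ.hasCompactSupport_gradient
      ((tsupport_gradient_subset φ).trans hφ.2.2) _ _
  have key : ∫⁻ x in Ω, ‖f x‖ₑ ^ (2 : ℝ) ≤ 2 * C * ∫⁻ x in Ω, ‖f x‖ₑ * ‖g x‖ₑ := by
    have h := hC (fun x => φ x ^ 2) (hφ.contDiff_one.pow 2) fun x hx => by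
      have : φ x = 0 := image_eq_zero_of_notMem_tsupport fun hx' =>
        notMem_frontier_of_mem hΩ (hφ.2.2 hx') hx
      simp [this]
    have h1 : ∫⁻ x in Ω, ‖f x‖ₑ ^ (2 : ℝ) = ∫⁻ x in Ω, ‖φ x ^ 2‖ₑ * dw Ω (d - n - 1) x := by
      refine setLIntegral_congr_fun hΩ.measurableSet fun x hx => ?_
      have hb := bd_pos hΩ hne hx
      simp only [hf]
      rw [enorm_bd_rpow_smul hb, show d - n - 1 = (d - n - 1) / 2 + (d - n - 1) / 2 by ring,
        dw_add hb, enorm_pow, ENNReal.rpow_two]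
      ring_nf
    have h2 : ∫⁻ x in Ω, ‖fderiv ℝ (fun x => φ x ^ 2) x‖ₑ * dw Ω (d - n) x =
        2 * ∫⁻ x in Ω, ‖f x‖ₑ * ‖g x‖ₑ := by
      rw [← lintegral_const_mul' _ _ ENNReal.ofNat_ne_top]
      refine setLIntegral_congr_fun hΩ.measurableSet fun x hx => ?_
      have hb := bd_pos hΩ hne hx
      have hd : DifferentiableAt ℝ φ x := hφ.contDiff_one.differentiable one_ne_zero x
      simp only [hf, hg]
      rw [enorm_bd_rpow_smul hb, enorm_bd_rpow_smul hb, enorm_gradient,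
        show d - n = (d - n - 1) / 2 + (d + 1 - n) / 2 by ring, dw_add hb,
        (hd.hasFDerivAt.pow 2).fderiv, enorm_smul]
      have : ‖(2 : ℕ) • φ x ^ (2 - 1)‖ₑ = 2 * ‖φ x‖ₑ := by
        rw [nsmul_eq_mul, enorm_mul, pow_one, Real.enorm_eq_ofReal (by norm_num)]
        simp
      rw [this]
      ring_nf
    rw [h1]
    refine h.trans_eq ?_
    rw [h2]
    ring
  have hCS : ∫⁻ x in Ω, ‖f x‖ₑ * ‖g x‖ₑ ≤ (∫⁻ x in Ω, ‖f x‖ₑ ^ (2 : ℝ)) ^ (1 / 2 : ℝ) *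
      (∫⁻ x in Ω, ‖g x‖ₑ ^ (2 : ℝ)) ^ (1 / 2 : ℝ) :=
    ENNReal.lintegral_mul_le_Lp_mul_Lq (volume.restrict Ω) Real.HolderConjugate.two_two
    hfm.1.enorm hgm.1.enorm
  rw [eLpNorm_eq_lintegral_rpow_enorm_toReal two_ne_zero ENNReal.ofNat_ne_top,
    eLpNorm_eq_lintegral_rpow_enorm_toReal two_ne_zero ENNReal.ofNat_ne_top, ENNReal.toReal_ofNat]
  set X := (∫⁻ x in Ω, ‖f x‖ₑ ^ (2 : ℝ)) ^ (1 / 2 : ℝ) with hX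
  have hXt : X ≠ ⊤ := by
    have := hfm.2.ne
    rwa [eLpNorm_eq_lintegral_rpow_enorm_toReal two_ne_zero ENNReal.ofNat_ne_top,
      ENNReal.toReal_ofNat] at this
  have hXX : X * X = ∫⁻ x in Ω, ‖f x‖ₑ ^ (2 : ℝ) := by
    rw [hX, ← ENNReal.rpow_add_of_nonneg _ _ (by norm_num) (by norm_num)]
    norm_num
  rcases eq_or_ne X 0 with h0 | h0
  · rw [h0]; exact zero_le
  refine (ENNReal.mul_le_mul_iff_right h0 hXt).1 ?_
  rw [hXX]
  refine (key.trans (mul_le_mul_right hCS _)).trans_eq ?_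
  push_cast
  ring

end HardyLtwo

section Mollification

variable {V : Type*} [NormedAddCommGroup V]

lemma tendsto_eLpNorm_comp_sub_sub {F : Euc n → V} (hF : MemLp F 2 volume) :
    Tendsto (fun t => eLpNorm (fun x => F (x - t) - F x) 2 volume) (𝓝 0) (𝓝 0) := by
  set g : C(Euc n, C(Euc n, Euc n)) :=
    (⟨fun q => q.2 - q.1, by fun_prop⟩ : C(Euc n × Euc n, Euc n)).curry with hg
  have hgm : ∀ t, MeasurePreserving (g t) volume volume := fun t =>
    measurePreserving_sub_right volume t
  have h := (continuous_const (y := hF.toLp)).compMeasurePreservingLp g.continuous hgm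
    ENNReal.ofNat_ne_top
  have h0 : Lp.compMeasurePreserving (g 0) (hgm 0) hF.toLp = hF.toLp := by
    rw [Lp.toLp_compMeasurePreserving hF]
    congr 1
    ext x
    simp [hg]
  have h1 := (h.tendsto 0).edist (tendsto_const_nhds (x := hF.toLp))
  rw [h0, edist_self] at h1
  refine h1.congr fun t => ?_
  rw [Lp.toLp_compMeasurePreserving hF, Lp.edist_toLp_toLp]
  rfl

lemma sq_lintegral_mul_le {α : Type*} [MeasurableSpace α] {ν : Measure α} {w h : α → ℝ≥0∞}
    (hw : AEMeasurable w ν) (hh : AEMeasurable h ν) (h1 : ∫⁻ t, w t ∂ν = 1) :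
    (∫⁻ t, w t * h t ∂ν) ^ (2 : ℝ) ≤ ∫⁻ t, w t * h t ^ (2 : ℝ) ∂ν := by
  have h2 := ENNReal.lintegral_mul_le_Lp_mul_Lq ν Real.HolderConjugate.two_two
    (hw.pow_const (1 / 2 : ℝ)) ((hw.pow_const (1 / 2 : ℝ)).mul hh)
  have e1 : ∀ t, w t ^ (1 / 2 : ℝ) * w t ^ (1 / 2 : ℝ) = w t := fun t => by
    rw [← ENNReal.rpow_add_of_nonneg _ _ (by norm_num) (by norm_num)]
    norm_num
  have e2 : ∀ t, (w t ^ (1 / 2 : ℝ)) ^ (2 : ℝ) = w t := fun t => by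
    rw [← ENNReal.rpow_mul]
    norm_num
  simp only [Pi.mul_apply, ← mul_assoc, e1, e2, h1, ENNReal.one_rpow, one_mul,
    ENNReal.mul_rpow_of_nonneg _ _ (zero_le_two : (0 : ℝ) ≤ 2)] at h2
  calc _ ≤ ((∫⁻ t, w t * h t ^ (2 : ℝ) ∂ν) ^ (1 / 2 : ℝ)) ^ (2 : ℝ) := by gcongr
    _ = _ := by
      rw [← ENNReal.rpow_mul]
      norm_num

open scoped Convolution in
lemma lintegral_enorm_convolution_sub_le [NormedSpace ℝ V] [CompleteSpace V] {F : Euc n → V}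
    (hF : MemLp F 2 volume) (ρ : ContDiffBump (0 : Euc n)) {ε : ℝ≥0∞}
    (hε : ∀ t ∈ ball 0 ρ.rOut, ∫⁻ x, ‖F (x - t) - F x‖ₑ ^ (2 : ℝ) ≤ ε) :
    ∫⁻ x, ‖(ρ.normed volume ⋆[ContinuousLinearMap.lsmul ℝ ℝ, volume] F) x - F x‖ₑ ^ (2 : ℝ) ≤
      ε := by
  set w : Euc n → ℝ≥0∞ := fun t => ENNReal.ofReal (ρ.normed volume t) with hw
  have hwm : Measurable w := ρ.continuous_normed.measurable.ennreal_ofReal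
  have hw1 : ∫⁻ t, w t = 1 := by
    rw [hw, ← ofReal_integral_eq_lintegral_ofReal ρ.integrable_normed
      (ae_of_all _ ρ.nonneg_normed), ρ.integral_normed, ENNReal.ofReal_one]
  have hFloc : LocallyIntegrable F volume := hF.locallyIntegrable one_le_two
  have hmeas : AEStronglyMeasurable (fun q : Euc n × Euc n => F (q.1 - q.2) - F q.1)
      (volume.prod volume) :=
    (hF.1.comp_quasiMeasurePreserving
      (quasiMeasurePreserving_sub_of_right_invariant volume volume)).sub hF.1.comp_fst
  have hex := (ρ.hasCompactSupport_normed (μ := volume)).convolutionExists_left (μ := volume)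
    (ContinuousLinearMap.lsmul ℝ ℝ) ρ.continuous_normed hFloc
  have hpt : ∀ᵐ x, ‖(ρ.normed volume ⋆[ContinuousLinearMap.lsmul ℝ ℝ, volume] F) x - F x‖ₑ
      ^ (2 : ℝ) ≤ ∫⁻ t, w t * ‖F (x - t) - F x‖ₑ ^ (2 : ℝ) := by
    filter_upwards [hmeas.prodMk_left] with x hx
    refine le_trans ?_ (sq_lintegral_mul_le hwm.aemeasurable hx.enorm hw1)
    gcongr
    have h1 : (ρ.normed volume ⋆[ContinuousLinearMap.lsmul ℝ ℝ, volume] F) x - F x =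
        ∫ t, ρ.normed volume t • (F (x - t) - F x) := by
      have h2 : F x = ∫ t, ρ.normed volume t • F x := by
        rw [integral_smul_const, ρ.integral_normed, one_smul]
      conv_lhs => rw [h2]
      rw [convolution_def, ← integral_sub (hex x) (ρ.integrable_normed.smul_const _)]
      simp [smul_sub]
    rw [h1]
    refine (enorm_integral_le_lintegral_enorm _).trans (lintegral_mono fun t => ?_)
    rw [enorm_smul, Real.enorm_eq_ofReal (ρ.nonneg_normed t)]
  refine (lintegral_mono_ae hpt).trans ?_
  rw [lintegral_lintegral_swap
    (by exact (hwm.comp measurable_snd).aemeasurable.mul (hmeas.enorm.pow_const _))]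
  calc _ ≤ ∫⁻ t, w t * ε := by
        refine lintegral_mono fun t => ?_
        simp only
        by_cases ht : t ∈ ball 0 ρ.rOut
        · rw [lintegral_const_mul' _ _ ENNReal.ofReal_ne_top]
          gcongr
          exact hε t ht
        · have : w t = 0 := by
            have : t ∉ Function.support (ρ.normed volume) := by rwa [ρ.support_normed_eq]
            rw [hw]
            simp [Function.notMem_support.1 this]
          simp [this]
    _ = ε := by rw [lintegral_mul_const _ hwm, hw1, one_mul]

end Mollification

section Smoothing

variable {Ω : Set (Euc n)}

lemma inner_gradient_eq_fderiv (φ : Euc n → ℝ) (x v : Euc n) :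
    ⟪gradient φ x, v⟫ = fderiv ℝ φ x v := by
  rw [gradient, InnerProductSpace.toDual_symm_apply]

open scoped Convolution in
lemma gradient_convolution {F : Euc n → ℝ} {G : Euc n → Euc n}
    (hF : LocallyIntegrable F volume) (hG : LocallyIntegrable G volume)
    (hw : ∀ φ : Euc n → ℝ, ContDiff ℝ (⊤ : ℕ∞) φ → HasCompactSupport φ → ∀ v : Euc n,
      (∫ x, F x * fderiv ℝ φ x v) = -∫ x, ⟪G x, v⟫ * φ x)
    {ρ : Euc n → ℝ} (hρ : ContDiff ℝ (⊤ : ℕ∞) ρ) (hc : HasCompactSupport ρ) (x : Euc n) :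
    gradient (ρ ⋆[ContinuousLinearMap.lsmul ℝ ℝ, volume] F) x =
      (ρ ⋆[ContinuousLinearMap.lsmul ℝ ℝ, volume] G) x := by
  refine ext_inner_right ℝ fun v => ?_
  have hρ1 : ContDiff ℝ 1 ρ := hρ.of_le (by exact_mod_cast le_top)
  have hφ : ContDiff ℝ (⊤ : ℕ∞) fun y => ρ (x - y) := hρ.comp (contDiff_const.sub contDiff_id)
  have hφc : HasCompactSupport fun y => ρ (x - y) :=
    hc.comp_homeomorph (Homeomorph.subLeft x)
  have hφd : ∀ y, fderiv ℝ (fun y => ρ (x - y)) y v = -fderiv ℝ ρ (x - y) v := fun y => by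
    have h := ((hρ1.differentiable one_ne_zero (x - y)).hasFDerivAt).comp y
      ((hasFDerivAt_const x y).sub (hasFDerivAt_id y))
    have h' : fderiv ℝ (fun y => ρ (x - y)) y = _ := h.fderiv
    rw [h']
    simp
  have hcG : Integrable (fun y => ρ (x - y) • G y) volume :=
    hG.integrable_smul_left_of_hasCompactSupport hφ.continuous hφc
  have hex := (hc.fderiv ℝ).convolutionExists_left (μ := volume)
    ((ContinuousLinearMap.lsmul ℝ ℝ).precompL (Euc n)) (hρ1.continuous_fderiv one_ne_zero) hF x
  rw [inner_gradient_eq_fderiv,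
    (hc.hasFDerivAt_convolution_left (ContinuousLinearMap.lsmul ℝ ℝ) hρ1 hF x).fderiv,
    convolution_def, ContinuousLinearMap.integral_apply hex, convolution_def,
    ← integral_sub_left_eq_self _ volume x,
    ← integral_sub_left_eq_self (fun t => ContinuousLinearMap.lsmul ℝ ℝ (ρ t) (G (x - t))) volume x]
  simp only [sub_sub_cancel, ContinuousLinearMap.precompL_apply, ContinuousLinearMap.lsmul_apply,
    smul_eq_mul]
  have h := hw _ hφ hφc v
  simp only [hφd, mul_neg, integral_neg, neg_inj] at h
  rw [real_inner_comm, ← integral_inner hcG]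
  simp only [inner_smul_right]
  calc ∫ y, fderiv ℝ ρ (x - y) v * F y
      = ∫ y, F y * fderiv ℝ ρ (x - y) v := integral_congr_ae (ae_of_all _ fun y => mul_comm _ _)
    _ = ∫ y, ⟪G y, v⟫ * ρ (x - y) := h
    _ = ∫ y, ρ (x - y) * ⟪v, G y⟫ := integral_congr_ae (ae_of_all _ fun y => by
        simp only [real_inner_comm v]; ring)

open scoped Convolution in
lemma exists_isTestOn_gradient_close (hΩ : IsOpen Ω) {F : Euc n → ℝ} {G : Euc n → Euc n}
    (hF : MemLp F 2 volume) (hG : MemLp G 2 volume)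
    (hw : ∀ φ : Euc n → ℝ, ContDiff ℝ (⊤ : ℕ∞) φ → HasCompactSupport φ → ∀ v : Euc n,
      (∫ x, F x * fderiv ℝ φ x v) = -∫ x, ⟪G x, v⟫ * φ x)
    {K : Set (Euc n)} (hK : IsCompact K) (hKΩ : K ⊆ Ω) (hFK : ∀ x ∉ K, F x = 0) :
    ∃ K' : Set (Euc n), IsCompact K' ∧ K ⊆ K' ∧ K' ⊆ Ω ∧ ∀ ε : ℝ≥0∞, 0 < ε →
      ∃ ψ : Euc n → ℝ, IsTestOn Ω ψ ∧ tsupport ψ ⊆ K' ∧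
        ∫⁻ x, ‖gradient ψ x - G x‖ₑ ^ (2 : ℝ) ≤ ε := by
  obtain ⟨r, hr, hrΩ⟩ := hK.exists_cthickening_subset_open hΩ hKΩ
  refine ⟨cthickening r K, hK.cthickening, self_subset_cthickening K, hrΩ, fun ε hε => ?_⟩
  have hev := (tendsto_eLpNorm_comp_sub_sub hG).eventually_le_const
    (u := ε ^ (1 / 2 : ℝ)) (ENNReal.rpow_pos_of_nonneg hε (by norm_num))
  obtain ⟨η, hη, hηε⟩ := Metric.eventually_nhds_iff_ball.1 hev
  set R := min r η with hR
  have hR0 : 0 < R := lt_min hr hη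
  set ρ : ContDiffBump (0 : Euc n) := ⟨R / 2, R, by positivity, by linarith⟩ with hρ
  have hFl := hF.locallyIntegrable one_le_two
  have hGl := hG.locallyIntegrable one_le_two
  have hρc : HasCompactSupport (ρ.normed volume) := ρ.hasCompactSupport_normed
  have hρs : ContDiff ℝ (⊤ : ℕ∞) (ρ.normed volume) := ρ.contDiff_normed
  set ψ : Euc n → ℝ := ρ.normed volume ⋆[ContinuousLinearMap.lsmul ℝ ℝ, volume] F with hψ
  have hsupp : tsupport ψ ⊆ cthickening r K := by
    refine closure_minimal ((support_convolution_subset _).trans ?_) isClosed_cthickening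
    rintro _ ⟨a, ha, b, hb, rfl⟩
    have hbK : b ∈ K := by
      by_contra h
      exact hb (hFK b h)
    rw [ρ.support_normed_eq] at ha
    refine mem_cthickening_of_dist_le _ b _ _ hbK ?_
    simp only [dist_eq_norm, add_sub_cancel_right]
    exact (mem_ball_zero_iff.1 ha).le.trans (min_le_left _ _)
  refine ⟨ψ, ⟨hρc.contDiff_convolution_left _ hρs hFl,
    hK.cthickening.of_isClosed_subset (isClosed_tsupport _) hsupp, hsupp.trans hrΩ⟩, hsupp, ?_⟩
  have h := lintegral_enorm_convolution_sub_le hG ρ (ε := ε) fun t ht => by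
    have h1 := hηε t (ball_subset_ball (min_le_right _ _) ht)
    rw [eLpNorm_eq_lintegral_rpow_enorm_toReal two_ne_zero ENNReal.ofNat_ne_top,
      ENNReal.toReal_ofNat] at h1
    exact (ENNReal.rpow_le_rpow_iff (by norm_num)).1 h1
  refine (lintegral_congr fun x => ?_).trans_le h
  rw [hψ, gradient_convolution hFl hGl hw hρs hρc]

end Smoothing

section Cutoff

variable {Ω : Set (Euc n)}

lemma infDist_compl_eq_bd (hΩ : IsOpen Ω) (hne : (frontier Ω).Nonempty) {x : Euc n}
    (hx : x ∈ Ω) : infDist x Ωᶜ = bd Ω x := by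
  have hsub : frontier Ω ⊆ Ωᶜ := fun y hy hyΩ => notMem_frontier_of_mem hΩ hyΩ hy
  refine le_antisymm (infDist_le_infDist_of_subset hsub hne) ?_
  refine (le_infDist (hne.mono hsub)).2 fun y hy => ?_
  by_contra! h
  exact hy (ball_bd_subset hΩ hx (by rwa [mem_ball, dist_comm]))

open scoped Convolution in
lemma exists_smooth_cutoff_infDist {S : Set (Euc n)} {k : ℝ} (hk : 0 < k) :
    ∃ η : Euc n → ℝ, ContDiff ℝ (⊤ : ℕ∞) η ∧ (∀ x, |η x| ≤ 1) ∧
      (∀ x, ‖fderiv ℝ η x‖ ≤ k) ∧ (∀ x, infDist x S < 1 / (2 * k) → η x = 0) ∧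
      ∀ x, 5 / (2 * k) < infDist x S → η =ᶠ[𝓝 x] fun _ => 1 := by
  set f : Euc n → ℝ := fun x => min 1 (max 0 (k * infDist x S - 1)) with hf
  have hfl : ∀ x y, |f x - f y| ≤ k * dist x y := fun x y => by
    calc |f x - f y| ≤ |max 0 (k * infDist x S - 1) - max 0 (k * infDist y S - 1)| := by
          simpa using abs_min_sub_min_le_max 1 (max 0 (k * infDist x S - 1)) 1
            (max 0 (k * infDist y S - 1))
      _ ≤ |(k * infDist x S - 1) - (k * infDist y S - 1)| := by
          simpa using abs_max_sub_max_le_max 0 (k * infDist x S - 1) 0 (k * infDist y S - 1)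
      _ = k * dist (infDist x S) (infDist y S) := by
          rw [sub_sub_sub_cancel_right, ← mul_sub, abs_mul, abs_of_pos hk, Real.dist_eq]
      _ ≤ k * dist x y := by
          gcongr
          simpa using (lipschitz_infDist_pt S).dist_le_mul x y
  have hfc : Continuous f := by
    have := continuous_infDist_pt S
    fun_prop
  have hf0 : ∀ x, 0 ≤ f x := fun x => le_min zero_le_one (le_max_left _ _)
  have hf1 : ∀ x, f x ≤ 1 := fun x => min_le_left _ _
  set ρ : ContDiffBump (0 : Euc n) :=
    ⟨1 / (4 * k), 1 / (2 * k), by positivity, by gcongr; norm_num⟩ with hρ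
  have hρ0 : ∀ t, 0 ≤ ρ.normed volume t := fun t => ρ.nonneg_normed t
  have hint : ∀ x, Integrable (fun t => ρ.normed volume t * f (x - t)) volume := fun x =>
    (ρ.continuous_normed.mul (hfc.comp (by fun_prop))).integrable_of_hasCompactSupport
      ρ.hasCompactSupport_normed.mul_right
  set η : Euc n → ℝ := ρ.normed volume ⋆[ContinuousLinearMap.lsmul ℝ ℝ, volume] f with hη
  have hηx : ∀ x, η x = ∫ t, ρ.normed volume t * f (x - t) := fun x => by
    simp [hη, convolution_def]
  have hfar : ∀ x, 5 / (2 * k) < infDist x S → η x = 1 := fun x hx => by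
    have hone : ∀ y ∈ ball x (1 / (2 * k)), f y = 1 := fun y hy => by
      have h1 : infDist x S ≤ infDist y S + dist x y := infDist_le_infDist_add_dist
      rw [mem_ball, dist_comm] at hy
      have h2 : 2 / k ≤ infDist y S := by
        have : (5 : ℝ) / (2 * k) - 1 / (2 * k) = 2 / k := by field_simp; norm_num
        linarith
      rw [div_le_iff₀ hk] at h2
      exact min_eq_left (le_max_of_le_right (by linarith))
    have hx1 := hone x (mem_ball_self (by positivity))
    rw [hη, ρ.normed_convolution_eq_right fun y hy => by rw [hone y hy, hx1], hx1]
  refine ⟨η, ρ.hasCompactSupport_normed.contDiff_convolution_left _ ρ.contDiff_normed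
    hfc.locallyIntegrable, fun x => ?_, fun x => ?_, fun x hx => ?_, fun x hx => ?_⟩
  · rw [hηx, abs_of_nonneg (integral_nonneg fun t => mul_nonneg (hρ0 t) (hf0 _)),
      ← ρ.integral_normed (μ := volume)]
    exact integral_mono (hint x) (ρ.integrable_normed (μ := volume)) fun t =>
      mul_le_of_le_one_right (hρ0 t) (hf1 _)
  · have hl : LipschitzWith k.toNNReal η := by
      refine LipschitzWith.of_dist_le_mul fun x y => ?_
      rw [Real.dist_eq, hηx, hηx, ← integral_sub (hint x) (hint y), Real.coe_toNNReal _ hk.le]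
      calc |∫ t, (ρ.normed volume t * f (x - t) - ρ.normed volume t * f (y - t))|
          ≤ ∫ t, ρ.normed volume t * (k * dist x y) := by
            rw [← Real.norm_eq_abs]
            refine norm_integral_le_of_norm_le ((ρ.integrable_normed (μ := volume)).mul_const _)
              (ae_of_all _ fun t => ?_)
            rw [← mul_sub, norm_mul, Real.norm_of_nonneg (hρ0 t)]
            refine mul_le_mul_of_nonneg_left ?_ (hρ0 t)
            simpa using hfl (x - t) (y - t)
        _ = k * dist x y := by rw [integral_mul_const, ρ.integral_normed, one_mul]
    simpa [hk.le] using norm_fderiv_le_of_lipschitz ℝ hl (x₀ := x)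
  · have hzero : ∀ y ∈ ball x (1 / (2 * k)), f y = 0 := fun y hy => by
      have h1 : infDist y S ≤ infDist x S + dist y x := infDist_le_infDist_add_dist
      rw [mem_ball] at hy
      have h2 : infDist y S ≤ 1 / k := by
        have : (1 : ℝ) / (2 * k) + 1 / (2 * k) = 1 / k := by field_simp; norm_num
        linarith
      rw [le_div_iff₀ hk] at h2
      rw [hf]
      simp only
      rw [max_eq_left (by linarith), min_eq_right zero_le_one]
    have hx1 := hzero x (mem_ball_self (by positivity))
    rw [hη, ρ.normed_convolution_eq_right fun y hy => by rw [hzero y hy, hx1], hx1]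
  · filter_upwards [(continuous_infDist_pt S).tendsto x |>.eventually_const_lt hx] with y hy
    exact hfar y hy

lemma exists_smooth_cutoff_ball (n : ℕ) : ∃ C : ℝ, 0 ≤ C ∧ ∀ k : ℝ, 0 < k → ∃ ζ : Euc n → ℝ,
    ContDiff ℝ (⊤ : ℕ∞) ζ ∧ (∀ x, |ζ x| ≤ 1) ∧ (∀ x, ‖fderiv ℝ ζ x‖ ≤ C / k) ∧
      (∀ x, 2 * k < ‖x‖ → ζ =ᶠ[𝓝 x] fun _ => 0) ∧ ∀ x, ‖x‖ < k → ζ =ᶠ[𝓝 x] fun _ => 1 := by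
  set b : ContDiffBump (0 : Euc n) := ⟨1, 2, one_pos, one_lt_two⟩ with hb
  have hbs : ContDiff ℝ (⊤ : ℕ∞) b := b.contDiff
  have hb1 : ContDiff ℝ 1 b := b.contDiff
  obtain ⟨C, hC⟩ := (hb1.continuous_fderiv one_ne_zero).bounded_above_of_compact_support
    (b.hasCompactSupport.fderiv ℝ)
  refine ⟨C, (norm_nonneg _).trans (hC 0), fun k hk => ⟨fun x => b (k⁻¹ • x),
    hbs.comp (contDiff_const_smul _), fun x => ?_, fun x => ?_, fun x hx => ?_,
    fun x hx => ?_⟩⟩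
  · rw [abs_of_nonneg b.nonneg]
    exact b.le_one
  · have h : fderiv ℝ (fun x => b (k⁻¹ • x)) x = k⁻¹ • fderiv ℝ b (k⁻¹ • x) :=
      fderiv_comp_smul k⁻¹
    rw [h, norm_smul, Real.norm_of_nonneg (inv_nonneg.2 hk.le), div_eq_inv_mul]
    gcongr
    exact hC _
  · filter_upwards [continuous_norm.tendsto x |>.eventually_const_lt hx] with y hy
    refine b.zero_of_le_dist ?_
    rw [dist_zero_right, norm_smul, norm_inv, Real.norm_of_nonneg hk.le, ← div_eq_inv_mul,
      le_div_iff₀ hk]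
    exact hy.le
  · filter_upwards [continuous_norm.tendsto x |>.eventually_lt_const hx] with y hy
    refine b.one_of_mem_closedBall ?_
    rw [mem_closedBall, dist_zero_right, norm_smul, norm_inv, Real.norm_of_nonneg hk.le,
      ← div_eq_inv_mul, div_le_iff₀ hk]
    simpa [hb] using hy.le

/-- Smooth compactly supported cutoffs exhausting `Ω` whose gradients are `O(1/δ)`. -/
lemma exists_cutoff (hΩ : IsOpen Ω) (hne : (frontier Ω).Nonempty) :
    ∃ C : ℝ, 0 ≤ C ∧ ∃ χ : ℕ → Euc n → ℝ, (∀ k, IsTestOn Ω (χ k)) ∧ (∀ k x, |χ k x| ≤ 1) ∧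
      (∀ k, ∀ x ∈ Ω, ‖fderiv ℝ (χ k) x‖ ≤ C / bd Ω x) ∧
      ∀ x ∈ Ω, ∀ᶠ k in atTop, χ k =ᶠ[𝓝 x] fun _ => 1 := by
  obtain ⟨ξ, hξ⟩ := hne
  have hne : (frontier Ω).Nonempty := ⟨ξ, hξ⟩
  have hsub : frontier Ω ⊆ Ωᶜ := fun y hy hyΩ => notMem_frontier_of_mem hΩ hyΩ hy
  obtain ⟨C, hC0, hC⟩ := exists_smooth_cutoff_ball n
  set κ : ℕ → ℝ := fun k => k + 1 + ‖ξ‖ with hκ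
  have hκ0 : ∀ k, 0 < κ k := fun k => by positivity
  have hκt : Tendsto κ atTop atTop :=
    tendsto_atTop_add_const_right _ _ (tendsto_atTop_add_const_right _ _
      tendsto_natCast_atTop_atTop)
  choose ζ hζs hζ1 hζd hζ0 hζe using fun k => hC (κ k) (hκ0 k)
  choose η hηs hη1 hηd hη0 hηe using fun k => exists_smooth_cutoff_infDist (S := Ωᶜ) (hκ0 k)
  have hcl : ∀ k, tsupport (fun x => η k x * ζ k x) ⊆
      {x | 1 / (2 * κ k) ≤ infDist x Ωᶜ} ∩ closedBall 0 (2 * κ k) := fun k => by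
    refine closure_minimal (fun x hx => ⟨?_, ?_⟩)
      ((isClosed_le continuous_const (continuous_infDist_pt _)).inter isClosed_closedBall)
    · by_contra h
      exact hx (by simp [hη0 k x (not_le.1 h)])
    · by_contra h
      rw [mem_closedBall, dist_zero_right, not_le] at h
      exact hx (by simp [(hζ0 k x h).eq_of_nhds])
  refine ⟨3 + 3 * C, by positivity, fun k x => η k x * ζ k x,
    fun k => ⟨(hηs k).mul (hζs k), ?_, ?_⟩, fun k x => ?_, fun k x hx => ?_, fun x hx => ?_⟩
  · exact (isCompact_closedBall _ _).of_isClosed_subset (isClosed_tsupport _)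
      ((hcl k).trans inter_subset_right)
  · intro x hx
    have h := (hcl k hx).1
    by_contra hxΩ
    have h0 : infDist x Ωᶜ = 0 := infDist_zero_of_mem hxΩ
    rw [Set.mem_ofPred_eq, h0] at h
    have := hκ0 k
    exact absurd h (not_le.2 (by positivity))
  · rw [abs_mul]
    exact mul_le_one₀ (hη1 k x) (abs_nonneg _) (hζ1 k x)
  · have hδ := bd_pos hΩ hne hx
    have hη' : ‖fderiv ℝ (η k) x‖ ≤ 3 / bd Ω x := by
      by_cases h : 5 / (2 * κ k) < infDist x Ωᶜ
      · rw [(hηe k x h).fderiv_eq]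
        simpa using by positivity
      · rw [infDist_compl_eq_bd hΩ hne hx, not_lt, le_div_iff₀ (by have := hκ0 k; positivity)] at h
        refine (hηd k x).trans ?_
        rw [le_div_iff₀ hδ]
        nlinarith
    have hζ' : ‖fderiv ℝ (ζ k) x‖ ≤ 3 * C / bd Ω x := by
      by_cases h : 2 * κ k < ‖x‖
      · rw [(hζ0 k x h).fderiv_eq]
        simpa using by positivity
      · refine (hζd k x).trans ?_
        rw [div_le_div_iff₀ (hκ0 k) hδ]
        have h1 : bd Ω x ≤ dist x ξ := bd_le_dist hξ
        have h2 : dist x ξ ≤ ‖x‖ + ‖ξ‖ := dist_le_norm_add_norm x ξ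
        have h3 : ‖ξ‖ ≤ κ k := by simp only [hκ]; have := k.cast_nonneg (α := ℝ); linarith
        nlinarith
    have hd : ∀ f : Euc n → ℝ, ContDiff ℝ (⊤ : ℕ∞) f → DifferentiableAt ℝ f x := fun f hf =>
      hf.differentiable (by simp) x
    rw [fderiv_fun_mul (hd _ (hηs k)) (hd _ (hζs k))]
    calc ‖η k x • fderiv ℝ (ζ k) x + ζ k x • fderiv ℝ (η k) x‖
        ≤ |η k x| * ‖fderiv ℝ (ζ k) x‖ + |ζ k x| * ‖fderiv ℝ (η k) x‖ := by
          refine (norm_add_le _ _).trans ?_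
          rw [norm_smul, norm_smul, Real.norm_eq_abs, Real.norm_eq_abs]
      _ ≤ 1 * (3 * C / bd Ω x) + 1 * (3 / bd Ω x) := by
          gcongr
          exacts [hη1 k x, hζ1 k x]
      _ = (3 + 3 * C) / bd Ω x := by ring
  · have hδ := bd_pos hΩ hne hx
    filter_upwards [hκt.eventually_gt_atTop ‖x‖, hκt.eventually_gt_atTop (5 / (2 * bd Ω x))]
      with k h1 h2
    have h3 : 5 / (2 * κ k) < infDist x Ωᶜ := by
      rw [infDist_compl_eq_bd hΩ hne hx, div_lt_iff₀ (by have := hκ0 k; positivity)]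
      rw [div_lt_iff₀ (by positivity)] at h2
      linarith
    filter_upwards [hζe k x h1, hηe k x h3] with y hy1 hy2
    rw [hy1, hy2, mul_one]

end Cutoff

section Density

variable {Ω : Set (Euc n)} {d : ℝ}

lemma LocallyIntegrableOn.integrableOn_smul_of_isCompact {F : Type*} [NormedAddCommGroup F]
    [NormedSpace ℝ F] {f : Euc n → F} (hf : LocallyIntegrableOn f Ω volume) {c : Euc n → ℝ}
    (hc : Continuous c) (hcs : HasCompactSupport c) (hcΩ : tsupport c ⊆ Ω) :
    IntegrableOn (fun x => c x • f x) Ω volume := by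
  have hK : IntegrableOn (fun x => c x • f x) (tsupport c) volume :=
    (hf.integrableOn_compact_subset hcΩ hcs).continuousOn_smul hc.continuousOn hcs
  refine (hK.integrable_of_forall_notMem_eq_zero fun x hx => ?_).integrableOn
  rw [image_eq_zero_of_notMem_tsupport hx, zero_smul]

lemma exists_dw_le_of_isCompact (hΩ : IsOpen Ω) (hne : (frontier Ω).Nonempty) (a : ℝ)
    {K : Set (Euc n)} (hK : IsCompact K) (hKΩ : K ⊆ Ω) : ∃ C : ℝ≥0, ∀ x ∈ K, dw Ω a x ≤ C := by
  have hcont : ContinuousOn (fun x => bd Ω x ^ a) K := fun x hx =>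
    ((continuous_bd Ω).continuousAt.rpow_const
      (Or.inl (bd_pos hΩ hne (hKΩ hx)).ne')).continuousWithinAt
  obtain ⟨C, hC⟩ := hK.bddAbove_image hcont
  refine ⟨C.toNNReal, fun x hx => ?_⟩
  rw [dw_eq_ofReal (bd_pos hΩ hne (hKΩ hx))]
  exact ENNReal.ofReal_le_ofReal (hC ⟨x, hx, rfl⟩)

lemma memLp_two_restrict_of_lintegral_dw (hΩ : IsOpen Ω) (hne : (frontier Ω).Nonempty) {a : ℝ}
    {F : Type*} [NormedAddCommGroup F] {f : Euc n → F}
    (hf : AEStronglyMeasurable f (volume.restrict Ω))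
    (hfa : ∫⁻ x in Ω, ‖f x‖ₑ ^ (2 : ℝ) * dw Ω a x < ⊤)
    {K : Set (Euc n)} (hK : IsCompact K) (hKΩ : K ⊆ Ω) : MemLp f 2 (volume.restrict K) := by
  obtain ⟨C, hC⟩ := exists_dw_le_of_isCompact hΩ hne (-a) hK hKΩ
  refine ⟨hf.mono_set hKΩ, ?_⟩
  rw [eLpNorm_lt_top_iff_lintegral_rpow_enorm_lt_top two_ne_zero ENNReal.ofNat_ne_top,
    ENNReal.toReal_ofNat]
  calc ∫⁻ x in K, ‖f x‖ₑ ^ (2 : ℝ)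
      ≤ ∫⁻ x in K, C * (‖f x‖ₑ ^ (2 : ℝ) * dw Ω a x) := by
        refine setLIntegral_mono' hK.measurableSet fun x hx => ?_
        have h1 : dw Ω a x * dw Ω (-a) x = 1 := by
          rw [← dw_add (bd_pos hΩ hne (hKΩ hx)), add_neg_cancel]
          simp [dw]
        calc ‖f x‖ₑ ^ (2 : ℝ) = dw Ω (-a) x * (‖f x‖ₑ ^ (2 : ℝ) * dw Ω a x) := by
              rw [mul_comm, mul_assoc, h1, mul_one]
          _ ≤ _ := by gcongr; exact hC x hx
    _ = C * ∫⁻ x in K, ‖f x‖ₑ ^ (2 : ℝ) * dw Ω a x := lintegral_const_mul' _ _ ENNReal.coe_ne_top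
    _ ≤ C * ∫⁻ x in Ω, ‖f x‖ₑ ^ (2 : ℝ) * dw Ω a x := by
        gcongr
    _ < ⊤ := ENNReal.mul_lt_top ENNReal.coe_lt_top hfa

lemma HasWeakGradOn.aestronglyMeasurable_left {u : Euc n → ℝ} {g : Euc n → Euc n}
    (h : HasWeakGradOn u g Ω) : AEStronglyMeasurable u (volume.restrict Ω) :=
  h.1.aestronglyMeasurable

lemma HasWeakGradOn.aestronglyMeasurable_right {u : Euc n → ℝ} {g : Euc n → Euc n}
    (h : HasWeakGradOn u g Ω) : AEStronglyMeasurable g (volume.restrict Ω) :=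
  h.2.1.aestronglyMeasurable

/-- Leibniz rule for a weak gradient multiplied by a test function. -/
lemma HasWeakGradOn.integral_cutoff_mul_fderiv {u : Euc n → ℝ} {g : Euc n → Euc n}
    (h : HasWeakGradOn u g Ω) {χ : Euc n → ℝ} (hχ : IsTestOn Ω χ) {φ : Euc n → ℝ}
    (hφ : ContDiff ℝ (⊤ : ℕ∞) φ) (v : Euc n) :
    (∫ x, χ x * u x * fderiv ℝ φ x v) =
      -∫ x, ⟪χ x • g x + u x • gradient χ x, v⟫ * φ x := by
  have hφ1 : ContDiff ℝ 1 φ := hφ.of_le (by exact_mod_cast le_top)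
  have hχ1 := hχ.contDiff_one
  have htest : IsTestOn Ω fun x => χ x * φ x :=
    ⟨hχ.1.mul hφ, hχ.2.1.mul_right, (tsupport_mul_subset_left).trans hχ.2.2⟩
  have hout : ∀ x ∉ Ω, χ x = 0 := fun x hx =>
    image_eq_zero_of_notMem_tsupport fun hx' => hx (hχ.2.2 hx')
  have hout' : ∀ x ∉ Ω, gradient χ x = 0 := fun x hx =>
    image_eq_zero_of_notMem_tsupport fun hx' => hx (hχ.2.2 (tsupport_gradient_subset χ hx'))
  have hd : ∀ x, fderiv ℝ (fun x => χ x * φ x) x v =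
      χ x * fderiv ℝ φ x v + φ x * fderiv ℝ χ x v := fun x => by
    rw [fderiv_fun_mul (hχ1.differentiable one_ne_zero x) (hφ1.differentiable one_ne_zero x)]
    simp
  have hφv : Continuous fun x => fderiv ℝ φ x v :=
    (hφ1.continuous_fderiv one_ne_zero).clm_apply continuous_const
  have hχv : Continuous fun x => fderiv ℝ χ x v :=
    (hχ1.continuous_fderiv one_ne_zero).clm_apply continuous_const
  have hχvs : tsupport (fun x => fderiv ℝ χ x v) ⊆ tsupport χ :=
    tsupport_fderiv_apply_subset ℝ v
  have i1 : IntegrableOn (fun x => (χ x * fderiv ℝ φ x v) • u x) Ω :=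
    LocallyIntegrableOn.integrableOn_smul_of_isCompact h.1 (hχ.1.continuous.mul hφv)
      hχ.2.1.mul_right (tsupport_mul_subset_left.trans hχ.2.2)
  have i2 : IntegrableOn (fun x => (fderiv ℝ χ x v * φ x) • u x) Ω :=
    LocallyIntegrableOn.integrableOn_smul_of_isCompact h.1 (hχv.mul hφ.continuous)
      (HasCompactSupport.mul_right (hχ.2.1.of_isClosed_subset (isClosed_tsupport _) hχvs))
      (tsupport_mul_subset_left.trans (hχvs.trans hχ.2.2))
  have i3 : IntegrableOn (fun x => ⟪v, (χ x * φ x) • g x⟫) Ω :=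
    (LocallyIntegrableOn.integrableOn_smul_of_isCompact h.2.1 htest.1.continuous htest.2.1
      htest.2.2).const_inner v
  have key := h.2.2 _ htest v
  simp only [hd] at key
  rw [← setIntegral_eq_integral_of_forall_compl_eq_zero (s := Ω)
      (f := fun x => χ x * u x * fderiv ℝ φ x v) fun x hx => by simp [hout x hx],
    ← setIntegral_eq_integral_of_forall_compl_eq_zero (s := Ω)
      (f := fun x => ⟪χ x • g x + u x • gradient χ x, v⟫ * φ x) fun x hx => by
        simp [hout x hx, hout' x hx]]
  calc ∫ x in Ω, χ x * u x * fderiv ℝ φ x v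
      = (∫ x in Ω, u x * (χ x * fderiv ℝ φ x v + φ x * fderiv ℝ χ x v)) -
          ∫ x in Ω, (fderiv ℝ χ x v * φ x) • u x := by
        rw [← integral_sub]
        · refine integral_congr_ae (ae_of_all _ fun x => ?_)
          simp only [smul_eq_mul]
          ring
        · refine (i1.add i2).congr (ae_of_all _ fun x => ?_)
          simp only [Pi.add_apply, smul_eq_mul]
          ring
        · exact i2
    _ = -((∫ x in Ω, ⟪v, (χ x * φ x) • g x⟫) + ∫ x in Ω, (fderiv ℝ χ x v * φ x) • u x) := by
        rw [key, neg_add, ← sub_eq_add_neg]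
        congr 2
        refine integral_congr_ae (ae_of_all _ fun x => ?_)
        simp only [inner_smul_right, real_inner_comm v]
        ring
    _ = _ := by
        rw [← integral_add i3 i2]
        congr 1
        refine integral_congr_ae (ae_of_all _ fun x => ?_)
        have hgr : ⟪v, gradient χ x⟫ = fderiv ℝ χ x v := by
          rw [real_inner_comm, inner_gradient_eq_fderiv]
        simp only [real_inner_comm v, inner_smul_right, inner_add_right, hgr, smul_eq_mul]
        ring

lemma add_rpow_two_le (a b : ℝ≥0∞) :
    (a + b) ^ (2 : ℝ) ≤ 2 * (a ^ (2 : ℝ) + b ^ (2 : ℝ)) := by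
  have h := ENNReal.rpow_add_le_mul_rpow_add_rpow a b (p := 2) one_le_two
  norm_num at h ⊢
  exact h

lemma tendsto_lintegral_cutoff_sub (hΩ : IsOpen Ω) (hne : (frontier Ω).Nonempty)
    {u : Euc n → ℝ} {g : Euc n → Euc n}
    (hum : AEStronglyMeasurable u (volume.restrict Ω))
    (hgm : AEStronglyMeasurable g (volume.restrict Ω))
    (hu : ∫⁻ x in Ω, ‖u x‖ₑ ^ (2 : ℝ) * dw Ω (d - n - 1) x < ⊤)
    (hg : ∫⁻ x in Ω, ‖g x‖ₑ ^ (2 : ℝ) * dw Ω (d + 1 - n) x < ⊤)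
    {C : ℝ} {χ : ℕ → Euc n → ℝ} (hχ : ∀ k, IsTestOn Ω (χ k)) (hχ1 : ∀ k x, |χ k x| ≤ 1)
    (hχd : ∀ k, ∀ x ∈ Ω, ‖fderiv ℝ (χ k) x‖ ≤ C / bd Ω x)
    (hχe : ∀ x ∈ Ω, ∀ᶠ k in atTop, χ k =ᶠ[𝓝 x] fun _ => 1) :
    Tendsto (fun k => ∫⁻ x in Ω, ‖g x - (χ k x • g x + u x • gradient (χ k) x)‖ₑ ^ (2 : ℝ) *
      dw Ω (d + 1 - n) x) atTop (𝓝 0) := by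
  have hlim := tendsto_lintegral_of_dominated_convergence' (μ := volume.restrict Ω)
    (F := fun k x => ‖g x - (χ k x • g x + u x • gradient (χ k) x)‖ₑ ^ (2 : ℝ) *
      dw Ω (d + 1 - n) x) (f := fun _ => 0)
    (fun x => 2 * ((2 : ℝ≥0∞) ^ (2 : ℝ) * (‖g x‖ₑ ^ (2 : ℝ) * dw Ω (d + 1 - n) x) +
      ENNReal.ofReal C ^ (2 : ℝ) * (‖u x‖ₑ ^ (2 : ℝ) * dw Ω (d - n - 1) x)))
    (fun k => ?_) (fun k => ?_) ?_ ?_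
  · simpa using hlim
  · refine AEMeasurable.mul (AEMeasurable.pow_const ?_ _) (measurable_dw Ω _).aemeasurable
    exact (hgm.sub (((hχ k).1.continuous.aestronglyMeasurable.smul hgm).add
      (hum.smul (hχ k).continuous_gradient.aestronglyMeasurable))).enorm
  · refine (ae_restrict_iff' hΩ.measurableSet).2 (ae_of_all _ fun x hx => ?_)
    have hδ := bd_pos hΩ hne hx
    have h1 : ‖g x - (χ k x • g x + u x • gradient (χ k) x)‖ₑ ≤
        2 * ‖g x‖ₑ + ENNReal.ofReal C * (‖u x‖ₑ * dw Ω (-1) x) := by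
      have e : g x - (χ k x • g x + u x • gradient (χ k) x) =
          (1 - χ k x) • g x - u x • gradient (χ k) x := by rw [sub_smul, one_smul, sub_sub]
      rw [e]
      refine (enorm_sub_le).trans (add_le_add ?_ ?_)
      · rw [enorm_smul]
        gcongr
        rw [Real.enorm_eq_ofReal_abs, ← ENNReal.ofReal_ofNat 2]
        refine ENNReal.ofReal_le_ofReal ?_
        have := abs_le.1 (hχ1 k x)
        rw [abs_le]
        constructor <;> linarith
      · rw [enorm_smul, mul_left_comm]
        gcongr
        rw [enorm_gradient, ← ofReal_norm, dw_eq_ofReal hδ,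
          ← ENNReal.ofReal_mul' (by positivity), Real.rpow_neg_one, ← div_eq_mul_inv]
        exact ENNReal.ofReal_le_ofReal (hχd k x hx)
    calc ‖g x - (χ k x • g x + u x • gradient (χ k) x)‖ₑ ^ (2 : ℝ) * dw Ω (d + 1 - n) x
        ≤ 2 * ((2 * ‖g x‖ₑ) ^ (2 : ℝ) +
            (ENNReal.ofReal C * (‖u x‖ₑ * dw Ω (-1) x)) ^ (2 : ℝ)) * dw Ω (d + 1 - n) x := by
          gcongr
          exact (ENNReal.rpow_le_rpow h1 zero_le_two).trans (add_rpow_two_le _ _)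
      _ = _ := by
          simp only
          rw [show d - n - 1 = (-1) * 2 + (d + 1 - n) by ring, dw_add hδ, ← dw_rpow]
          simp only [ENNReal.mul_rpow_of_nonneg _ _ zero_le_two]
          ring
  · rw [lintegral_const_mul' _ _ ENNReal.ofNat_ne_top, lintegral_add_left', lintegral_const_mul',
      lintegral_const_mul']
    · exact ENNReal.mul_ne_top ENNReal.ofNat_ne_top (ENNReal.add_ne_top.2
        ⟨ENNReal.mul_ne_top (by simp) hg.ne, ENNReal.mul_ne_top (by simp) hu.ne⟩)
    · simp
    · simp
    · exact ((hgm.enorm.pow_const _).mul (measurable_dw Ω _).aemeasurable).const_mul _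
  · refine (ae_restrict_iff' hΩ.measurableSet).2 (ae_of_all _ fun x hx => ?_)
    refine tendsto_const_nhds.congr' ?_
    filter_upwards [hχe x hx] with k hk
    have hgr : gradient (χ k) x = 0 := by
      rw [gradient, hk.fderiv_eq]
      simp
    rw [hgr, hk.eq_of_nhds]
    simp

/-- Gradients of test functions approximate the weak gradient of a function in the weighted
energy space that vanishes at the boundary in the Hardy sense. -/
lemma HasWeakGradOn.exists_isTestOn_lintegral_sub_le (hΩ : IsOpen Ω)
    (hne : (frontier Ω).Nonempty) {u : Euc n → ℝ} {g : Euc n → Euc n}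
    (h : HasWeakGradOn u g Ω)
    (hu : ∫⁻ x in Ω, ‖u x‖ₑ ^ (2 : ℝ) * dw Ω (d - n - 1) x < ⊤)
    (hg : ∫⁻ x in Ω, ‖g x‖ₑ ^ (2 : ℝ) * dw Ω (d + 1 - n) x < ⊤) {ε : ℝ≥0∞} (hε : 0 < ε) :
    ∃ φ : Euc n → ℝ, IsTestOn Ω φ ∧
      ∫⁻ x in Ω, ‖gradient φ x - g x‖ₑ ^ (2 : ℝ) * dw Ω (d + 1 - n) x ≤ ε := by
  obtain ⟨C, -, χ, hχ, hχ1, hχd, hχe⟩ := exists_cutoff hΩ hne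
  have hum := h.aestronglyMeasurable_left
  have hgm := h.aestronglyMeasurable_right
  have hε4 : 0 < ε / 4 := ENNReal.div_pos hε.ne' (by norm_num)
  obtain ⟨k, hk⟩ := ((tendsto_lintegral_cutoff_sub hΩ hne hum hgm hu hg hχ hχ1 hχd
    hχe).eventually_le_const hε4).exists
  set F : Euc n → ℝ := fun x => χ k x * u x with hF
  set G : Euc n → Euc n := fun x => χ k x • g x + u x • gradient (χ k) x with hG
  set K := tsupport (χ k) with hK
  have hKc : IsCompact K := (hχ k).2.1
  have hKΩ : K ⊆ Ω := (hχ k).2.2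
  have hF0 : ∀ x ∉ K, F x = 0 := fun x hx => by
    simp [hF, image_eq_zero_of_notMem_tsupport hx]
  have hG0 : ∀ x ∉ K, G x = 0 := fun x hx => by
    simp [hG, image_eq_zero_of_notMem_tsupport hx,
      image_eq_zero_of_notMem_tsupport fun h' => hx (tsupport_gradient_subset _ h')]
  have huK := memLp_two_restrict_of_lintegral_dw hΩ hne hum hu hKc hKΩ
  have hgK := memLp_two_restrict_of_lintegral_dw hΩ hne hgm hg hKc hKΩ
  have hχm : AEStronglyMeasurable (χ k) (volume.restrict K) :=
    (hχ k).1.continuous.aestronglyMeasurable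
  have hgrm : AEStronglyMeasurable (gradient (χ k)) (volume.restrict K) :=
    (hχ k).continuous_gradient.aestronglyMeasurable
  obtain ⟨D, hD⟩ := (hχ k).continuous_gradient.bounded_above_of_compact_support
    (hχ k).hasCompactSupport_gradient
  have hFK : MemLp F 2 (volume.restrict K) := huK.of_le (hχm.mul huK.1) (ae_of_all _ fun x => by
    rw [hF, norm_mul]
    exact mul_le_of_le_one_left (norm_nonneg _) (hχ1 k x))
  have hGK : MemLp G 2 (volume.restrict K) := by
    refine MemLp.add (hgK.of_le (hχm.smul hgK.1) (ae_of_all _ fun x => ?_))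
      (huK.of_le_mul (c := D) (huK.1.smul hgrm) (ae_of_all _ fun x => ?_))
    · rw [norm_smul]
      exact mul_le_of_le_one_left (norm_nonneg _) (hχ1 k x)
    · rw [norm_smul, mul_comm]
      exact mul_le_mul_of_nonneg_right (hD x) (norm_nonneg _)
  have hKm : MeasurableSet K := hKc.measurableSet
  have hFL : MemLp F 2 volume := by
    rw [← indicator_eq_self.2 (fun x hx => by_contra fun h' => hx (hF0 x h') :
      Function.support F ⊆ K), memLp_indicator_iff_restrict hKm]
    exact hFK
  have hGL : MemLp G 2 volume := by
    rw [← indicator_eq_self.2 (fun x hx => by_contra fun h' => hx (hG0 x h') :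
      Function.support G ⊆ K), memLp_indicator_iff_restrict hKm]
    exact hGK
  obtain ⟨K', hK', hKK', hK'Ω, happ⟩ := exists_isTestOn_gradient_close hΩ hFL hGL
    (fun φ hφ _ v => h.integral_cutoff_mul_fderiv (hχ k) hφ v) hKc hKΩ hF0
  obtain ⟨M, hM⟩ := exists_dw_le_of_isCompact hΩ hne (d + 1 - n) hK' hK'Ω
  obtain ⟨ψ, hψ, hψK, hψG⟩ := happ (ε / 4 / (M + 1)) (ENNReal.div_pos hε4.ne' (by simp))
  refine ⟨ψ, hψ, ?_⟩
  have hsecond : ∫⁻ x in Ω, ‖gradient ψ x - G x‖ₑ ^ (2 : ℝ) * dw Ω (d + 1 - n) x ≤ ε / 4 :=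
    calc ∫⁻ x in Ω, ‖gradient ψ x - G x‖ₑ ^ (2 : ℝ) * dw Ω (d + 1 - n) x
        ≤ ∫⁻ x, (M + 1) * ‖gradient ψ x - G x‖ₑ ^ (2 : ℝ) := by
          refine (setLIntegral_le_lintegral _ _).trans (lintegral_mono fun x => ?_)
          by_cases hx : x ∈ K'
          · simp only
            rw [mul_comm]
            gcongr
            exact (hM x hx).trans le_self_add
          · simp [hG0 x fun h' => hx (hKK' h'), image_eq_zero_of_notMem_tsupport fun h' =>
              hx (hψK (tsupport_gradient_subset ψ h'))]
      _ = (M + 1) * ∫⁻ x, ‖gradient ψ x - G x‖ₑ ^ (2 : ℝ) :=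
          lintegral_const_mul' _ _ (by simp)
      _ ≤ (M + 1) * (ε / 4 / (M + 1)) := by gcongr
      _ ≤ ε / 4 := ENNReal.mul_div_le
  calc ∫⁻ x in Ω, ‖gradient ψ x - g x‖ₑ ^ (2 : ℝ) * dw Ω (d + 1 - n) x
      ≤ ∫⁻ x in Ω, (2 * (‖gradient ψ x - G x‖ₑ ^ (2 : ℝ) * dw Ω (d + 1 - n) x) +
          2 * (‖g x - G x‖ₑ ^ (2 : ℝ) * dw Ω (d + 1 - n) x)) := by
        refine lintegral_mono fun x => ?_
        rw [← mul_add, ← add_mul, ← mul_assoc]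
        gcongr
        refine (ENNReal.rpow_le_rpow ?_ zero_le_two).trans (add_rpow_two_le _ _)
        rw [enorm_sub_rev (g x), ← sub_add_sub_cancel _ (G x) (g x)]
        exact enorm_add_le _ _
    _ = 2 * (∫⁻ x in Ω, ‖gradient ψ x - G x‖ₑ ^ (2 : ℝ) * dw Ω (d + 1 - n) x) +
          2 * ∫⁻ x in Ω, ‖g x - G x‖ₑ ^ (2 : ℝ) * dw Ω (d + 1 - n) x := by
        rw [lintegral_add_left', lintegral_const_mul' _ _ ENNReal.ofNat_ne_top,
          lintegral_const_mul' _ _ ENNReal.ofNat_ne_top]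
        exact (((hψ.continuous_gradient.aestronglyMeasurable.sub hGL.1.restrict).enorm.pow_const
          _).mul (measurable_dw Ω _).aemeasurable).const_mul _
    _ ≤ 2 * (ε / 4) + 2 * (ε / 4) := by gcongr
    _ = ε := by
        rw [← two_mul, ← mul_assoc]
        norm_num
        exact ENNReal.mul_div_cancel (by norm_num) (by norm_num)

end Density

section LaxMilgram

variable {Ω : Set (Euc n)} {d : ℝ}

lemma exists_mem_closure_inner_eq {E : Type*} [NormedAddCommGroup E] [InnerProductSpace ℝ E]
    [CompleteSpace E] (S : Submodule ℝ E) (T : E →L[ℝ] E) {c : ℝ} (hc : 0 < c)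
    (hT : ∀ w, c * ‖w‖ ^ 2 ≤ ⟪w, T w⟫) (e : E) :
    ∃ w ∈ S.topologicalClosure, ∀ v ∈ S, ⟪v, T w⟫ = ⟪v, e⟫ := by
  set W := S.topologicalClosure with hW
  have : CompleteSpace W := S.isClosed_topologicalClosure.completeSpace_coe
  set B : W →L[ℝ] W →L[ℝ] ℝ :=
    ((ContinuousLinearMap.compL ℝ W E ℝ).flip W.subtypeL).comp
      ((innerSL ℝ).comp (T.comp W.subtypeL)) with hB
  have hBv : ∀ w v : W, B w v = ⟪T w, (v : E)⟫ := fun w v => rfl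
  have hco : IsCoercive B := ⟨c, hc, fun w => by
    rw [hBv, real_inner_comm, mul_assoc, ← pow_two]
    exact hT w⟩
  set f : W := (InnerProductSpace.toDual ℝ W).symm ((innerSL ℝ e).comp W.subtypeL) with hf
  set w : W := hco.continuousLinearEquivOfBilin.symm f with hw
  refine ⟨w, w.2, fun v hv => ?_⟩
  have h := hco.continuousLinearEquivOfBilin_apply w ⟨v, S.le_topologicalClosure hv⟩
  rw [hw, ContinuousLinearEquiv.apply_symm_apply, ← hw, hBv, hf,
    InnerProductSpace.toDual_symm_apply] at h
  rw [real_inner_comm, ← h]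
  exact real_inner_comm _ _

lemma apply_eq_sum_basisFun (L : Euc n →L[ℝ] Euc n) (v : Euc n) :
    L v = ∑ i, v i • L (EuclideanSpace.basisFun (Fin n) ℝ i) := by
  conv_lhs => rw [← (EuclideanSpace.basisFun (Fin n) ℝ).sum_repr v]
  simp

lemma aestronglyMeasurable_clm_apply {μ : Measure (Euc n)} {M : Euc n → Euc n →L[ℝ] Euc n}
    (hM : ∀ v, Measurable fun x => M x v) {w : Euc n → Euc n} (hw : AEStronglyMeasurable w μ) :
    AEStronglyMeasurable (fun x => M x (w x)) μ := by
  rw [show (fun x => M x (w x)) = fun x => ∑ i, w x i • M x (EuclideanSpace.basisFun (Fin n) ℝ i)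
    from funext fun x => apply_eq_sum_basisFun _ _]
  refine Finset.aestronglyMeasurable_fun_sum _ fun i _ => ?_
  exact ((EuclideanSpace.proj i).continuous.comp_aestronglyMeasurable hw).smul
    (hM _).aestronglyMeasurable

/-- The bounded operator on `L²` given by pointwise application of a bounded field of
operators. -/
lemma exists_clm_Lp_two {μ : Measure (Euc n)} {M : Euc n → Euc n →L[ℝ] Euc n}
    (hM : ∀ v, Measurable fun x => M x v) {L : ℝ} (hL : ∀ᵐ x ∂μ, ∀ ξ, ‖M x ξ‖ ≤ L * ‖ξ‖) :
    ∃ T : Lp (Euc n) 2 μ →L[ℝ] Lp (Euc n) 2 μ, ∀ w, T w =ᵐ[μ] fun x => M x (w x) := by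
  have hmem : ∀ w : Lp (Euc n) 2 μ, MemLp (fun x => M x (w x)) 2 μ := fun w =>
    (Lp.memLp w).of_le_mul (aestronglyMeasurable_clm_apply hM (Lp.aestronglyMeasurable w))
      (hL.mono fun x hx => hx _)
  set T : Lp (Euc n) 2 μ →ₗ[ℝ] Lp (Euc n) 2 μ :=
    { toFun := fun w => (hmem w).toLp
      map_add' := fun w v => by
        rw [← MemLp.toLp_add]
        refine MemLp.toLp_congr _ _ ?_
        filter_upwards [Lp.coeFn_add w v] with x hx
        rw [Pi.add_apply, hx, Pi.add_apply, map_add]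
      map_smul' := fun r w => by
        rw [RingHom.id_apply, ← MemLp.toLp_const_smul]
        refine MemLp.toLp_congr _ _ ?_
        filter_upwards [Lp.coeFn_smul r w] with x hx
        rw [Pi.smul_apply, hx, Pi.smul_apply, map_smul] } with hT
  refine ⟨T.mkContinuous L fun w => ?_, fun w => (hmem w).coeFn_toLp⟩
  refine Lp.norm_le_mul_norm_of_ae_le_mul ?_
  filter_upwards [hL, (hmem w).coeFn_toLp] with x hx h2
  change ‖(hmem w).toLp _ x‖ ≤ _
  rw [h2]
  exact hx _

end LaxMilgram

section WeakSolution

variable {Ω : Set (Euc n)} {d A₀ : ℝ}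

lemma IsTestOn.add {φ ψ : Euc n → ℝ} (hφ : IsTestOn Ω φ) (hψ : IsTestOn Ω ψ) :
    IsTestOn Ω fun x => φ x + ψ x :=
  ⟨hφ.1.add hψ.1, hφ.2.1.add hψ.2.1, (tsupport_add φ ψ).trans (union_subset hφ.2.2 hψ.2.2)⟩

lemma IsTestOn.const_mul {φ : Euc n → ℝ} (hφ : IsTestOn Ω φ) (r : ℝ) :
    IsTestOn Ω fun x => r * φ x :=
  ⟨contDiff_const.mul hφ.1, hφ.2.1.mul_left, tsupport_mul_subset_right.trans hφ.2.2⟩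

lemma isTestOn_zero : IsTestOn Ω fun _ => 0 :=
  ⟨contDiff_const, HasCompactSupport.zero, by simp⟩

lemma IsTestOn.differentiable {φ : Euc n → ℝ} (hφ : IsTestOn Ω φ) : Differentiable ℝ φ :=
  hφ.contDiff_one.differentiable one_ne_zero

lemma IsTestOn.gradient_add {φ ψ : Euc n → ℝ} (hφ : IsTestOn Ω φ) (hψ : IsTestOn Ω ψ)
    (x : Euc n) : gradient (fun x => φ x + ψ x) x = gradient φ x + gradient ψ x := by
  rw [gradient, fderiv_fun_add (hφ.differentiable x) (hψ.differentiable x), map_add]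
  rfl

lemma IsTestOn.gradient_const_mul {φ : Euc n → ℝ} (hφ : IsTestOn Ω φ) (r : ℝ) (x : Euc n) :
    gradient (fun x => r * φ x) x = r • gradient φ x := by
  rw [gradient, fderiv_const_mul (hφ.differentiable x), map_smul]
  rfl

/-- Weighted gradients `δᵇ ∇φ` of test functions, as a subspace of `L²(Ω)`. -/
def gradientSpace (Ω : Set (Euc n)) (b : ℝ) : Submodule ℝ (Lp (Euc n) 2 (volume.restrict Ω)) where
  carrier := {f | ∃ φ : Euc n → ℝ, IsTestOn Ω φ ∧
    f =ᵐ[volume.restrict Ω] fun x => bd Ω x ^ b • gradient φ x}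
  add_mem' := by
    rintro f g ⟨φ, hφ, hf⟩ ⟨ψ, hψ, hg⟩
    refine ⟨_, hφ.add hψ, ?_⟩
    filter_upwards [hf, hg, Lp.coeFn_add f g] with x h1 h2 h3
    rw [h3, Pi.add_apply, h1, h2, hφ.gradient_add hψ, smul_add]
  zero_mem' := by
    refine ⟨_, isTestOn_zero, ?_⟩
    filter_upwards [Lp.coeFn_zero (Euc n) 2 (volume.restrict Ω)] with x hx
    rw [hx]
    simp [gradient]
  smul_mem' := by
    rintro r f ⟨φ, hφ, hf⟩
    refine ⟨_, hφ.const_mul r, ?_⟩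
    filter_upwards [hf, Lp.coeFn_smul r f] with x h1 h2
    rw [h2, Pi.smul_apply, h1, hφ.gradient_const_mul, smul_comm]

lemma lintegral_rpow_smul_Lp_lt_top (hΩ : IsOpen Ω) (hne : (frontier Ω).Nonempty)
    {F : Type*} [NormedAddCommGroup F] [NormedSpace ℝ F] (b : ℝ) (f : Lp F 2 (volume.restrict Ω)) :
    ∫⁻ x in Ω, ‖bd Ω x ^ (-b) • f x‖ₑ ^ (2 : ℝ) * dw Ω (2 * b) x < ⊤ := by
  have h := (Lp.memLp f).2
  rw [eLpNorm_lt_top_iff_lintegral_rpow_enorm_lt_top two_ne_zero ENNReal.ofNat_ne_top,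
    ENNReal.toReal_ofNat] at h
  refine (setLIntegral_congr_fun hΩ.measurableSet fun x hx => ?_).trans_lt h
  have hδ := bd_pos hΩ hne hx
  have h1 : dw Ω (-b * 2) x * dw Ω (2 * b) x = 1 := by
    rw [← dw_add hδ, neg_mul, mul_comm b, neg_add_cancel]
    simp [dw]
  rw [enorm_bd_rpow_smul hδ, ENNReal.mul_rpow_of_nonneg _ _ zero_le_two, dw_rpow, mul_right_comm,
    h1, one_mul]

lemma aestronglyMeasurable_bd_rpow_smul {F : Type*} [NormedAddCommGroup F] [NormedSpace ℝ F]
    (b : ℝ) {f : Euc n → F} {μ : Measure (Euc n)} (hf : AEStronglyMeasurable f μ) :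
    AEStronglyMeasurable (fun x => bd Ω x ^ b • f x) μ :=
  ((measurable_bd Ω).pow_const b).aestronglyMeasurable.smul hf

lemma locallyIntegrableOn_of_lintegral_dw (hΩ : IsOpen Ω) (hne : (frontier Ω).Nonempty)
    {a : ℝ} {F : Type*} [NormedAddCommGroup F] {f : Euc n → F}
    (hf : AEStronglyMeasurable f (volume.restrict Ω))
    (hfa : ∫⁻ x in Ω, ‖f x‖ₑ ^ (2 : ℝ) * dw Ω a x < ⊤) : LocallyIntegrableOn f Ω volume := by
  refine (locallyIntegrableOn_iff hΩ.isLocallyClosed).2 fun K hKΩ hK => ?_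
  have : IsFiniteMeasure (volume.restrict K) := ⟨by
    rw [Measure.restrict_apply_univ]; exact hK.measure_lt_top⟩
  exact (memLp_two_restrict_of_lintegral_dw hΩ hne hf hfa hK hKΩ).integrable one_le_two

lemma tendsto_setIntegral_inner_of_tendsto_Lp (hΩ : IsOpen Ω) (hne : (frontier Ω).Nonempty)
    {F : Type*} [NormedAddCommGroup F] [InnerProductSpace ℝ F] (b : ℝ)
    {f : ℕ → Lp F 2 (volume.restrict Ω)} {f₀ : Lp F 2 (volume.restrict Ω)}
    (hf : Tendsto f atTop (𝓝 f₀)) {k : Euc n → F} (hk : Continuous k) (hkc : HasCompactSupport k)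
    (hkΩ : tsupport k ⊆ Ω) :
    Tendsto (fun j => ∫ x in Ω, ⟪bd Ω x ^ b • f j x, k x⟫) atTop
      (𝓝 (∫ x in Ω, ⟪bd Ω x ^ b • f₀ x, k x⟫)) := by
  have hmem := memLp_bd_rpow_smul hΩ hne b hk hkc hkΩ 2 (volume.restrict Ω)
  have key : ∀ h : Lp F 2 (volume.restrict Ω),
      ⟪h, hmem.toLp⟫ = ∫ x in Ω, ⟪bd Ω x ^ b • h x, k x⟫ := fun h => by
    rw [L2.inner_def]
    refine integral_congr_ae ?_
    filter_upwards [hmem.coeFn_toLp] with x hx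
    rw [hx, real_inner_smul_left, real_inner_smul_right]
  simp_rw [← key]
  exact hf.inner tendsto_const_nhds

/-- Functions whose weighted gradients lie in the closure of the gradients of test functions. -/
lemma exists_hasWeakGradOn_of_mem_closure (hΩ : IsOpen Ω) (hdn : d < n)
    (hΓ : AhlforsRegular d A₀ (frontier Ω)) (hJ : WeakLocalJohn Ω d)
    (hunb : ¬ Bornology.IsBounded Ωᶜ) {w : Lp (Euc n) 2 (volume.restrict Ω)}
    (hw : w ∈ (gradientSpace Ω ((d + 1 - n) / 2)).topologicalClosure) :
    ∃ u : Euc n → ℝ, HasWeakGradOn u (fun x => bd Ω x ^ (-((d + 1 - n) / 2)) • w x) Ω ∧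
      ∫⁻ x in Ω, ‖u x‖ₑ ^ (2 : ℝ) * dw Ω (d - n - 1) x < ⊤ := by
  obtain ⟨C, hC⟩ := exists_hardy hΩ hdn hΓ hJ hunb
  have hne := hΓ.1
  obtain ⟨f, hfS, hfw⟩ := mem_closure_iff_seq_limit.1 hw
  choose φ hφ hfφ using hfS
  set b := (d + 1 - n) / 2 with hb
  set b' := (d - n - 1) / 2 with hb'
  have hmem : ∀ j, MemLp (fun x => bd Ω x ^ b' • φ j x) 2 (volume.restrict Ω) := fun j =>
    memLp_bd_rpow_smul hΩ hne b' (hφ j).1.continuous (hφ j).2.1 (hφ j).2.2 _ _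
  set v : ℕ → Lp ℝ 2 (volume.restrict Ω) := fun j => (hmem j).toLp with hv
  have hedist : ∀ i j, edist (v i) (v j) ≤ C * edist (f i) (f j) := fun i j => by
    have htest := (hφ i).add ((hφ j).const_mul (-1))
    rw [hv, Lp.edist_toLp_toLp, Lp.edist_def]
    refine (le_of_eq (eLpNorm_congr_ae (ae_of_all _ fun x => ?_))).trans
      ((hC _ htest).trans (le_of_eq ?_))
    · simp only [Pi.sub_apply, smul_eq_mul]
      ring
    · congr 1
      refine eLpNorm_congr_ae ?_
      filter_upwards [hfφ i, hfφ j] with x h1 h2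
      rw [(hφ i).gradient_add ((hφ j).const_mul (-1)), (hφ j).gradient_const_mul, Pi.sub_apply,
        h1, h2, ← smul_sub, neg_one_smul, sub_eq_add_neg]
  have hcauchy : CauchySeq v := by
    have hfc := hfw.cauchySeq
    rw [EMetric.cauchySeq_iff] at hfc ⊢
    intro ε hε
    obtain ⟨N, hN⟩ := hfc (ε / (C + 1)) (ENNReal.div_pos hε.ne' (by simp))
    refine ⟨N, fun i hi j hj => (hedist i j).trans_lt ?_⟩
    calc C * edist (f i) (f j) ≤ (C + 1) * edist (f i) (f j) := by gcongr; exact le_self_add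
      _ < ε := by
        rw [mul_comm]
        exact ENNReal.mul_lt_of_lt_div (hN i hi j hj)
  obtain ⟨v₀, hv₀⟩ := cauchySeq_tendsto_of_complete hcauchy
  have hu := lintegral_rpow_smul_Lp_lt_top hΩ hne b' v₀
  have hg := lintegral_rpow_smul_Lp_lt_top hΩ hne b w
  have hum := aestronglyMeasurable_bd_rpow_smul (Ω := Ω) (-b') (Lp.aestronglyMeasurable v₀)
  have hgm := aestronglyMeasurable_bd_rpow_smul (Ω := Ω) (-b) (Lp.aestronglyMeasurable w)
  refine ⟨fun x => bd Ω x ^ (-b') • v₀ x, ⟨locallyIntegrableOn_of_lintegral_dw hΩ hne hum hu,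
    locallyIntegrableOn_of_lintegral_dw hΩ hne hgm hg, fun ψ hψ e => ?_⟩, ?_⟩
  · have hψe : Continuous fun x => fderiv ℝ ψ x e :=
      (hψ.contDiff_one.continuous_fderiv one_ne_zero).clm_apply continuous_const
    have hψs : tsupport (fun x => fderiv ℝ ψ x e) ⊆ tsupport ψ := tsupport_fderiv_apply_subset ℝ e
    have hψes : tsupport (fun x => ψ x • e) ⊆ tsupport ψ := tsupport_smul_subset_left _ _
    have l1 := tendsto_setIntegral_inner_of_tendsto_Lp hΩ hne (-b') hv₀ hψe
      (hψ.2.1.of_isClosed_subset (isClosed_tsupport _) hψs) (hψs.trans hψ.2.2)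
    have l2 := tendsto_setIntegral_inner_of_tendsto_Lp hΩ hne (-b) hfw
      (hψ.1.continuous.smul continuous_const : Continuous fun x => ψ x • e)
      (hψ.2.1.of_isClosed_subset (isClosed_tsupport _) hψes) (hψes.trans hψ.2.2)
    have heq : ∀ j, ∫ x in Ω, ⟪bd Ω x ^ (-b') • v j x, fderiv ℝ ψ x e⟫ =
        -∫ x in Ω, ⟪bd Ω x ^ (-b) • f j x, ψ x • e⟫ := fun j => by
      have hmΩ := hΩ.measurableSet
      have e1 : ∫ x in Ω, ⟪bd Ω x ^ (-b') • v j x, fderiv ℝ ψ x e⟫ =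
          ∫ x in Ω, φ j x * fderiv ℝ ψ x e := by
        refine integral_congr_ae ?_
        filter_upwards [(hmem j).coeFn_toLp, ae_restrict_mem hmΩ] with x h1 hx
        rw [hv, h1, smul_smul, ← Real.rpow_add (bd_pos hΩ hne hx), neg_add_cancel, Real.rpow_zero,
          one_smul, real_inner_eq_re_inner, RCLike.inner_apply]
        simp [mul_comm]
      have e2 : ∫ x in Ω, ⟪bd Ω x ^ (-b) • f j x, ψ x • e⟫ =
          ∫ x in Ω, fderiv ℝ (φ j) x e * ψ x := by
        refine integral_congr_ae ?_
        filter_upwards [hfφ j, ae_restrict_mem hmΩ] with x h1 hx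
        rw [h1, smul_smul, ← Real.rpow_add (bd_pos hΩ hne hx), neg_add_cancel, Real.rpow_zero,
          one_smul, real_inner_smul_right, inner_gradient_eq_fderiv, mul_comm]
      have hφ0 : ∀ x ∉ Ω, ψ x = 0 := fun x hx =>
        image_eq_zero_of_notMem_tsupport fun h' => hx (hψ.2.2 h')
      have hφe : Continuous fun x => fderiv ℝ (φ j) x e :=
        ((hφ j).contDiff_one.continuous_fderiv one_ne_zero).clm_apply continuous_const
      rw [e1, e2, setIntegral_eq_integral_of_forall_compl_eq_zero fun x hx => by
          rw [image_eq_zero_of_notMem_tsupport fun h' => hx (hψ.2.2 (hψs h')), mul_zero],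
        setIntegral_eq_integral_of_forall_compl_eq_zero fun x hx => by rw [hφ0 x hx, mul_zero]]
      refine integral_mul_fderiv_eq_neg_fderiv_mul_of_integrable ?_ ?_ ?_
        (fun x _ => (hφ j).differentiable x) fun x _ => hψ.differentiable x
      · exact (hφe.mul hψ.1.continuous).integrable_of_hasCompactSupport hψ.2.1.mul_left
      · exact ((hφ j).1.continuous.mul hψe).integrable_of_hasCompactSupport (hφ j).2.1.mul_right
      · exact ((hφ j).1.continuous.mul hψ.1.continuous).integrable_of_hasCompactSupport
          hψ.2.1.mul_left
    have hlim := tendsto_nhds_unique (l1.congr heq) l2.neg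
    calc ∫ x in Ω, bd Ω x ^ (-b') • v₀ x * fderiv ℝ ψ x e
        = ∫ x in Ω, ⟪bd Ω x ^ (-b') • v₀ x, fderiv ℝ ψ x e⟫ := by
          refine integral_congr_ae (ae_of_all _ fun x => ?_)
          simp [mul_comm]
      _ = -∫ x in Ω, ⟪bd Ω x ^ (-b) • w x, ψ x • e⟫ := hlim
      _ = _ := by
          congr 1
          refine integral_congr_ae (ae_of_all _ fun x => ?_)
          simp only [real_inner_smul_right]
          ring
  · rwa [hb', mul_div_cancel₀ _ two_ne_zero] at hu

end WeakSolution

section Energy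

variable {Ω : Set (Euc n)} {d A₀ : ℝ}

lemma lintegral_bd_rpow_smul (hΩ : IsOpen Ω) (hne : (frontier Ω).Nonempty)
    {F : Type*} [NormedAddCommGroup F] [NormedSpace ℝ F] (b : ℝ) (f : Euc n → F) :
    ∫⁻ x in Ω, ‖bd Ω x ^ b • f x‖ₑ ^ (2 : ℝ) = ∫⁻ x in Ω, ‖f x‖ₑ ^ (2 : ℝ) * dw Ω (2 * b) x := by
  refine setLIntegral_congr_fun hΩ.measurableSet fun x hx => ?_
  rw [enorm_bd_rpow_smul (bd_pos hΩ hne hx), ENNReal.mul_rpow_of_nonneg _ _ zero_le_two, dw_rpow,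
    mul_comm b, mul_comm]

lemma memLp_two_bd_rpow_smul (hΩ : IsOpen Ω) (hne : (frontier Ω).Nonempty)
    {F : Type*} [NormedAddCommGroup F] [NormedSpace ℝ F] {b : ℝ} {f : Euc n → F}
    (hf : AEStronglyMeasurable f (volume.restrict Ω))
    (hfb : ∫⁻ x in Ω, ‖f x‖ₑ ^ (2 : ℝ) * dw Ω (2 * b) x < ⊤) :
    MemLp (fun x => bd Ω x ^ b • f x) 2 (volume.restrict Ω) := by
  refine ⟨aestronglyMeasurable_bd_rpow_smul b hf, ?_⟩
  rw [eLpNorm_lt_top_iff_lintegral_rpow_enorm_lt_top two_ne_zero ENNReal.ofNat_ne_top,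
    ENNReal.toReal_ofNat, lintegral_bd_rpow_smul hΩ hne]
  exact hfb

lemma setIntegral_inner_eq_inner_toLp (hΩ : IsOpen Ω) (hne : (frontier Ω).Nonempty)
    {b : ℝ} {g F : Euc n → Euc n}
    (hg : MemLp (fun x => bd Ω x ^ b • g x) 2 (volume.restrict Ω))
    (hF : MemLp (fun x => bd Ω x ^ (-b) • F x) 2 (volume.restrict Ω)) :
    ∫ x in Ω, ⟪g x, F x⟫ = ⟪hg.toLp, hF.toLp⟫ := by
  rw [L2.inner_def]
  refine integral_congr_ae ?_
  filter_upwards [hg.coeFn_toLp, hF.coeFn_toLp, ae_restrict_mem hΩ.measurableSet] with x h1 h2 hx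
  rw [h1, h2, real_inner_smul_left, real_inner_smul_right, ← mul_assoc,
    ← Real.rpow_add (bd_pos hΩ hne hx), add_neg_cancel, Real.rpow_zero, one_mul]

/-- Two fields which pair equally with all gradients of test functions pair equally with the
weak gradient of every function of finite energy. -/
lemma HasWeakGradOn.integral_inner_congr (hΩ : IsOpen Ω) (hne : (frontier Ω).Nonempty)
    {u : Euc n → ℝ} {g : Euc n → Euc n} (h : HasWeakGradOn u g Ω)
    (hu : ∫⁻ x in Ω, ‖u x‖ₑ ^ (2 : ℝ) * dw Ω (d - n - 1) x < ⊤)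
    (hg : ∫⁻ x in Ω, ‖g x‖ₑ ^ (2 : ℝ) * dw Ω (d + 1 - n) x < ⊤) {F₁ F₂ : Euc n → Euc n}
    (hF₁ : MemLp (fun x => bd Ω x ^ (-((d + 1 - n) / 2)) • F₁ x) 2 (volume.restrict Ω))
    (hF₂ : MemLp (fun x => bd Ω x ^ (-((d + 1 - n) / 2)) • F₂ x) 2 (volume.restrict Ω))
    (heq : ∀ φ : Euc n → ℝ, IsTestOn Ω φ →
      ∫ x in Ω, ⟪gradient φ x, F₁ x⟫ = ∫ x in Ω, ⟪gradient φ x, F₂ x⟫) :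
    ∫ x in Ω, ⟪g x, F₁ x⟫ = ∫ x in Ω, ⟪g x, F₂ x⟫ := by
  set b := (d + 1 - n) / 2 with hb
  have h2b : 2 * b = d + 1 - n := mul_div_cancel₀ _ two_ne_zero
  choose φ hφ hφg using fun j : ℕ => h.exists_isTestOn_lintegral_sub_le hΩ hne hu hg
    (ε := ((j : ℝ≥0∞) + 1)⁻¹) (ENNReal.inv_pos.2 (by simp))
  have hgL : MemLp (fun x => bd Ω x ^ b • g x) 2 (volume.restrict Ω) :=
    memLp_two_bd_rpow_smul hΩ hne h.aestronglyMeasurable_right (by rwa [h2b])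
  have hφL : ∀ j, MemLp (fun x => bd Ω x ^ b • gradient (φ j) x) 2 (volume.restrict Ω) := fun j =>
    memLp_bd_rpow_smul hΩ hne b (hφ j).continuous_gradient (hφ j).hasCompactSupport_gradient
      ((tsupport_gradient_subset _).trans (hφ j).2.2) _ _
  have hlim : Tendsto (fun j => (hφL j).toLp) atTop (𝓝 hgL.toLp) := by
    rw [Lp.tendsto_Lp_iff_tendsto_eLpNorm'']
    have hinv : Tendsto (fun j : ℕ => (((j : ℝ≥0∞) + 1)⁻¹) ^ (1 / 2 : ℝ)) atTop (𝓝 0) := by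
      have h0 : Tendsto (fun j : ℕ => ((j : ℝ≥0∞) + 1)⁻¹) atTop (𝓝 0) := by
        have := (tendsto_add_atTop_iff_nat 1).2 ENNReal.tendsto_inv_nat_nhds_zero
        simpa using this
      simpa using h0.ennrpow_const (1 / 2)
    refine tendsto_of_tendsto_of_tendsto_of_le_of_le tendsto_const_nhds hinv (fun _ => zero_le)
      fun j => ?_
    rw [eLpNorm_eq_lintegral_rpow_enorm_toReal two_ne_zero ENNReal.ofNat_ne_top,
      ENNReal.toReal_ofNat]
    refine ENNReal.rpow_le_rpow ?_ (by norm_num)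
    simp only [Pi.sub_apply, ← smul_sub]
    rw [lintegral_bd_rpow_smul hΩ hne, h2b]
    exact hφg j
  have h1 := Filter.Tendsto.inner (𝕜 := ℝ) hlim (tendsto_const_nhds (x := hF₁.toLp))
  have h2 := Filter.Tendsto.inner (𝕜 := ℝ) hlim (tendsto_const_nhds (x := hF₂.toLp))
  rw [← setIntegral_inner_eq_inner_toLp hΩ hne] at h1 h2
  simp_rw [← setIntegral_inner_eq_inner_toLp hΩ hne] at h1 h2
  exact tendsto_nhds_unique h1 (h2.congr fun j => (heq _ (hφ j)).symm)

lemma WeaklyElliptic.norm_apply_le {lam Lam : ℝ} {A : Euc n → Euc n →L[ℝ] Euc n}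
    (h : WeaklyElliptic Ω d lam Lam A) {x : Euc n} (hx : x ∈ Ω) (ξ : Euc n) :
    ‖A x ξ‖ ≤ Lam * bd Ω x ^ (d + 1 - (n : ℝ)) * ‖ξ‖ := by
  have h1 := (h.2.2.2 x hx ξ (A x ξ)).2
  rw [real_inner_self_eq_norm_sq, abs_of_nonneg (sq_nonneg _), pow_two] at h1
  by_cases h0 : ‖A x ξ‖ = 0
  · rw [h0]
    have := h.1.le.trans h.2.1
    have := bd_nonneg Ω x
    positivity
  · exact le_of_mul_le_mul_right h1 ((norm_nonneg _).lt_of_ne' h0)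

lemma memLp_apply_of_norm_le (hΩ : IsOpen Ω) (hne : (frontier Ω).Nonempty) {b L : ℝ}
    {g F : Euc n → Euc n} (hg : MemLp (fun x => bd Ω x ^ b • g x) 2 (volume.restrict Ω))
    (hF : AEStronglyMeasurable F (volume.restrict Ω))
    (hle : ∀ x ∈ Ω, ‖F x‖ ≤ L * bd Ω x ^ (2 * b) * ‖g x‖) :
    MemLp (fun x => bd Ω x ^ (-b) • F x) 2 (volume.restrict Ω) := by
  refine hg.of_le_mul (c := L) (aestronglyMeasurable_bd_rpow_smul _ hF) ?_
  filter_upwards [ae_restrict_mem hΩ.measurableSet] with x hx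
  have hδ := bd_pos hΩ hne hx
  rw [norm_smul, norm_smul, Real.norm_of_nonneg (by positivity),
    Real.norm_of_nonneg (by positivity)]
  calc bd Ω x ^ (-b) * ‖F x‖ ≤ bd Ω x ^ (-b) * (L * bd Ω x ^ (2 * b) * ‖g x‖) := by
        gcongr
        exact hle x hx
    _ = L * (bd Ω x ^ (-b + 2 * b) * ‖g x‖) := by rw [Real.rpow_add hδ]; ring
    _ = L * (bd Ω x ^ b * ‖g x‖) := by rw [show -b + 2 * b = b by ring]

/-- Weak solutions of finite energy exist for data of finite energy. -/
lemma exists_weak_solution (hΩ : IsOpen Ω) (hdn : d < n)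
    (hΓ : AhlforsRegular d A₀ (frontier Ω)) (hJ : WeakLocalJohn Ω d)
    (hunb : ¬ Bornology.IsBounded Ωᶜ) {lam Lam : ℝ} {A : Euc n → Euc n →L[ℝ] Euc n}
    (hA : WeaklyElliptic Ω d lam Lam A) {H : Euc n → Euc n}
    (hH : MemLp (fun x => bd Ω x ^ ((d + 1 - n) / 2) • H x) 2 (volume.restrict Ω)) :
    ∃ (u : Euc n → ℝ) (g : Euc n → Euc n), HasWeakGradOn u g Ω ∧
      ∫⁻ x in Ω, ‖u x‖ₑ ^ (2 : ℝ) * dw Ω (d - n - 1) x < ⊤ ∧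
      ∫⁻ x in Ω, ‖g x‖ₑ ^ (2 : ℝ) * dw Ω (d + 1 - n) x < ⊤ ∧
      ∀ φ : Euc n → ℝ, IsTestOn Ω φ → ∫ x in Ω, ⟪gradient φ x, A x (g x)⟫ =
        ∫ x in Ω, ⟪gradient φ x, bd Ω x ^ (d + 1 - (n : ℝ)) • H x⟫ := by
  have hne := hΓ.1
  have hmΩ := hΩ.measurableSet
  set a := d + 1 - (n : ℝ) with ha
  set b := a / 2 with hb
  have hb2 : b + b = a := add_halves a
  obtain ⟨T, hT⟩ := exists_clm_Lp_two (μ := volume.restrict Ω)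
    (M := fun x => bd Ω x ^ (-a) • A x) (L := Lam)
    (fun v => ((measurable_bd Ω).pow_const (-a)).smul (hA.2.2.1 v)) (by
      filter_upwards [ae_restrict_mem hmΩ] with x hx ξ
      have hδ := bd_pos hΩ hne hx
      rw [_root_.smul_apply, norm_smul, Real.norm_of_nonneg (by positivity)]
      calc bd Ω x ^ (-a) * ‖A x ξ‖ ≤ bd Ω x ^ (-a) * (Lam * bd Ω x ^ a * ‖ξ‖) := by
            gcongr
            exact hA.norm_apply_le hx ξ
        _ = Lam * (bd Ω x ^ (-a + a)) * ‖ξ‖ := by rw [Real.rpow_add hδ]; ring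
        _ = Lam * ‖ξ‖ := by rw [neg_add_cancel, Real.rpow_zero, mul_one])
  have hco : ∀ w : Lp (Euc n) 2 (volume.restrict Ω), lam * ‖w‖ ^ 2 ≤ ⟪w, T w⟫ := fun w => by
    rw [← real_inner_self_eq_norm_sq, L2.inner_def, L2.inner_def, ← integral_const_mul]
    refine integral_mono_ae ((L2.integrable_inner w w).const_mul _) (L2.integrable_inner w (T w)) ?_
    filter_upwards [hT w, ae_restrict_mem hmΩ] with x h1 hx
    have hδ := bd_pos hΩ hne hx
    rw [h1, _root_.smul_apply, real_inner_smul_right, real_inner_self_eq_norm_sq]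
    calc lam * ‖w x‖ ^ 2 = bd Ω x ^ (-a + a) * (lam * ‖w x‖ ^ 2) := by
          rw [neg_add_cancel, Real.rpow_zero, one_mul]
      _ = bd Ω x ^ (-a) * (lam * bd Ω x ^ a * ‖w x‖ ^ 2) := by rw [Real.rpow_add hδ]; ring
      _ ≤ _ := by
        gcongr
        exact (hA.2.2.2 x hx (w x) 0).1
  obtain ⟨w, hw, hwe⟩ := exists_mem_closure_inner_eq (gradientSpace Ω b) T hA.1 hco hH.toLp
  obtain ⟨u, hug, hu⟩ := exists_hasWeakGradOn_of_mem_closure hΩ hdn hΓ hJ hunb hw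
  refine ⟨u, _, hug, hu, ?_, fun φ hφ => ?_⟩
  · have h := lintegral_rpow_smul_Lp_lt_top hΩ hne b w
    rwa [two_mul, hb2] at h
  · have hφL : MemLp (fun x => bd Ω x ^ b • gradient φ x) 2 (volume.restrict Ω) :=
      memLp_bd_rpow_smul hΩ hne b hφ.continuous_gradient hφ.hasCompactSupport_gradient
        ((tsupport_gradient_subset _).trans hφ.2.2) _ _
    have h := hwe hφL.toLp ⟨φ, hφ, hφL.coeFn_toLp⟩
    rw [L2.inner_def, L2.inner_def] at h
    calc ∫ x in Ω, ⟪gradient φ x, A x (bd Ω x ^ (-b) • w x)⟫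
        = ∫ x in Ω, ⟪MemLp.toLp _ hφL x, T w x⟫ := by
          refine integral_congr_ae ?_
          filter_upwards [hφL.coeFn_toLp, hT w, ae_restrict_mem hmΩ] with x h1 h2 hx
          have hδ := bd_pos hΩ hne hx
          rw [h1, h2, _root_.smul_apply, map_smul, real_inner_smul_left,
            real_inner_smul_right, real_inner_smul_right, ← mul_assoc, ← Real.rpow_add hδ]
          congr 2
          linarith
      _ = ∫ x in Ω, ⟪MemLp.toLp _ hφL x, MemLp.toLp _ hH x⟫ := h
      _ = _ := by
          refine integral_congr_ae ?_
          filter_upwards [hφL.coeFn_toLp, hH.coeFn_toLp, ae_restrict_mem hmΩ] with x h1 h2 hx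
          rw [h1, h2, real_inner_smul_left, real_inner_smul_right, real_inner_smul_right,
            ← mul_assoc, ← Real.rpow_add (bd_pos hΩ hne hx), hb2]

end Energy

section Duality

variable {Ω : Set (Euc n)} {d A₀ : ℝ}

lemma avNorm_two_lt_top_iff (hΩ : IsOpen Ω) (hne : (frontier Ω).Nonempty) (d : ℝ) {c : ℝ}
    (hc : 0 < c) (hc1 : c < 1) {s a : ℝ} (ha : a = d - n + 2 - 2 * s) {F : Type*}
    [NormedAddCommGroup F] {f : Euc n → F} (hf : AEStronglyMeasurable f (volume.restrict Ω)) :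
    avNorm Ω d c 2 2 s f < ⊤ ↔ ∫⁻ x in Ω, ‖f x‖ₑ ^ (2 : ℝ) * dw Ω a x < ⊤ := by
  obtain ⟨C, hC⟩ := exists_lintegral_average_comparable hΩ hne hc hc1 a
  obtain ⟨h1, h2⟩ := hC (fun x => ‖f x‖ₑ ^ (2 : ℝ)) (hf.enorm.pow_const _)
  rw [avNorm_of_ne_top hΩ d c 2 s two_ne_zero ENNReal.ofNat_ne_top, ENNReal.toReal_ofNat,
    ENNReal.rpow_lt_top_iff_of_pos (by norm_num)]
  have h3 : ∫⁻ y in Ω, (wAvg Ω c 2 f y * dw Ω (avExp n d 2 s) y) ^ (2 : ℝ) =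
      ∫⁻ y in Ω, (volume (ball y (c * bd Ω y)))⁻¹ *
        (∫⁻ x in ball y (c * bd Ω y), ‖f x‖ₑ ^ (2 : ℝ)) * dw Ω a y := by
    refine lintegral_congr fun y => ?_
    rw [ENNReal.mul_rpow_of_nonneg _ _ zero_le_two, dw_rpow, wAvg,
      eLpNorm_eq_lintegral_rpow_enorm_toReal two_ne_zero ENNReal.ofNat_ne_top,
      ENNReal.toReal_ofNat, ← ENNReal.rpow_mul, lintegral_smul_measure, smul_eq_mul]
    congr 2
    · norm_num
    · rw [ha, avExp, ENNReal.toReal_ofNat]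
      ring
  rw [h3]
  exact ⟨fun h => h1.trans_lt (ENNReal.mul_lt_top ENNReal.coe_lt_top h),
    fun h => h2.trans_lt (ENNReal.mul_lt_top ENNReal.coe_lt_top h)⟩

lemma WeaklyElliptic.adjoint {lam Lam : ℝ} {A : Euc n → Euc n →L[ℝ] Euc n}
    (h : WeaklyElliptic Ω d lam Lam A) :
    WeaklyElliptic Ω d lam Lam fun x => ContinuousLinearMap.adjoint (A x) := by
  refine ⟨h.1, h.2.1, fun v => ?_, fun x hx ξ η => ⟨?_, ?_⟩⟩
  · rw [show (fun x => ContinuousLinearMap.adjoint (A x) v) = fun x =>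
      ∑ i, ⟪A x (EuclideanSpace.basisFun (Fin n) ℝ i), v⟫ • EuclideanSpace.basisFun (Fin n) ℝ i
      from funext fun x => by
        simp_rw [← ContinuousLinearMap.adjoint_inner_right]
        exact ((EuclideanSpace.basisFun (Fin n) ℝ).sum_repr' _).symm]
    exact Finset.measurable_fun_sum _ fun i _ =>
      ((h.2.2.1 _).inner measurable_const).smul_const _
  · rw [ContinuousLinearMap.adjoint_inner_right, real_inner_comm]
    exact (h.2.2.2 x hx ξ 0).1
  · rw [ContinuousLinearMap.adjoint_inner_right, real_inner_comm]
    exact (h.2.2.2 x hx η ξ).2.trans_eq (by ring)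

/-- The pairing identity behind the duality: solutions for `A` and for its adjoint satisfy
`∫ ⟪∇u', δ^{d+1-n} H⟫ = ∫ ⟪∇u, δ^{d+1-n} H'⟫`. -/
lemma PoissonEq.integral_inner_comm (hΩ : IsOpen Ω) (hne : (frontier Ω).Nonempty) {lam Lam : ℝ}
    {A : Euc n → Euc n →L[ℝ] Euc n} (hA : WeaklyElliptic Ω d lam Lam A)
    {u u' : Euc n → ℝ} {g g' H H' : Euc n → Euc n} (h : PoissonEq Ω d A u g H)
    (h' : PoissonEq Ω d (fun x => ContinuousLinearMap.adjoint (A x)) u' g' H')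
    (hu : ∫⁻ x in Ω, ‖u x‖ₑ ^ (2 : ℝ) * dw Ω (d - n - 1) x < ⊤)
    (hg : ∫⁻ x in Ω, ‖g x‖ₑ ^ (2 : ℝ) * dw Ω (d + 1 - n) x < ⊤)
    (hu' : ∫⁻ x in Ω, ‖u' x‖ₑ ^ (2 : ℝ) * dw Ω (d - n - 1) x < ⊤)
    (hg' : ∫⁻ x in Ω, ‖g' x‖ₑ ^ (2 : ℝ) * dw Ω (d + 1 - n) x < ⊤)
    (hH : MemLp (fun x => bd Ω x ^ ((d + 1 - n) / 2) • H x) 2 (volume.restrict Ω))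
    (hH' : MemLp (fun x => bd Ω x ^ ((d + 1 - n) / 2) • H' x) 2 (volume.restrict Ω)) :
    ∫ x in Ω, ⟪g' x, bd Ω x ^ (d + 1 - (n : ℝ)) • H x⟫ =
      ∫ x in Ω, ⟪g x, bd Ω x ^ (d + 1 - (n : ℝ)) • H' x⟫ := by
  set b := (d + 1 - n) / 2 with hb
  have h2b : 2 * b = d + 1 - n := mul_div_cancel₀ _ two_ne_zero
  have hdata : ∀ K : Euc n → Euc n,
      MemLp (fun x => bd Ω x ^ b • K x) 2 (volume.restrict Ω) →
      MemLp (fun x => bd Ω x ^ (-b) • bd Ω x ^ (d + 1 - (n : ℝ)) • K x) 2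
        (volume.restrict Ω) := fun K hK => by
    refine (memLp_congr_ae ?_).1 hK
    filter_upwards [ae_restrict_mem hΩ.measurableSet] with x hx
    rw [smul_smul, ← Real.rpow_add (bd_pos hΩ hne hx), ← h2b]
    congr 2
    ring
  have hflux : ∀ {B : Euc n → Euc n →L[ℝ] Euc n}, WeaklyElliptic Ω d lam Lam B →
      ∀ {v : Euc n → Euc n}, AEStronglyMeasurable v (volume.restrict Ω) →
      ∫⁻ x in Ω, ‖v x‖ₑ ^ (2 : ℝ) * dw Ω (d + 1 - n) x < ⊤ →
      MemLp (fun x => bd Ω x ^ (-b) • B x (v x)) 2 (volume.restrict Ω) := fun hB v hv hvf =>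
    memLp_apply_of_norm_le hΩ hne (memLp_two_bd_rpow_smul hΩ hne hv (by rwa [h2b]))
      (aestronglyMeasurable_clm_apply hB.2.2.1 hv)
      fun x hx => by rw [h2b]; exact hB.norm_apply_le hx _
  have hgm := h.1.aestronglyMeasurable_right
  have hgm' := h'.1.aestronglyMeasurable_right
  calc ∫ x in Ω, ⟪g' x, bd Ω x ^ (d + 1 - (n : ℝ)) • H x⟫
      = ∫ x in Ω, ⟪g' x, A x (g x)⟫ :=
        (h'.1.integral_inner_congr hΩ hne hu' hg' (hflux hA hgm hg) (hdata H hH) h.2.2).symm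
    _ = ∫ x in Ω, ⟪g x, ContinuousLinearMap.adjoint (A x) (g' x)⟫ := by
        refine integral_congr_ae (.of_forall fun x => ?_)
        exact (real_inner_comm _ _).trans (ContinuousLinearMap.adjoint_inner_right _ _ _).symm
    _ = _ := h.1.integral_inner_congr hΩ hne hu hg (hflux hA.adjoint hgm' hg') (hdata H' hH')
        h'.2.2

lemma ofReal_integral_inner_le (hΩ : IsOpen Ω) (hne : (frontier Ω).Nonempty) (a : ℝ)
    (g H : Euc n → Euc n) :
    ENNReal.ofReal (∫ x in Ω, ⟪g x, bd Ω x ^ a • H x⟫) ≤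
      ∫⁻ x in Ω, ‖g x‖ₑ * ‖H x‖ₑ * dw Ω a x := by
  calc ENNReal.ofReal (∫ x in Ω, ⟪g x, bd Ω x ^ a • H x⟫)
      ≤ ‖∫ x in Ω, ⟪g x, bd Ω x ^ a • H x⟫‖ₑ := Real.ofReal_le_enorm _
    _ ≤ ∫⁻ x in Ω, ‖⟪g x, bd Ω x ^ a • H x⟫‖ₑ := enorm_integral_le_lintegral_enorm _
    _ ≤ _ := by
      refine setLIntegral_mono' hΩ.measurableSet fun x hx => ?_
      calc ‖⟪g x, bd Ω x ^ a • H x⟫‖ₑ ≤ ‖g x‖ₑ * ‖bd Ω x ^ a • H x‖ₑ := by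
            rw [← ofReal_norm, ← ofReal_norm, ← ofReal_norm, ← ENNReal.ofReal_mul (norm_nonneg _)]
            exact ENNReal.ofReal_le_ofReal (norm_inner_le_norm _ _)
        _ = _ := by rw [enorm_bd_rpow_smul (bd_pos hΩ hne hx)]; ring

lemma PoissonEq.aestronglyMeasurable_datum (hΩ : IsOpen Ω) (hne : (frontier Ω).Nonempty)
    {A : Euc n → Euc n →L[ℝ] Euc n} {u : Euc n → ℝ} {g H : Euc n → Euc n}
    (h : PoissonEq Ω d A u g H) : AEStronglyMeasurable H (volume.restrict Ω) := by
  refine (aestronglyMeasurable_bd_rpow_smul (Ω := Ω) (-(d + 1 - (n : ℝ)))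
    h.2.1.aestronglyMeasurable).congr ?_
  filter_upwards [ae_restrict_mem hΩ.measurableSet] with x hx
  rw [smul_smul, ← Real.rpow_add (bd_pos hΩ hne hx), neg_add_cancel, Real.rpow_zero, one_smul]

lemma locallyIntegrableOn_bd_rpow_smul (hΩ : IsOpen Ω) (hne : (frontier Ω).Nonempty)
    {a b : ℝ} {f : Euc n → Euc n} (hf : AEStronglyMeasurable f (volume.restrict Ω))
    (hfb : ∫⁻ x in Ω, ‖f x‖ₑ ^ (2 : ℝ) * dw Ω b x < ⊤) :
    LocallyIntegrableOn (fun x => bd Ω x ^ a • f x) Ω volume := by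
  refine locallyIntegrableOn_of_lintegral_dw hΩ hne (a := b - 2 * a)
    (aestronglyMeasurable_bd_rpow_smul a hf) ?_
  rw [setLIntegral_congr_fun (g := fun x => ‖f x‖ₑ ^ (2 : ℝ) * dw Ω b x) hΩ.measurableSet]
  · exact hfb
  intro x hx
  have hδ := bd_pos hΩ hne hx
  simp only
  rw [enorm_bd_rpow_smul hδ, ENNReal.mul_rpow_of_nonneg _ _ zero_le_two, dw_rpow, mul_right_comm,
    ← dw_add hδ, mul_comm]
  congr 2
  ring

end Duality

/-- duality of compatible solvability: `L` and `L^*`. -/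
theorem statement_17 (n : ℕ) (d : ℝ) (hd0 : 0 < d) (hdn : d < n)
    (Ω : Set (Euc n)) (hΩ : IsOpen Ω) (A₀ : ℝ)
    (hahl : AhlforsRegular d A₀ (frontier Ω)) (hjohn : WeakLocalJohn Ω d)
    (hunb : ¬ Bornology.IsBounded Ωᶜ)
    (lam0 Lam0 : ℝ) (A : Euc n → Euc n →L[ℝ] Euc n)
    (hell : WeaklyElliptic Ω d lam0 Lam0 A)
    (p p' β β' : ℝ≥0∞) (s : ℝ) (hp : 1 ≤ p) (hβ : 1 ≤ β)
    (hpc : 1 / p + 1 / p' = 1) (hβc : 1 / β + 1 / β' = 1)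
    (hsolv : CompatSolvable Ω d A β p s) :
    CompatSolvable Ω d (fun x => ContinuousLinearMap.adjoint (A x)) β' p' (1 - s) := by
  obtain ⟨C, c, hC, hc, hc1, hsolv⟩ := hsolv
  have hne := hahl.1
  obtain ⟨Cp, hCp⟩ := exists_lintegral_mul_le_avNorm_mul_avNorm (E := Euc n) (F := Euc n)
    hΩ hne d hc hc1 hβc hpc s
  obtain ⟨Cd, hCd⟩ := exists_avNorm_le_of_dual hΩ hne d hc hc1 hβc hpc s
  refine ⟨Cd * (Cp * C) + 1, c, by positivity, hc, hc1, fun H' u' g' _ hH'₂ hg'₂ hu'₂ h' => ?_⟩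
  have henergy : ∀ {f : Euc n → Euc n}, AEStronglyMeasurable f (volume.restrict Ω) →
      (avNorm Ω d c 2 2 (1 / 2) f < ⊤ ↔
        ∫⁻ x in Ω, ‖f x‖ₑ ^ (2 : ℝ) * dw Ω (d + 1 - n) x < ⊤) := fun hf =>
    avNorm_two_lt_top_iff hΩ hne d hc hc1 (by ring) hf
  have henergy₀ : ∀ {f : Euc n → ℝ}, AEStronglyMeasurable f (volume.restrict Ω) →
      (avNorm Ω d c 2 2 (1 / 2 + 1) f < ⊤ ↔
        ∫⁻ x in Ω, ‖f x‖ₑ ^ (2 : ℝ) * dw Ω (d - n - 1) x < ⊤) := fun hf =>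
    avNorm_two_lt_top_iff hΩ hne d hc hc1 (by ring) hf
  have h2b : 2 * ((d + 1 - n) / 2) = d + 1 - n := mul_div_cancel₀ _ two_ne_zero
  have hH'm := h'.aestronglyMeasurable_datum hΩ hne
  have hH'L : MemLp (fun x => bd Ω x ^ ((d + 1 - n) / 2) • H' x) 2 (volume.restrict Ω) :=
    memLp_two_bd_rpow_smul hΩ hne hH'm (by rw [h2b]; exact (henergy hH'm).1 hH'₂)
  have hg' := (henergy h'.1.aestronglyMeasurable_right).1 hg'₂
  have hu' := (henergy₀ h'.1.aestronglyMeasurable_left).1 hu'₂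
  calc avNorm Ω d c β' p' (1 - s) g'
      ≤ Cd * (Cp * ENNReal.ofReal C * avNorm Ω d c β' p' (1 - s) H') := by
        refine hCd g' _ h'.1.aestronglyMeasurable_right fun H hH => ?_
        have hHm : AEStronglyMeasurable H (volume.restrict Ω) := hH.1.aestronglyMeasurable
        have hH₂ : avNorm Ω d c 2 2 (1 / 2) H < ⊤ :=
          hH.avNorm_lt_top hΩ hne d hc hc1 one_le_two one_le_two (1 / 2)
        have hHe := (henergy hHm).1 hH₂
        have hHL : MemLp (fun x => bd Ω x ^ ((d + 1 - n) / 2) • H x) 2 (volume.restrict Ω) :=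
          memLp_two_bd_rpow_smul hΩ hne hHm (by rwa [h2b])
        obtain ⟨u, g, hug, hu, hg, hsol⟩ := exists_weak_solution hΩ hdn hahl hjohn hunb hell hHL
        have h : PoissonEq Ω d A u g H :=
          ⟨hug, locallyIntegrableOn_bd_rpow_smul hΩ hne hHm hHe, hsol⟩
        have hle := hsolv H u g (hH.avNorm_lt_top hΩ hne d hc hc1 hβ hp s) hH₂
          ((henergy hug.aestronglyMeasurable_right).2 hg)
          ((henergy₀ hug.aestronglyMeasurable_left).2 hu) h
        rw [h.integral_inner_comm hΩ hne hell h' hu hg hu' hg' hHL hH'L]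
        calc ENNReal.ofReal (∫ x in Ω, ⟪g x, bd Ω x ^ (d + 1 - (n : ℝ)) • H' x⟫)
            ≤ Cp * (avNorm Ω d c β p s g * avNorm Ω d c β' p' (1 - s) H') :=
              (ofReal_integral_inner_le hΩ hne _ g H').trans
                (hCp g H' hug.aestronglyMeasurable_right hH'm)
          _ ≤ Cp * (ENNReal.ofReal C * avNorm Ω d c β p s H *
                avNorm Ω d c β' p' (1 - s) H') := by gcongr
          _ = _ := by ring
    _ = ENNReal.ofReal (Cd * (Cp * C)) * avNorm Ω d c β' p' (1 - s) H' := by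
        rw [ENNReal.ofReal_mul NNReal.zero_le_coe, ENNReal.ofReal_mul NNReal.zero_le_coe,
          ENNReal.ofReal_coe_nnreal, ENNReal.ofReal_coe_nnreal]
        ring
    _ ≤ _ := by
        gcongr
        linarith

end Paper
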